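/- arXiv:1710.08486 — 4 statements merged into one kernel-verified Lean document; each statement's English description precedes it below -/
import Mathlib

section
/- Every simple graph G on n vertices satisfies π₃(G) ≤ 9n²/16; that is, the edges of G can be decomposed into copies of K₂ and K₃ (complete subgraphs C₁, …, C_ℓ of order two or three) with |C₁| + ⋯ + |C_ℓ| ≤ 9n²/16. -/
/-- `D = (C_1, …, C_ℓ)` is a decomposition of the edges of `G` into complete subgraphs:
each part is a clique of `G` with at least two vertices, and every edge of `G`
lies in exactly one part. -/
def IsCliqueDecomp {V : Type*} (G : SimpleGraph V) {ℓ : ℕ} (D : Fin ℓ → Finset V) : Prop :=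
  (∀ i, G.IsClique (D i : Set V) ∧ 2 ≤ (D i).card) ∧
  ∀ u v : V, G.Adj u v → ∃! i, u ∈ D i ∧ v ∈ D i

open Finset in
/-- Goodman's bound: a graph with `S` ordered adjacent pairs and `T` ordered triangles satisfies
`S * (2 * S - n ^ 2) ≤ n * T`. -/
theorem goodman_bound {V : Type*} [Fintype V] [DecidableEq V] (G : SimpleGraph V)
    [DecidableRel G.Adj] :
    (#{p : V × V | G.Adj p.1 p.2} : ℝ) *
        (2 * #{p : V × V | G.Adj p.1 p.2} - (Fintype.card V : ℝ) ^ 2) ≤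
      Fintype.card V *
        #{p : V × V × V | G.Adj p.1 p.2.1 ∧ G.Adj p.1 p.2.2 ∧ G.Adj p.2.1 p.2.2} := by
  set a : V → V → ℝ := fun u v ↦ if G.Adj u v then 1 else 0 with ha
  set N : ℝ := ((Fintype.card V : ℕ) : ℝ) with hN
  set d : V → ℝ := fun u ↦ ∑ v, a u v with hd
  have symm : ∀ u v, a u v = a v u := fun u v ↦ by simp [ha, G.adj_comm]
  have hS : (#{p : V × V | G.Adj p.1 p.2} : ℝ) = ∑ u, d u := by
    rw [card_filter, Nat.cast_sum, Fintype.sum_prod_type]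
    simp [hd, ha]
  have hT : (#{p : V × V × V | G.Adj p.1 p.2.1 ∧ G.Adj p.1 p.2.2 ∧ G.Adj p.2.1 p.2.2} : ℝ) =
      ∑ u, ∑ v, ∑ w, a u v * (a u w * a v w) := by
    rw [card_filter, Nat.cast_sum, Fintype.sum_prod_type]
    refine sum_congr rfl fun u _ ↦ ?_
    rw [Fintype.sum_prod_type]
    refine sum_congr rfl fun v _ ↦ sum_congr rfl fun w _ ↦ ?_
    by_cases h₁ : G.Adj u v <;> by_cases h₂ : G.Adj u w <;> by_cases h₃ : G.Adj v w <;>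
      simp [ha, h₁, h₂, h₃]
  have hlow : ∑ u, ∑ v, a u v * (d u + d v - N) ≤ ∑ u, ∑ v, ∑ w, a u v * (a u w * a v w) := by
    refine sum_le_sum fun u _ ↦ sum_le_sum fun v _ ↦ ?_
    have : d u + d v - N = ∑ w, (a u w + a v w - 1) := by
      simp [hd, hN, sum_add_distrib]
    rw [this, mul_sum]
    refine sum_le_sum fun w _ ↦ ?_
    by_cases h₁ : G.Adj u v <;> by_cases h₂ : G.Adj u w <;> by_cases h₃ : G.Adj v w <;>
      simp [ha, h₁, h₂, h₃]
  have hleft : ∑ u, ∑ v, a u v * d u = ∑ u, d u ^ 2 :=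
    sum_congr rfl fun u _ ↦ by rw [← sum_mul, sq]
  have hright : ∑ u, ∑ v, a u v * d v = ∑ u, d u ^ 2 := by
    rw [sum_comm, ← hleft]
    exact sum_congr rfl fun u _ ↦ sum_congr rfl fun v _ ↦ by rw [symm]
  have hexp : ∑ u, ∑ v, a u v * (d u + d v - N) = 2 * ∑ u, d u ^ 2 - N * ∑ u, d u := by
    simp only [mul_sub, mul_add, sum_sub_distrib, sum_add_distrib, hleft, hright]
    simp only [← sum_mul, hd]
    ring
  have hcs : (∑ u, d u) ^ 2 ≤ N * ∑ u, d u ^ 2 := by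
    simpa [hN] using sq_sum_le_card_mul_sum_sq (s := univ) (f := d)
  rw [hS, hT]
  have hN0 : 0 ≤ N := by positivity
  have := mul_le_mul_of_nonneg_left (hexp ▸ hlow) hN0
  nlinarith

open Finset in
/-- There are at most six ordered triangles for each triangle. -/
theorem card_ordered_triangles_le {V : Type*} [Fintype V] [DecidableEq V] (G : SimpleGraph V)
    [DecidableRel G.Adj] :
    #{p : V × V × V | G.Adj p.1 p.2.1 ∧ G.Adj p.1 p.2.2 ∧ G.Adj p.2.1 p.2.2} ≤
      6 * #(G.cliqueFinset 3) := by
  refine card_le_mul_card_image_of_maps_to (f := fun p : V × V × V ↦ ({p.1, p.2.1, p.2.2} : Finset V))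
    (fun p hp ↦ ?_) 6 fun t ht ↦ ?_
  · rw [SimpleGraph.mem_cliqueFinset_iff, SimpleGraph.is3Clique_triple_iff]
    simpa using hp
  · rw [SimpleGraph.mem_cliqueFinset_iff, SimpleGraph.is3Clique_iff] at ht
    obtain ⟨x, y, z, hxy, hxz, hyz, rfl⟩ := ht
    refine (card_le_card (t := {(x, y, z), (x, z, y), (y, x, z), (y, z, x), (z, x, y),
      (z, y, x)}) ?_).trans card_le_six
    rintro ⟨u, v, w⟩ hp
    simp only [mem_filter, mem_univ, true_and] at hp
    obtain ⟨⟨huv, huw, hvw⟩, h⟩ := hp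
    have hu : u ∈ ({x, y, z} : Finset V) := h ▸ by simp
    have hv : v ∈ ({x, y, z} : Finset V) := h ▸ by simp
    have hw : w ∈ ({x, y, z} : Finset V) := h ▸ by simp
    have := huv.ne
    have := huw.ne
    have := hvw.ne
    clear h
    simp only [mem_insert, mem_singleton, Prod.mk.injEq] at hu hv hw ⊢
    grind

open Finset in
/-- Some class of triangles with a fixed vertex sum modulo `n` contains at least a `1 / n` fraction
of all triangles; such a class is edge-disjoint. -/
theorem exists_edge_disjoint_triangles {n : ℕ} [NeZero n] (G : SimpleGraph (Fin n))
    [DecidableRel G.Adj] :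
    ∃ P ⊆ G.cliqueFinset 3, #(G.cliqueFinset 3) ≤ n * #P ∧
      ∀ s ∈ P, ∀ t ∈ P, ∀ u v, u ≠ v → u ∈ s → v ∈ s → u ∈ t → v ∈ t → s = t := by
  obtain ⟨c, -, hc⟩ := exists_max_image (univ : Finset (Fin n))
    (fun c ↦ #{t ∈ G.cliqueFinset 3 | ∑ x ∈ t, x = c}) ⟨0, mem_univ _⟩
  refine ⟨{t ∈ G.cliqueFinset 3 | ∑ x ∈ t, x = c}, filter_subset _ _, ?_, ?_⟩
  · rw [card_eq_sum_card_fiberwise (f := fun t : Finset (Fin n) ↦ ∑ x ∈ t, x) (t := univ)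
      (fun _ _ ↦ by simp)]
    simpa using sum_le_card_nsmul _ _ _ hc
  · have third : ∀ s : Finset (Fin n), #s = 3 → ∀ u v, u ≠ v → u ∈ s → v ∈ s →
        ∃ w, s = {u, v, w} ∧ ∑ x ∈ s, x = u + v + w := by
      intro s hs u v huv hu hv
      have h₁ : #((s.erase u).erase v) = 1 := by
        rw [card_erase_of_mem (mem_erase.2 ⟨huv.symm, hv⟩), card_erase_of_mem hu, hs]
      obtain ⟨w, hw⟩ := card_eq_one.1 h₁
      refine ⟨w, ?_, ?_⟩
      · rw [← hw, insert_erase (mem_erase.2 ⟨huv.symm, hv⟩), insert_erase hu]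
      · rw [← add_sum_erase s _ hu, ← add_sum_erase _ _ (mem_erase.2 ⟨huv.symm, hv⟩), hw,
          sum_singleton, add_assoc]
    intro s hs t ht u v huv hus hvs hut hvt
    simp only [mem_filter, SimpleGraph.mem_cliqueFinset_iff] at hs ht
    obtain ⟨w, rfl, hw⟩ := third s hs.1.card_eq u v huv hus hvs
    obtain ⟨w', rfl, hw'⟩ := third t ht.1.card_eq u v huv hut hvt
    have : w = w' := add_left_cancel (a := u + v) (by rw [← hw, ← hw', hs.2, ht.2])
    rw [this]

open Finset in
/-- An edge-disjoint family `P` of triangles extends to a decomposition into edges and triangles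
of total order at most the number of ordered adjacent pairs minus `3 * #P`. -/
theorem exists_decomp_of_edge_disjoint_triangles {n : ℕ} (G : SimpleGraph (Fin n))
    [DecidableRel G.Adj] (P : Finset (Finset (Fin n))) (hP : P ⊆ G.cliqueFinset 3)
    (hdisj : ∀ s ∈ P, ∀ t ∈ P, ∀ u v, u ≠ v → u ∈ s → v ∈ s → u ∈ t → v ∈ t → s = t) :
    ∃ (ℓ : ℕ) (D : Fin ℓ → Finset (Fin n)), IsCliqueDecomp G D ∧
      (∀ i, #(D i) = 2 ∨ #(D i) = 3) ∧
      ∑ i, #(D i) + 3 * #P ≤ #{p : Fin n × Fin n | G.Adj p.1 p.2} := by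
  set R : Finset (Finset (Fin n)) := {t ∈ G.cliqueFinset 2 | ∀ s ∈ P, ¬ t ⊆ s} with hR
  have hP3 : ∀ t ∈ P, G.IsNClique 3 t := fun t ht ↦ by simpa using hP ht
  have hR2 : ∀ t ∈ R, G.IsNClique 2 t := fun t ht ↦ by
    simpa using (mem_filter.1 ht).1
  have hPR : Disjoint P R := disjoint_left.2 fun t ht ht' ↦ (mem_filter.1 ht').2 t ht subset_rfl
  have eq_pair : ∀ t ∈ R, ∀ u v, u ≠ v → u ∈ t → v ∈ t → t = {u, v} := by
    intro t ht u v huv hu hv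
    refine (eq_of_subset_of_card_le (by simp [insert_subset_iff, hu, hv]) ?_).symm
    rw [(hR2 t ht).card_eq, card_pair huv]
  have not_both : ∀ s ∈ P, ∀ t ∈ R, ∀ u v, u ≠ v → u ∈ s → v ∈ s → u ∈ t → v ∈ t → False := by
    intro s hs t ht u v huv hus hvs hut hvt
    refine (mem_filter.1 ht).2 s hs ?_
    rw [eq_pair t ht u v huv hut hvt]
    simp [insert_subset_iff, hus, hvs]
  have huniq : ∀ s ∈ P ∪ R, ∀ t ∈ P ∪ R, ∀ u v, u ≠ v →
      u ∈ s → v ∈ s → u ∈ t → v ∈ t → s = t := by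
    intro s hs t ht u v huv hus hvs hut hvt
    rcases mem_union.1 hs with hs | hs <;> rcases mem_union.1 ht with ht | ht
    · exact hdisj s hs t ht u v huv hus hvs hut hvt
    · exact (not_both s hs t ht u v huv hus hvs hut hvt).elim
    · exact (not_both t ht s hs u v huv hut hvt hus hvs).elim
    · rw [eq_pair s hs u v huv hus hvs, eq_pair t ht u v huv hut hvt]
  have hex : ∀ u v, G.Adj u v → ∃ t ∈ P ∪ R, u ∈ t ∧ v ∈ t := by
    intro u v huv
    by_cases h : ∃ s ∈ P, u ∈ s ∧ v ∈ s
    · obtain ⟨s, hs, hus⟩ := h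
      exact ⟨s, mem_union_left _ hs, hus⟩
    · refine ⟨{u, v}, mem_union_right _ ?_, by simp, by simp⟩
      simp only [hR, mem_filter, SimpleGraph.mem_cliqueFinset_iff]
      refine ⟨⟨by simp [huv], card_pair huv.ne⟩, fun s hs hsub ↦ h ?_⟩
      exact ⟨s, hs, hsub (by simp), hsub (by simp)⟩
  have hclique : ∀ t ∈ P ∪ R, G.IsClique (t : Set (Fin n)) ∧ (#t = 2 ∨ #t = 3) := by
    intro t ht
    rcases mem_union.1 ht with ht | ht
    · exact ⟨(hP3 t ht).isClique, .inr (hP3 t ht).card_eq⟩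
    · exact ⟨(hR2 t ht).isClique, .inl (hR2 t ht).card_eq⟩
  have hpairs : ∑ t ∈ P ∪ R, #t.offDiag ≤ #{p : Fin n × Fin n | G.Adj p.1 p.2} := by
    rw [← card_biUnion]
    · refine card_le_card fun p hp ↦ ?_
      simp only [mem_biUnion, mem_offDiag] at hp
      obtain ⟨t, ht, h₁, h₂, hne⟩ := hp
      simpa using (hclique t ht).1 h₁ h₂ hne
    · intro s hs t ht hst
      refine disjoint_left.2 fun p hp hp' ↦ hst ?_
      rw [mem_offDiag] at hp hp'
      exact huniq s hs t ht p.1 p.2 hp.2.2 hp.1 hp.2.1 hp'.1 hp'.2.1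
  have hsum : ∑ t ∈ P ∪ R, #t + 3 * #P = ∑ t ∈ P ∪ R, #t.offDiag := by
    have h₁ : ∀ t ∈ P, #t.offDiag = 6 := fun t ht ↦ by rw [offDiag_card, (hP3 t ht).card_eq]
    have h₂ : ∀ t ∈ R, #t.offDiag = 2 := fun t ht ↦ by rw [offDiag_card, (hR2 t ht).card_eq]
    rw [sum_union hPR, sum_union hPR, sum_congr rfl h₁, sum_congr rfl h₂,
      sum_congr rfl fun t ht ↦ (hP3 t ht).card_eq, sum_congr rfl fun t ht ↦ (hR2 t ht).card_eq]
    simp only [sum_const, smul_eq_mul]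
    ring
  set e := (P ∪ R).equivFin
  refine ⟨_, fun i ↦ (e.symm i : Finset (Fin n)), ⟨fun i ↦ ?_, fun u v huv ↦ ?_⟩, fun i ↦ ?_, ?_⟩
  · obtain ⟨h₁, h₂⟩ := hclique _ (e.symm i).2
    exact ⟨h₁, by rcases h₂ with h | h <;> simp [h]⟩
  · obtain ⟨t, ht, hut, hvt⟩ := hex u v huv
    refine ⟨e ⟨t, ht⟩, by simpa using ⟨hut, hvt⟩, fun j hj ↦ ?_⟩
    rw [← e.symm_apply_eq]
    exact Subtype.ext (huniq _ (e.symm j).2 t ht u v huv.ne hj.1 hj.2 hut hvt)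
  · exact (hclique _ (e.symm i).2).2
  · rw [Equiv.sum_comp e.symm (fun t ↦ #(t : Finset (Fin n))), sum_coe_sort (P ∪ R) card, hsum]
    exact hpairs

/-- Every graph `G` on `n` vertices satisfies `π₃(G) ≤ 9n²/16`: the edges of `G` can be
decomposed into copies of `K₂` and `K₃` whose orders sum to at most `9n²/16`. -/
theorem gyori_tuza :
    ∀ (n : ℕ) (G : SimpleGraph (Fin n)),
      ∃ (ℓ : ℕ) (D : Fin ℓ → Finset (Fin n)), IsCliqueDecomp G D ∧
        (∀ i, (D i).card = 2 ∨ (D i).card = 3) ∧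
        (∑ i, ((D i).card : ℝ)) ≤ 9 * (n : ℝ) ^ 2 / 16 := by
  classical
  intro n G
  rcases Nat.eq_zero_or_pos n with rfl | hn
  · exact ⟨0, Fin.elim0, ⟨fun i ↦ i.elim0, fun u ↦ u.elim0⟩, fun i ↦ i.elim0, by simp⟩
  have : NeZero n := ⟨hn.ne'⟩
  obtain ⟨P, hP, hcard, hdisj⟩ := exists_edge_disjoint_triangles G
  obtain ⟨ℓ, D, hD, h23, hsum⟩ := exists_decomp_of_edge_disjoint_triangles G P hP hdisj
  refine ⟨ℓ, D, hD, h23, ?_⟩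
  have hgood := goodman_bound G
  have hT : ((Finset.card {p : Fin n × Fin n × Fin n |
      G.Adj p.1 p.2.1 ∧ G.Adj p.1 p.2.2 ∧ G.Adj p.2.1 p.2.2} : ℕ) : ℝ) ≤ 6 * (n * P.card) := by
    exact_mod_cast (card_ordered_triangles_le G).trans (Nat.mul_le_mul_left 6 hcard)
  have hsum' : (∑ i, ((D i).card : ℝ)) + 3 * P.card ≤
      (Finset.card {p : Fin n × Fin n | G.Adj p.1 p.2} : ℕ) := by
    exact_mod_cast hsum
  rw [Fintype.card_fin] at hgood
  set S : ℝ := ((Finset.card {p : Fin n × Fin n | G.Adj p.1 p.2} : ℕ) : ℝ)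
  have hn' : (0 : ℝ) < n := by exact_mod_cast hn
  have hSP : S * (2 * S - (n : ℝ) ^ 2) ≤ (n : ℝ) ^ 2 * (6 * P.card) := by
    nlinarith [mul_le_mul_of_nonneg_left hT hn'.le]
  have hcost : S - 3 * P.card ≤ 9 * (n : ℝ) ^ 2 / 16 := by
    refine le_of_mul_le_mul_left ?_ (pow_pos hn' 2)
    nlinarith [sq_nonneg (S - 3 * (n : ℝ) ^ 2 / 4)]
  linarith
end

section
/- Every K₄-free simple graph on n vertices with at least ⌊n²/4⌋ + k edges contains at least k pairwise edge-disjoint triangles. -/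
namespace TrianglePacking

section BoolMatrices

/-- The number of `true` entries of a Boolean matrix. -/
abbrev bitSum {m n : ℕ} (p : Fin m → Fin n → Bool) : ℤ := ∑ i, ∑ j, (p i j).toInt

/-- No two rows and two columns carry only `true`. -/
abbrev NoSquare {m n : ℕ} (p : Fin m → Fin n → Bool) : Prop :=
  ∀ i i', i < i' → ∀ j j', j < j' → (p i j && p i j' && p i' j && p i' j') = false

/-- Some entry of the vector is `false`. -/
abbrev NoFull {m : ℕ} (x : Fin m → Bool) : Prop := ∃ i, x i = false

/-- A vertex with adjacency vectors `x` and `y` to two cliques joined according to `p` spans no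
`K₄` with two vertices of one clique and one vertex of the other. -/
abbrev NoCone {m n : ℕ} (p : Fin m → Fin n → Bool) (x : Fin m → Bool) (y : Fin n → Bool) : Prop :=
  (∀ i i', i < i' → ∀ j, (p i j && p i' j && x i && x i' && y j) = false) ∧
  (∀ i, ∀ j j', j < j' → (p i j && p i j' && x i && y j && y j') = false)

/-- The number of pairs of `true` entries of `x` and `y` that are joined according to `p`. -/
abbrev coneSum {m n : ℕ} (p : Fin m → Fin n → Bool) (x : Fin m → Bool) (y : Fin n → Bool) : ℤ :=
  ∑ i, ∑ j, (p i j && x i && y j).toInt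

/-- The sum of `x i + y j - 1` over all `false` entries of `p` whose row and column both contain
exactly two `true` entries. -/
abbrev bitSurplus {m n : ℕ} (p : Fin m → Fin n → Bool) (x : Fin m → Bool) (y : Fin n → Bool) : ℤ :=
  ∑ i, ∑ j, if p i j = false ∧ ∑ j', (p i j').toInt = 2 ∧ ∑ i', (p i' j).toInt = 2 then
    (x i).toInt + (y j).toInt - 1 else 0

theorem forall_fin_three_fun {α : Type*} {P : (Fin 3 → α) → Prop} :
    (∀ x, P x) ↔ ∀ a b c, P ![a, b, c] := by
  refine ⟨fun h a b c => h _, fun h x => ?_⟩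
  convert h (x 0) (x 1) (x 2) using 1
  ext i; fin_cases i <;> rfl

theorem forall_fin_two_fun {α : Type*} {P : (Fin 2 → α) → Prop} :
    (∀ x, P x) ↔ ∀ a b, P ![a, b] := by
  refine ⟨fun h a b => h _, fun h x => ?_⟩
  convert h (x 0) (x 1) using 1
  ext i; fin_cases i <;> rfl

set_option maxRecDepth 100000

theorem bitSum_three_three_le : ∀ p : Fin 3 → Fin 3 → Bool, NoSquare p →
    (∀ i, NoFull (p i)) → (∀ j, NoFull fun i => p i j) → bitSum p ≤ 6 := by
  simp only [forall_fin_three_fun (α := Fin 3 → Bool), forall_fin_three_fun (α := Bool)]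
  decide +kernel

theorem bitSum_three_two_le : ∀ p : Fin 3 → Fin 2 → Bool, NoSquare p →
    (∀ j, NoFull fun i => p i j) → bitSum p ≤ 4 := by
  simp only [forall_fin_three_fun (α := Fin 2 → Bool), forall_fin_two_fun (α := Bool)]
  decide +kernel

theorem bitSum_two_two_le : ∀ p : Fin 2 → Fin 2 → Bool, NoSquare p → bitSum p ≤ 3 := by
  simp only [forall_fin_two_fun (α := Fin 2 → Bool), forall_fin_two_fun (α := Bool)]
  decide +kernel

theorem sum_le_coneSum_three_two : ∀ p : Fin 3 → Fin 2 → Bool, NoSquare p →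
    (∀ j, NoFull fun i => p i j) → bitSum p = 4 →
    ∀ (x : Fin 3 → Bool) (y : Fin 2 → Bool), NoFull x → NoCone p x y →
    ∑ i, (x i).toInt + ∑ j, (y j).toInt ≤ coneSum p x y + 2 := by
  simp only [forall_fin_three_fun (α := Fin 2 → Bool), forall_fin_three_fun (α := Bool),
    forall_fin_two_fun (α := Bool)]
  decide +kernel

theorem sum_le_coneSum_three_three : ∀ p : Fin 3 → Fin 3 → Bool, NoSquare p →
    (∀ i, NoFull (p i)) → (∀ j, NoFull fun i => p i j) → 5 ≤ bitSum p →
    ∀ (x : Fin 3 → Bool) (y : Fin 3 → Bool), NoFull x → NoFull y → NoCone p x y →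
    bitSum p + ∑ i, (x i).toInt + ∑ j, (y j).toInt ≤ coneSum p x y + 8 ∧
    (bitSum p = 5 →
      2 * (∑ i, (x i).toInt + ∑ j, (y j).toInt) + 1 + bitSurplus p x y ≤
        2 * coneSum p x y + 6) := by
  simp only [forall_fin_three_fun (α := Fin 3 → Bool), forall_fin_three_fun (α := Bool)]
  decide +kernel

theorem abs_bitSurplus_le_one : ∀ p : Fin 3 → Fin 3 → Bool, NoSquare p →
    (∀ i, NoFull (p i)) → (∀ j, NoFull fun i => p i j) → bitSum p = 5 →
    ∀ (x : Fin 3 → Bool) (y : Fin 3 → Bool), |bitSurplus p x y| ≤ 1 := by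
  simp only [forall_fin_three_fun (α := Fin 3 → Bool), forall_fin_three_fun (α := Bool)]
  decide +kernel

theorem exists_of_three_two_two : ∀ p : Fin 3 → Fin 2 → Bool, bitSum p = 3 →
    (∀ j, NoFull fun i => p i j) → ∀ q : Fin 3 → Fin 2 → Bool, bitSum q = 3 →
    (∀ j, NoFull fun i => q i j) → ∀ r : Fin 2 → Fin 2 → Bool, bitSum r = 3 →
    (∀ i j k, (p i j && q i k && r j k) = false) →
    (∃ i, (p i 0 && p i 1) = true) ∧
    ∃ i j, (∀ i', p i' j = decide (i' ≠ i)) ∧ (∀ k, q i k = true) ∧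
      ∀ j', j' ≠ j → ∀ k, r j' k = true := by
  simp only [forall_fin_three_fun (α := Fin 2 → Bool), forall_fin_two_fun (α := Fin 2 → Bool),
    forall_fin_two_fun (α := Bool)]
  decide +kernel

set_option synthInstance.maxHeartbeats 200000 in
set_option synthInstance.maxSize 1000 in
theorem exists_coloring_of_two_two_two : ∀ p : Fin 2 → Fin 2 → Bool, NoSquare p →
    ∀ q : Fin 2 → Fin 2 → Bool, NoSquare q → ∀ r : Fin 2 → Fin 2 → Bool, NoSquare r →
    (∀ j k, (p 0 j && p 1 j && q 0 k && q 1 k && r j k) = false) →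
    (∀ i k, (p i 0 && p i 1 && q i k && r 0 k && r 1 k) = false) →
    (∀ i j, (p i j && q i 0 && q i 1 && r j 0 && r j 1) = false) →
    ∑ i, ∑ j, ∑ k, (p i j && q i k && r j k).toInt + 6 < bitSum p + bitSum q + bitSum r →
    ∃ f g h : Fin 2 → Bool, (∀ i j, f i = g j → p i j = true) ∧
      (∀ i k, f i = h k → q i k = true) ∧ (∀ j k, g j = h k → r j k = true) := by
  simp only [forall_fin_two_fun (α := Fin 2 → Bool), forall_fin_two_fun (α := Bool)]
  decide +kernel

end BoolMatrices

open Finset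

section Counting

variable {V : Type*} (G : SimpleGraph V)

open Classical in
/-- The adjacency relation as a Boolean. -/
noncomputable def adjBit (u v : V) : Bool := decide (G.Adj u v)

/-- The number of neighbours of `v` in `A`. -/
noncomputable def degIn (A : Finset V) (v : V) : ℤ := ∑ a ∈ A, (adjBit G v a).toInt

/-- The number of pairs in `A × B` that are adjacent. -/
noncomputable def edgeCount (A B : Finset V) : ℤ := ∑ a ∈ A, ∑ b ∈ B, (adjBit G a b).toInt

/-- The number of pairs in `A × B` that form a triangle with `c`. -/
noncomputable def triCountAt (A B : Finset V) (c : V) : ℤ :=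
  ∑ a ∈ A, ∑ b ∈ B, (adjBit G a b && adjBit G c a && adjBit G c b).toInt

/-- The number of triples in `A × B × C` that form a triangle. -/
noncomputable def triCount (A B C : Finset V) : ℤ := ∑ c ∈ C, triCountAt G A B c

/-- If two disjoint triangles `A` and `B` are joined by exactly five edges, this picks out the
unique non-adjacent pair whose members both have two neighbours on the other side. -/
def IsSpecial (A B : Finset V) (a b : V) : Prop :=
  edgeCount G A B = 5 ∧ adjBit G a b = false ∧ degIn G B a = 2 ∧ degIn G A b = 2

open Classical in
/-- The number of neighbours of `c` in the special pair of `A` and `B`, minus one. -/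
noncomputable def surplusAt (A B : Finset V) (c : V) : ℤ :=
  ∑ a ∈ A, ∑ b ∈ B,
    if IsSpecial G A B a b then (adjBit G c a).toInt + (adjBit G c b).toInt - 1 else 0

/-- The total surplus of the vertices of `C` with respect to `A` and `B`. -/
noncomputable def surplus (A B C : Finset V) : ℤ := ∑ c ∈ C, surplusAt G A B c

/-- The local weight of a triple of cliques. Its sum over all triples of classes of a partition
into cliques compares the number of triangles with the number of edges. -/
noncomputable def weight (A B C : Finset V) : ℤ :=
  4 * triCount G A B C - 4 * (edgeCount G A B + edgeCount G B C + edgeCount G A C) +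
    8 * (#A + #B + #C) - 24 +
    2 * ((#A - 2) * (#B - 2) + (#B - 2) * (#C - 2) + (#A - 2) * (#C - 2)) -
    (surplus G A B C + surplus G B C A + surplus G A C B)

variable {G}

theorem adjBit_comm (u v : V) : adjBit G u v = adjBit G v u := by
  simp [adjBit, G.adj_comm]

theorem adjBit_eq_true {u v : V} : adjBit G u v = true ↔ G.Adj u v := by
  simp [adjBit]

theorem adjBit_eq_false {u v : V} : adjBit G u v = false ↔ ¬ G.Adj u v := by
  simp [adjBit]

theorem edgeCount_comm (A B : Finset V) : edgeCount G A B = edgeCount G B A := by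
  rw [edgeCount, sum_comm]
  simp only [edgeCount, adjBit_comm]

theorem sum_degIn (A C : Finset V) : ∑ c ∈ C, degIn G A c = edgeCount G C A := rfl

theorem triCountAt_comm (A B : Finset V) (c : V) :
    triCountAt G A B c = triCountAt G B A c := by
  rw [triCountAt, sum_comm]
  refine sum_congr rfl fun b _ => sum_congr rfl fun a _ => ?_
  rw [adjBit_comm a b, Bool.and_right_comm]

theorem triCount_comm (A B C : Finset V) : triCount G A B C = triCount G B A C :=
  sum_congr rfl fun c _ => triCountAt_comm A B c

theorem triCount_rotate (A B C : Finset V) : triCount G A B C = triCount G B C A := by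
  simp only [triCount, triCountAt]
  rw [sum_comm]
  refine sum_congr rfl fun a _ => ?_
  rw [sum_comm]
  refine sum_congr rfl fun b _ => sum_congr rfl fun c _ => ?_
  rw [adjBit_comm c a, adjBit_comm c b]
  congr 1
  grind

theorem isSpecial_comm (A B : Finset V) (a b : V) :
    IsSpecial G A B a b ↔ IsSpecial G B A b a := by
  simp only [IsSpecial, edgeCount_comm A B, adjBit_comm a b]
  tauto

theorem surplusAt_comm (A B : Finset V) (c : V) : surplusAt G A B c = surplusAt G B A c := by
  rw [surplusAt, sum_comm]
  refine sum_congr rfl fun b _ => sum_congr rfl fun a _ => ?_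
  rw [add_comm]
  classical exact if_congr (isSpecial_comm A B a b) rfl rfl

theorem surplus_comm (A B C : Finset V) : surplus G A B C = surplus G B A C :=
  sum_congr rfl fun c _ => surplusAt_comm A B c

theorem weight_rotate (A B C : Finset V) : weight G A B C = weight G B C A := by
  simp only [weight, triCount_rotate A B, edgeCount_comm A B, edgeCount_comm A C,
    surplus_comm A B, surplus_comm A C]
  ring

theorem surplus_eq_zero {A B : Finset V} (h : edgeCount G A B ≠ 5) (C : Finset V) :
    surplus G A B C = 0 := by
  simp [surplus, surplusAt, IsSpecial, h]

theorem triCount_nonneg (A B C : Finset V) : 0 ≤ triCount G A B C :=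
  sum_nonneg fun _ _ => sum_nonneg fun _ _ => sum_nonneg fun _ _ => by
    cases (adjBit G _ _ && adjBit G _ _ && adjBit G _ _) <;> simp

theorem exists_enum {A : Finset V} {m : ℕ} (hA : #A = m) :
    ∃ a : Fin m ↪ V, A = univ.map a := by
  refine ⟨(A.equivFinOfCardEq hA).symm.toEmbedding.trans (Function.Embedding.subtype _), ?_⟩
  ext v
  simp only [mem_map, mem_univ, true_and]
  refine ⟨fun hv => ⟨A.equivFinOfCardEq hA ⟨v, hv⟩, by simp⟩, ?_⟩
  rintro ⟨i, rfl⟩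
  simp

theorem not_adj_of_cliqueFree_four (hK : G.CliqueFree 4) {a b c d : V} (hab : G.Adj a b)
    (hac : G.Adj a c) (had : G.Adj a d) (hbc : G.Adj b c) (hbd : G.Adj b d) : ¬ G.Adj c d := by
  classical
  intro hcd
  refine hK {a, b, c, d} ⟨?_, ?_⟩
  · simp only [coe_insert, coe_singleton, SimpleGraph.isClique_insert,
      SimpleGraph.isClique_singleton, Set.mem_insert_iff, Set.mem_singleton_iff]
    grind [SimpleGraph.Adj.symm]
  · rw [card_insert_of_notMem, card_insert_of_notMem, card_pair hcd.ne] <;>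
      simp [hab.ne, hac.ne, had.ne, hbc.ne, hbd.ne]

theorem noSquare_adjBit (hK : G.CliqueFree 4) {m n : ℕ} {a : Fin m ↪ V} {b : Fin n ↪ V}
    (ha : G.IsClique (univ.map a : Finset V)) (hb : G.IsClique (univ.map b : Finset V)) :
    NoSquare fun i j => adjBit G (a i) (b j) := by
  intro i i' hi j j' hj
  have h₁ : G.Adj (a i) (a i') := ha (by simp) (by simp) (a.injective.ne hi.ne)
  have h₂ : G.Adj (b j) (b j') := hb (by simp) (by simp) (b.injective.ne hj.ne)
  by_contra h
  simp only [Bool.not_eq_false, Bool.and_eq_true, adjBit_eq_true] at h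
  obtain ⟨⟨⟨h₃, h₄⟩, h₅⟩, h₆⟩ := h
  exact not_adj_of_cliqueFree_four hK h₁ h₃ h₄ h₅ h₆ h₂

theorem noFull_adjBit (hK : G.CliqueFree 4) {a : Fin 3 ↪ V}
    (ha : G.IsClique (univ.map a : Finset V)) (c : V) : NoFull fun i => adjBit G c (a i) := by
  have h {i j : Fin 3} (hij : i ≠ j) : G.Adj (a i) (a j) :=
    ha (by simp) (by simp) (a.injective.ne hij)
  by_contra hc
  simp only [not_exists, Bool.not_eq_false, adjBit_eq_true] at hc
  exact not_adj_of_cliqueFree_four hK (hc 0) (hc 1) (hc 2) (h (i := 0) (j := 1) (by decide))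
    (h (by decide)) (h (by decide))

theorem noCone_adjBit (hK : G.CliqueFree 4) {m n : ℕ} {a : Fin m ↪ V} {b : Fin n ↪ V}
    (ha : G.IsClique (univ.map a : Finset V)) (hb : G.IsClique (univ.map b : Finset V)) (c : V) :
    NoCone (fun i j => adjBit G (a i) (b j)) (fun i => adjBit G c (a i))
      (fun j => adjBit G c (b j)) := by
  constructor
  · intro i i' hi j
    have h₁ : G.Adj (a i) (a i') := ha (by simp) (by simp) (a.injective.ne hi.ne)
    by_contra h
    simp only [Bool.not_eq_false, Bool.and_eq_true, adjBit_eq_true] at h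
    obtain ⟨⟨⟨⟨h₂, h₃⟩, h₄⟩, h₅⟩, h₆⟩ := h
    exact not_adj_of_cliqueFree_four hK h₄ h₅ h₆ h₁ h₂ h₃
  · intro i j j' hj
    have h₁ : G.Adj (b j) (b j') := hb (by simp) (by simp) (b.injective.ne hj.ne)
    by_contra h
    simp only [Bool.not_eq_false, Bool.and_eq_true, adjBit_eq_true] at h
    obtain ⟨⟨⟨⟨h₂, h₃⟩, h₄⟩, h₅⟩, h₆⟩ := h
    exact not_adj_of_cliqueFree_four hK h₄ h₅ h₆ h₂ h₃ h₁

theorem edgeCount_map {m n : ℕ} (a : Fin m ↪ V) (b : Fin n ↪ V) :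
    edgeCount G (univ.map a) (univ.map b) = bitSum fun i j => adjBit G (a i) (b j) := by
  simp [edgeCount]

theorem degIn_map {m : ℕ} (a : Fin m ↪ V) (c : V) :
    degIn G (univ.map a) c = ∑ i, (adjBit G c (a i)).toInt := by
  simp [degIn]

theorem triCountAt_map {m n : ℕ} (a : Fin m ↪ V) (b : Fin n ↪ V) (c : V) :
    triCountAt G (univ.map a) (univ.map b) c =
      coneSum (fun i j => adjBit G (a i) (b j)) (fun i => adjBit G c (a i))
        (fun j => adjBit G c (b j)) := by
  simp [triCountAt]

theorem surplusAt_map {m n : ℕ} (a : Fin m ↪ V) (b : Fin n ↪ V) (c : V)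
    (h : edgeCount G (univ.map a) (univ.map b) = 5) :
    surplusAt G (univ.map a) (univ.map b) c =
      bitSurplus (fun i j => adjBit G (a i) (b j)) (fun i => adjBit G c (a i))
        (fun j => adjBit G c (b j)) := by
  have hab : ∀ i j, adjBit G (b j) (a i) = adjBit G (a i) (b j) := fun i j => adjBit_comm _ _
  simp only [surplusAt, IsSpecial, h, degIn_map, sum_map, hab, true_and, bitSurplus]

section Cliques

variable {A B C : Finset V}

theorem edgeCount_le_six (hK : G.CliqueFree 4) (hA : G.IsClique (A : Set V))
    (hB : G.IsClique (B : Set V)) (hcA : #A = 3) (hcB : #B = 3) : edgeCount G A B ≤ 6 := by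
  obtain ⟨a, rfl⟩ := exists_enum hcA
  obtain ⟨b, rfl⟩ := exists_enum hcB
  rw [edgeCount_map]
  refine bitSum_three_three_le _ (noSquare_adjBit hK hA hB) (fun i => noFull_adjBit hK hB _)
    fun j => ?_
  simpa only [adjBit_comm] using noFull_adjBit hK hA (b j)

theorem edgeCount_le_four (hK : G.CliqueFree 4) (hA : G.IsClique (A : Set V))
    (hB : G.IsClique (B : Set V)) (hcA : #A = 3) (hcB : #B = 2) : edgeCount G A B ≤ 4 := by
  obtain ⟨a, rfl⟩ := exists_enum hcA
  obtain ⟨b, rfl⟩ := exists_enum hcB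
  rw [edgeCount_map]
  refine bitSum_three_two_le _ (noSquare_adjBit hK hA hB) fun j => ?_
  simpa only [adjBit_comm] using noFull_adjBit hK hA (b j)

theorem edgeCount_le_three (hK : G.CliqueFree 4) (hA : G.IsClique (A : Set V))
    (hB : G.IsClique (B : Set V)) (hcA : #A = 2) (hcB : #B = 2) : edgeCount G A B ≤ 3 := by
  obtain ⟨a, rfl⟩ := exists_enum hcA
  obtain ⟨b, rfl⟩ := exists_enum hcB
  rw [edgeCount_map]
  exact bitSum_two_two_le _ (noSquare_adjBit hK hA hB)

theorem edgeCount_self_of_card_two (hA : G.IsClique (A : Set V)) (hcA : #A = 2) :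
    edgeCount G A A = 2 := by
  classical
  obtain ⟨x, y, hxy, rfl⟩ := card_eq_two.1 hcA
  have h : G.Adj x y := hA (by simp) (by simp) hxy
  simp [edgeCount, sum_pair hxy, adjBit, h, h.symm]

/-- The counting estimates for a vertex set `C` and two triangles joined by at least five edges. -/
theorem triCount_bounds_of_five_le (hK : G.CliqueFree 4) (hA : G.IsClique (A : Set V))
    (hB : G.IsClique (B : Set V)) (hcA : #A = 3) (hcB : #B = 3) (h : 5 ≤ edgeCount G A B)
    (C : Finset V) :
    edgeCount G A B * #C + edgeCount G A C + edgeCount G B C ≤ triCount G A B C + 8 * #C ∧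
    (edgeCount G A B = 5 → 2 * (edgeCount G A C + edgeCount G B C) + #C + surplus G A B C ≤
      2 * triCount G A B C + 6 * #C) := by
  have key : ∀ c, edgeCount G A B + degIn G A c + degIn G B c ≤ triCountAt G A B c + 8 ∧
      (edgeCount G A B = 5 → 2 * (degIn G A c + degIn G B c) + 1 + surplusAt G A B c ≤
        2 * triCountAt G A B c + 6) := by
    intro c
    obtain ⟨a, rfl⟩ := exists_enum hcA
    obtain ⟨b, rfl⟩ := exists_enum hcB
    have := sum_le_coneSum_three_three _ (noSquare_adjBit hK hA hB)
      (fun i => noFull_adjBit hK hB _)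
      (fun j => by simpa only [adjBit_comm] using noFull_adjBit hK hA (b j))
      (by rwa [edgeCount_map] at h) _ _ (noFull_adjBit hK hA c) (noFull_adjBit hK hB c)
      (noCone_adjBit hK hA hB c)
    rw [← edgeCount_map, ← degIn_map, ← degIn_map, ← triCountAt_map] at this
    refine ⟨this.1, fun h5 => ?_⟩
    rw [surplusAt_map a b c h5]
    exact this.2 h5
  rw [edgeCount_comm A C, edgeCount_comm B C, triCount, surplus]
  constructor
  · have := sum_le_sum fun c (_ : c ∈ C) => (key c).1
    simp only [sum_add_distrib, sum_const, nsmul_eq_mul, sum_degIn] at this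
    linarith
  · intro h5
    have := sum_le_sum fun c (_ : c ∈ C) => (key c).2 h5
    simp only [sum_add_distrib, sum_const, nsmul_eq_mul, ← mul_sum, sum_degIn] at this
    linarith

theorem abs_surplus_le (hK : G.CliqueFree 4) (hA : G.IsClique (A : Set V))
    (hB : G.IsClique (B : Set V)) (hcA : #A = 3) (hcB : #B = 3) (C : Finset V) :
    |surplus G A B C| ≤ #C := by
  by_cases h5 : edgeCount G A B = 5
  · have key : ∀ c, |surplusAt G A B c| ≤ 1 := by
      intro c
      obtain ⟨a, rfl⟩ := exists_enum hcA
      obtain ⟨b, rfl⟩ := exists_enum hcB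
      rw [surplusAt_map a b c h5]
      exact abs_bitSurplus_le_one _ (noSquare_adjBit hK hA hB) (fun i => noFull_adjBit hK hB _)
        (fun j => by simpa only [adjBit_comm] using noFull_adjBit hK hA (b j))
        (by rwa [edgeCount_map] at h5) _ _
    calc |surplus G A B C| ≤ ∑ c ∈ C, |surplusAt G A B c| := abs_sum_le_sum_abs _ _
      _ ≤ ∑ c ∈ C, 1 := sum_le_sum fun c _ => key c
      _ = #C := by simp
  · simp [surplus_eq_zero h5]

theorem edgeCount_add_le_triCount (hK : G.CliqueFree 4) (hA : G.IsClique (A : Set V))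
    (hB : G.IsClique (B : Set V)) (hcA : #A = 3) (hcB : #B = 2) (h : edgeCount G A B = 4)
    (C : Finset V) : edgeCount G A C + edgeCount G B C ≤ triCount G A B C + 2 * #C := by
  have key : ∀ c, degIn G A c + degIn G B c ≤ triCountAt G A B c + 2 := by
    intro c
    obtain ⟨a, rfl⟩ := exists_enum hcA
    obtain ⟨b, rfl⟩ := exists_enum hcB
    have := sum_le_coneSum_three_two _ (noSquare_adjBit hK hA hB)
      (fun j => by simpa only [adjBit_comm] using noFull_adjBit hK hA (b j))
      (by rwa [edgeCount_map] at h) _ _ (noFull_adjBit hK hA c)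
      (noCone_adjBit hK hA hB c)
    rwa [← degIn_map, ← degIn_map, ← triCountAt_map] at this
  rw [edgeCount_comm A C, edgeCount_comm B C, ← sum_degIn, ← sum_degIn, triCount]
  have := sum_le_sum fun c (_ : c ∈ C) => key c
  simp only [sum_add_distrib, sum_const, nsmul_eq_mul] at this
  linarith

theorem weight_nonneg_three_three_three (hK : G.CliqueFree 4) (hA : G.IsClique (A : Set V))
    (hB : G.IsClique (B : Set V)) (hC : G.IsClique (C : Set V)) (hcA : #A = 3) (hcB : #B = 3)
    (hcC : #C = 3) : 0 ≤ weight G A B C := by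
  have tA := triCount_rotate (G := G) A B C
  have tB := triCount_comm (G := G) A B C
  have tC := triCount_rotate (G := G) B A C
  have eBA := edgeCount_comm (G := G) A B
  have eCA := edgeCount_comm (G := G) A C
  have eCB := edgeCount_comm (G := G) B C
  have hAB := edgeCount_le_six hK hA hB hcA hcB
  have hAC := edgeCount_le_six hK hA hC hcA hcC
  have hBC := edgeCount_le_six hK hB hC hcB hcC
  have bAB := fun h => triCount_bounds_of_five_le hK hA hB hcA hcB h C
  have bAC := fun h => triCount_bounds_of_five_le hK hA hC hcA hcC h B
  have bBC := fun h => triCount_bounds_of_five_le hK hB hC hcB hcC h A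
  have sAB := abs_le.1 (abs_surplus_le hK hA hB hcA hcB C)
  have sAC := abs_le.1 (abs_surplus_le hK hA hC hcA hcC B)
  have sBC := abs_le.1 (abs_surplus_le hK hB hC hcB hcC A)
  have zAB := fun h => surplus_eq_zero (G := G) (A := A) (B := B) h C
  have zAC := fun h => surplus_eq_zero (G := G) (A := A) (B := C) h B
  have zBC := fun h => surplus_eq_zero (G := G) (A := B) (B := C) h A
  have t0 := triCount_nonneg (G := G) A B C
  rw [weight]
  simp only [hcA, hcB, hcC] at *
  push_cast at *
  norm_num
  by_cases h5 : 5 ≤ edgeCount G A B <;> by_cases h5' : 5 ≤ edgeCount G A C <;>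
    by_cases h5'' : 5 ≤ edgeCount G B C <;>
    simp only [h5, h5', h5'', true_imp_iff] at bAB bAC bBC <;> omega

theorem weight_nonneg_three_three_two (hK : G.CliqueFree 4) (hA : G.IsClique (A : Set V))
    (hB : G.IsClique (B : Set V)) (hC : G.IsClique (C : Set V)) (hcA : #A = 3) (hcB : #B = 3)
    (hcC : #C = 2) : 0 ≤ weight G A B C := by
  have tB := triCount_comm (G := G) A B C
  have tA := triCount_rotate (G := G) A B C
  have tC := triCount_rotate (G := G) B A C
  have eBA := edgeCount_comm (G := G) A B
  have eCA := edgeCount_comm (G := G) A C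
  have eCB := edgeCount_comm (G := G) B C
  have hAB := edgeCount_le_six hK hA hB hcA hcB
  have hAC := edgeCount_le_four hK hA hC hcA hcC
  have hBC := edgeCount_le_four hK hB hC hcB hcC
  have bAB := fun h => triCount_bounds_of_five_le hK hA hB hcA hcB h C
  have bAC := fun h => edgeCount_add_le_triCount hK hA hC hcA hcC h B
  have bBC := fun h => edgeCount_add_le_triCount hK hB hC hcB hcC h A
  have sAB := abs_le.1 (abs_surplus_le hK hA hB hcA hcB C)
  have zAB := fun h => surplus_eq_zero (G := G) (A := A) (B := B) h C
  have zAC := surplus_eq_zero (G := G) (A := A) (B := C) (by omega) B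
  have zBC := surplus_eq_zero (G := G) (A := B) (B := C) (by omega) A
  have t0 := triCount_nonneg (G := G) A B C
  rw [weight]
  simp only [hcA, hcB, hcC] at *
  push_cast at *
  norm_num
  by_cases h5 : 5 ≤ edgeCount G A B <;> simp only [h5, true_imp_iff] at bAB <;> omega

variable (G) in
/-- The triples of a triangle and two edges whose weight may be negative. -/
def IsTight (A B C : Finset V) : Prop :=
  #A = 3 ∧ #B = 2 ∧ #C = 2 ∧ edgeCount G A B = 3 ∧ edgeCount G A C = 3 ∧ edgeCount G B C = 3 ∧
    triCount G A B C = 0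

theorem weight_three_two_two (hK : G.CliqueFree 4) (hA : G.IsClique (A : Set V))
    (hB : G.IsClique (B : Set V)) (hC : G.IsClique (C : Set V)) (hcA : #A = 3) (hcB : #B = 2)
    (hcC : #C = 2) : 0 ≤ weight G A B C ∨ IsTight G A B C ∧ weight G A B C = -4 := by
  have tB := triCount_comm (G := G) A B C
  have tA := triCount_rotate (G := G) A B C
  have tC := triCount_rotate (G := G) B A C
  have eBA := edgeCount_comm (G := G) A B
  have eCA := edgeCount_comm (G := G) A C
  have eCB := edgeCount_comm (G := G) B C
  have hAB := edgeCount_le_four hK hA hB hcA hcB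
  have hAC := edgeCount_le_four hK hA hC hcA hcC
  have hBC := edgeCount_le_three hK hB hC hcB hcC
  have bAB := fun h => edgeCount_add_le_triCount hK hA hB hcA hcB h C
  have bAC := fun h => edgeCount_add_le_triCount hK hA hC hcA hcC h B
  have zAB := surplus_eq_zero (G := G) (A := A) (B := B) (by omega) C
  have zAC := surplus_eq_zero (G := G) (A := A) (B := C) (by omega) B
  have zBC := surplus_eq_zero (G := G) (A := B) (B := C) (by omega) A
  have t0 := triCount_nonneg (G := G) A B C
  rw [IsTight, weight]
  simp only [hcA, hcB, hcC] at *
  push_cast at *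
  norm_num
  omega

theorem IsTight.exists_structure (hK : G.CliqueFree 4) (hA : G.IsClique (A : Set V))
    (hB : G.IsClique (B : Set V)) (hC : G.IsClique (C : Set V)) (h : IsTight G A B C) :
    2 ≤ triCount G B B A ∧ ∃ a ∈ A, ∃ b ∈ B, (∀ a' ∈ A, G.Adj a' b ↔ a' ≠ a) ∧
      (∀ c ∈ C, G.Adj a c) ∧ ∀ b' ∈ B, b' ≠ b → ∀ c ∈ C, G.Adj b' c := by
  obtain ⟨hcA, hcB, hcC, hAB, hAC, hBC, hT⟩ := h
  obtain ⟨a, rfl⟩ := exists_enum hcA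
  obtain ⟨b, rfl⟩ := exists_enum hcB
  obtain ⟨c, rfl⟩ := exists_enum hcC
  rw [edgeCount_map] at hAB hAC hBC
  obtain ⟨⟨i, hi⟩, i₀, j₀, h₁, h₂, h₃⟩ := exists_of_three_two_two _ hAB
    (fun j => by simpa only [adjBit_comm] using noFull_adjBit hK hA (b j)) _ hAC
    (fun j => by simpa only [adjBit_comm] using noFull_adjBit hK hA (c j)) _ hBC (by
      intro i j k
      have h0 : ∀ x : Bool, 0 ≤ x.toInt := by decide
      simp only [triCount, triCountAt, sum_map] at hT
      rw [sum_eq_zero_iff_of_nonneg fun _ _ => sum_nonneg fun _ _ => sum_nonneg fun _ _ => h0 _]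
        at hT
      have hT := hT k (mem_univ _)
      rw [sum_eq_zero_iff_of_nonneg fun _ _ => sum_nonneg fun _ _ => h0 _] at hT
      have hT := hT i (mem_univ _)
      rw [sum_eq_zero_iff_of_nonneg fun _ _ => h0 _] at hT
      have hT := hT j (mem_univ _)
      rw [adjBit_comm (c k) (a i), adjBit_comm (c k) (b j)] at hT
      revert hT
      cases (adjBit G (a i) (b j) && adjBit G (a i) (c k) && adjBit G (b j) (c k)) <;> simp)
  constructor
  · have hb : G.Adj (b 0) (b 1) := hB (by simp) (by simp) (b.injective.ne (by decide))
    have h0 : ∀ x : Bool, 0 ≤ x.toInt := by decide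
    have hge : ∀ i ∈ univ, (0 : ℤ) ≤ triCountAt G (univ.map b) (univ.map b) (a i) :=
      fun i _ => sum_nonneg fun _ _ => sum_nonneg fun _ _ => h0 _
    rw [triCount, sum_map]
    refine le_trans ?_ (single_le_sum hge (mem_univ i))
    simp only [Bool.and_eq_true] at hi
    simp [triCountAt, Fin.sum_univ_two, hi.1, hi.2, adjBit_eq_true.2 hb, adjBit_eq_true.2 hb.symm,
      adjBit_eq_false.2 (G.irrefl)]
  · refine ⟨a i₀, by simp, b j₀, by simp, ?_, ?_, ?_⟩
    · simp only [mem_map, mem_univ, true_and, forall_exists_index, forall_apply_eq_imp_iff]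
      intro i
      rw [← adjBit_eq_true, h₁]
      simp
    · simp only [mem_map, mem_univ, true_and, forall_exists_index, forall_apply_eq_imp_iff]
      exact fun k => adjBit_eq_true.1 (h₂ k)
    · simp only [mem_map, mem_univ, true_and, forall_exists_index, forall_apply_eq_imp_iff]
      exact fun j hj k => adjBit_eq_true.1 (h₃ j (fun h => hj (h ▸ rfl)) k)

theorem IsTight.le_weight (hK : G.CliqueFree 4) (hA : G.IsClique (A : Set V))
    (hB : G.IsClique (B : Set V)) (hC : G.IsClique (C : Set V)) (h : IsTight G A B C) :
    8 ≤ weight G A B B := by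
  have h₁ := (h.exists_structure hK hA hB hC).1
  obtain ⟨hcA, hcB, -, hAB, -⟩ := h
  have hBB := edgeCount_self_of_card_two hB hcB
  have tA := triCount_rotate (G := G) A B B
  have z := surplus_eq_zero (G := G) (A := A) (B := B) (by omega) B
  have z' := surplus_eq_zero (G := G) (A := B) (B := B) (by omega) A
  rw [weight, hcA, hcB]
  push_cast
  norm_num
  omega

theorem weight_nonneg_of_card_two (hK : G.CliqueFree 4) (hA : G.IsClique (A : Set V))
    (hC : G.IsClique (C : Set V)) (hcA : #A = 2) (hcC : #C = 2) : 0 ≤ weight G A A C := by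
  have hAA := edgeCount_self_of_card_two hA hcA
  have hAC := edgeCount_le_three hK hA hC hcA hcC
  have hT : 2 * edgeCount G A C - 2 * #C ≤ triCount G A A C := by
    have key : ∀ c, 2 * degIn G A c ≤ triCountAt G A A c + 2 := by
      intro c
      classical
      obtain ⟨x, y, hxy, rfl⟩ := card_eq_two.1 hcA
      have h : G.Adj x y := hA (by simp) (by simp) hxy
      simp only [degIn, triCountAt, sum_pair hxy, adjBit_eq_true.2 h, adjBit_eq_true.2 h.symm,
        adjBit_eq_false.2 (G.irrefl)]
      cases adjBit G c x <;> cases adjBit G c y <;> simp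
    rw [edgeCount_comm A C, triCount]
    have := sum_le_sum fun c (_ : c ∈ C) => key c
    simp only [sum_add_distrib, sum_const, nsmul_eq_mul, ← mul_sum, sum_degIn] at this
    linarith
  have z := surplus_eq_zero (G := G) (A := A) (B := A) (by omega) C
  have z' := surplus_eq_zero (G := G) (A := A) (B := C) (by omega) A
  rw [weight, hcA, hcC]
  rw [hcC] at hT
  push_cast at *
  norm_num
  have t0 := triCount_nonneg (G := G) A A C
  omega

theorem exists_coloring_of_weight_neg (hK : G.CliqueFree 4) (hA : G.IsClique (A : Set V))
    (hB : G.IsClique (B : Set V)) (hC : G.IsClique (C : Set V)) (hAB : Disjoint A B)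
    (hAC : Disjoint A C) (hBC : Disjoint B C) (hcA : #A = 2) (hcB : #B = 2)
    (hcC : #C = 2) (h : weight G A B C < 0) :
    ∃ col : V → Bool, ∀ u v, (u ∈ A ∨ u ∈ B ∨ u ∈ C) → (v ∈ A ∨ v ∈ B ∨ v ∈ C) → u ≠ v →
      col u = col v → G.Adj u v := by
  have eAB := edgeCount_le_three hK hA hB hcA hcB
  have eAC := edgeCount_le_three hK hA hC hcA hcC
  have eBC := edgeCount_le_three hK hB hC hcB hcC
  rw [weight, surplus_eq_zero (by omega), surplus_eq_zero (by omega), surplus_eq_zero (by omega),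
    hcA, hcB, hcC] at h
  obtain ⟨a, rfl⟩ := exists_enum hcA
  obtain ⟨b, rfl⟩ := exists_enum hcB
  obtain ⟨c, rfl⟩ := exists_enum hcC
  have ha : G.Adj (a 0) (a 1) := hA (by simp) (by simp) (a.injective.ne (by decide))
  have hb : G.Adj (b 0) (b 1) := hB (by simp) (by simp) (b.injective.ne (by decide))
  have hc : G.Adj (c 0) (c 1) := hC (by simp) (by simp) (c.injective.ne (by decide))
  have hT : triCount G (univ.map a) (univ.map b) (univ.map c) = ∑ i, ∑ j, ∑ k,
      (adjBit G (a i) (b j) && adjBit G (a i) (c k) && adjBit G (b j) (c k)).toInt := by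
    simp only [triCount, triCountAt, sum_map]
    rw [sum_comm]
    refine sum_congr rfl fun i _ => ?_
    rw [sum_comm]
    refine sum_congr rfl fun j _ => sum_congr rfl fun k _ => ?_
    rw [adjBit_comm (c k), adjBit_comm (c k)]
  obtain ⟨f, g, h, h₁, h₂, h₃⟩ := exists_coloring_of_two_two_two _ (noSquare_adjBit hK hA hB) _
    (noSquare_adjBit hK hA hC) _ (noSquare_adjBit hK hB hC)
    (by
      intro j k
      by_contra hn
      simp only [Bool.not_eq_false, Bool.and_eq_true, adjBit_eq_true] at hn
      obtain ⟨⟨⟨⟨h₁, h₂⟩, h₃⟩, h₄⟩, h₅⟩ := hn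
      exact not_adj_of_cliqueFree_four hK ha h₁ h₃ h₂ h₄ h₅)
    (by
      intro i k
      by_contra hn
      simp only [Bool.not_eq_false, Bool.and_eq_true, adjBit_eq_true] at hn
      obtain ⟨⟨⟨⟨h₁, h₂⟩, h₃⟩, h₄⟩, h₅⟩ := hn
      exact not_adj_of_cliqueFree_four hK h₁ h₂ h₃ hb h₄ h₅)
    (by
      intro i j
      by_contra hn
      simp only [Bool.not_eq_false, Bool.and_eq_true, adjBit_eq_true] at hn
      obtain ⟨⟨⟨⟨h₁, h₂⟩, h₃⟩, h₄⟩, h₅⟩ := hn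
      exact not_adj_of_cliqueFree_four hK h₁ h₂ h₃ h₄ h₅ hc)
    (by
      rw [← hT, ← edgeCount_map, ← edgeCount_map, ← edgeCount_map]
      push_cast at h
      linarith)
  have dAB : ∀ i j, a i ≠ b j := fun i j => disjoint_iff_ne.1 hAB _ (by simp) _ (by simp)
  have dAC : ∀ i j, a i ≠ c j := fun i j => disjoint_iff_ne.1 hAC _ (by simp) _ (by simp)
  have dBC : ∀ i j, b i ≠ c j := fun i j => disjoint_iff_ne.1 hBC _ (by simp) _ (by simp)
  set col : V → Bool :=
    Function.extend a f (Function.extend b g (Function.extend c h fun _ => false)) with hcol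
  have cA : ∀ i, col (a i) = f i := fun i => a.injective.extend_apply _ _ _
  have cB : ∀ i, col (b i) = g i := fun i => by
    rw [hcol, Function.extend_apply' _ _ _ (by rintro ⟨j, hj⟩; exact dAB _ _ hj),
      b.injective.extend_apply]
  have cC : ∀ i, col (c i) = h i := fun i => by
    rw [hcol, Function.extend_apply' _ _ _ (by rintro ⟨j, hj⟩; exact dAC _ _ hj),
      Function.extend_apply' _ _ _ (by rintro ⟨j, hj⟩; exact dBC _ _ hj),
      c.injective.extend_apply]
  refine ⟨col, fun u v hu hv huv he => ?_⟩
  rcases hu with hu | hu | hu <;> rcases hv with hv | hv | hv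
  all_goals
    obtain ⟨i, -, rfl⟩ := mem_map.1 hu
    obtain ⟨j, -, rfl⟩ := mem_map.1 hv
    simp only [cA, cB, cC] at he
    first
    | exact hA hu hv huv
    | exact hB hu hv huv
    | exact hC hu hv huv
    | exact adjBit_eq_true.1 (h₁ _ _ he)
    | exact adjBit_eq_true.1 (h₂ _ _ he)
    | exact adjBit_eq_true.1 (h₃ _ _ he)
    | exact (adjBit_eq_true.1 (h₁ _ _ he.symm)).symm
    | exact (adjBit_eq_true.1 (h₂ _ _ he.symm)).symm
    | exact (adjBit_eq_true.1 (h₃ _ _ he.symm)).symm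

end Cliques

end Counting

section Labelling

variable {V : Type*} (G : SimpleGraph V)

/-- Distinct vertices with the same label are adjacent. -/
def IsCliqueLabelling {ι : Type*} (l : V → ι) : Prop :=
  ∀ ⦃u v⦄, u ≠ v → l u = l v → G.Adj u v

/-- The set of vertices with label `i`. -/
abbrev labelClass [Fintype V] {ι : Type*} [DecidableEq ι] (l : V → ι) (i : ι) : Finset V :=
  {v | l v = i}

variable {G}

theorem IsCliqueLabelling.isClique [Fintype V] {ι : Type*} [DecidableEq ι] {l : V → ι}
    (hl : IsCliqueLabelling G l) (i : ι) : G.IsClique (labelClass l i : Set V) := by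
  intro u hu v hv huv
  simp only [coe_filter, mem_univ, true_and, Set.mem_ofPred_eq] at hu hv
  exact hl huv (hu.trans hv.symm)

theorem IsCliqueLabelling.card_le_three [Fintype V] {ι : Type*} [DecidableEq ι] {l : V → ι}
    (hl : IsCliqueLabelling G l) (hK : G.CliqueFree 4) (i : ι) : #(labelClass l i) ≤ 3 := by
  by_contra! h
  exact hK.mono h _ ⟨hl.isClique i, rfl⟩

theorem exists_surjective_labelling [Finite V] (G : SimpleGraph V) :
    ∃ r, (∃ l : V → Fin r, IsCliqueLabelling G l) ∧
      ∀ l : V → Fin r, IsCliqueLabelling G l → Function.Surjective l := by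
  classical
  have hex : ∃ r, ∃ l : V → Fin r, IsCliqueLabelling G l :=
    ⟨Nat.card V, Finite.equivFin V, fun u v huv h => absurd ((Finite.equivFin V).injective h) huv⟩
  refine ⟨Nat.find hex, Nat.find_spec hex, ?_⟩
  have hmin := fun m => Nat.find_min hex (m := m)
  revert hmin
  generalize Nat.find hex = r
  intro hmin l hl i
  by_contra! hi
  obtain ⟨s, rfl⟩ := Nat.exists_eq_succ_of_ne_zero i.pos.ne'
  choose f hf using fun v => Fin.exists_succAbove_eq (hi v)
  exact hmin s (Nat.lt_succ_self s) ⟨f, fun u v huv h => hl huv (by rw [← hf u, ← hf v, h])⟩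

theorem IsCliqueLabelling.two_mul_card_le [Fintype V] {r : ℕ} {l : V → Fin r}
    (hl : IsCliqueLabelling G l) (hK : G.CliqueFree 4)
    (hsurj : ∀ l' : V → Fin r, IsCliqueLabelling G l' → Function.Surjective l')
    (hsing : ∀ l' : V → Fin r, IsCliqueLabelling G l' →
      #{i | #(labelClass l i) = 1} ≤ #{i | #(labelClass l' i) = 1})
    {v : V} (hv : #(labelClass l (l v)) = 1) [DecidableRel G.Adj] (k : Fin r) :
    2 * #{u ∈ labelClass l k | G.Adj v u} ≤ #(labelClass l k) := by
  classical
  have hv' : ∀ u, l u = l v → u = v := by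
    intro u hu
    exact card_le_one.1 hv.le u (by simp [hu]) v (by simp)
  by_cases hkv : k = l v
  · subst hkv
    rw [card_eq_zero.2]
    · simp
    · ext u
      simp only [mem_filter, mem_univ, true_and, notMem_empty, iff_false, not_and]
      intro hu
      rw [hv' u hu]
      exact G.irrefl
  by_contra! hlt
  by_cases hall : ∀ u, l u = k → G.Adj v u
  · have hl' : IsCliqueLabelling G (Function.update l v k) := by
      intro a b hab h
      by_cases ha : a = v
      · subst ha
        rw [Function.update_self, Function.update_of_ne hab.symm] at h
        exact hall b h.symm
      · by_cases hb : b = v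
        · subst hb
          rw [Function.update_self, Function.update_of_ne ha] at h
          exact (hall a h).symm
        · rw [Function.update_of_ne ha, Function.update_of_ne hb] at h
          exact hl hab h
    obtain ⟨w, hw⟩ := hsurj _ hl' (l v)
    by_cases hwv : w = v
    · subst hwv
      rw [Function.update_self] at hw
      exact hkv hw
    · rw [Function.update_of_ne hwv] at hw
      exact hwv (hv' w hw)
  · push Not at hall
    obtain ⟨w, hwk, hw⟩ := hall
    have h3 := hl.card_le_three hK k
    have hss : #{u ∈ labelClass l k | G.Adj v u} < #(labelClass l k) :=
      card_lt_card ((filter_ssubset).2 ⟨w, by simp [hwk], hw⟩)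
    obtain ⟨a, ha⟩ : ({u ∈ labelClass l k | G.Adj v u} : Finset V).Nonempty := by
      rw [← card_pos]; omega
    simp only [mem_filter, mem_univ, true_and] at ha
    obtain ⟨hak, hva⟩ := ha
    have hl' : IsCliqueLabelling G (Function.update l a (l v)) := by
      intro x y hxy h
      by_cases hx : x = a
      · subst hx
        rw [Function.update_self, Function.update_of_ne hxy.symm] at h
        rw [hv' y h.symm]
        exact hva.symm
      · by_cases hy : y = a
        · subst hy
          rw [Function.update_self, Function.update_of_ne hx] at h
          rw [hv' x h]
          exact hva
        · rw [Function.update_of_ne hx, Function.update_of_ne hy] at h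
          exact hl hxy h
    refine (hsing _ hl').not_gt (card_lt_card ?_)
    rw [ssubset_iff_of_subset]
    · refine ⟨l v, by simpa using hv, ?_⟩
      simp only [mem_filter, mem_univ, true_and]
      intro h1
      have := card_le_one.1 h1.le v (by simp [Function.update_of_ne hva.ne]) a (by simp)
      exact hva.ne this
    · intro i hi
      simp only [mem_filter, mem_univ, true_and] at hi ⊢
      by_cases hik : i = k
      · subst hik
        have : labelClass (Function.update l a (l v)) i = (labelClass l i).erase a := by
          ext x
          by_cases hx : x = a
          · subst hx
            simp [Ne.symm hkv]
          · simp [hx]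
        rw [this, card_erase_of_mem (by simp [hak])] at hi
        omega
      · by_cases hiv : i = l v
        · rw [hiv, hv]
        · have : labelClass (Function.update l a (l v)) i = labelClass l i := by
            ext x
            by_cases hx : x = a
            · subst hx
              simp [Ne.symm hiv, hak, Ne.symm hik]
            · simp [hx]
          rwa [this] at hi

/-- If every degree exceeds half the number of vertices, then there is a partition into the minimum
number of cliques all of whose classes have two or three elements. -/
theorem exists_labelling_card_two_or_three [Fintype V] [DecidableRel G.Adj] (hK : G.CliqueFree 4)
    (hdeg : ∀ v, Fintype.card V < 2 * G.degree v) :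
    ∃ r, ∃ l : V → Fin r, IsCliqueLabelling G l ∧
      (∀ l' : V → Fin r, IsCliqueLabelling G l' → Function.Surjective l') ∧
      ∀ i, #(labelClass l i) = 2 ∨ #(labelClass l i) = 3 := by
  classical
  obtain ⟨r, ⟨l₀, hl₀⟩, hsurj⟩ := exists_surjective_labelling G
  obtain ⟨l, hl, hsing⟩ := exists_min_image ({l | IsCliqueLabelling G l} : Finset (V → Fin r))
    (fun l => #{i | #(labelClass l i) = 1}) ⟨l₀, by simpa using hl₀⟩
  simp only [mem_filter, mem_univ, true_and] at hl hsing
  refine ⟨r, l, hl, hsurj, fun i => ?_⟩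
  have h3 := hl.card_le_three hK i
  obtain ⟨v, rfl⟩ := hsurj l hl i
  have h0 : 0 < #(labelClass l (l v)) := card_pos.2 ⟨v, by simp⟩
  suffices h1 : #(labelClass l (l v)) ≠ 1 by omega
  intro h1
  have hsum := sum_le_sum fun k (_ : k ∈ univ) => hl.two_mul_card_le hK hsurj hsing h1 k
  rw [← mul_sum] at hsum
  have e₁ : ∑ k, #(labelClass l k) = Fintype.card V :=
    (card_eq_sum_card_fiberwise fun x _ => mem_coe.2 (mem_univ (l x))).symm
  have e₂ : ∑ k, #{u ∈ labelClass l k | G.Adj v u} = G.degree v := by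
    rw [← G.card_neighborFinset_eq_degree,
      card_eq_sum_card_fiberwise (f := l) (t := univ) fun x _ => mem_coe.2 (mem_univ (l x))]
    refine sum_congr rfl fun k _ => congrArg card ?_
    ext u
    simp [and_comm]
  rw [e₁, e₂] at hsum
  exact absurd (hdeg v) (by omega)

end Labelling

section MinimumLabelling

variable {V : Type*} {G : SimpleGraph V} [Fintype V] {r : ℕ} {l : V → Fin r}

theorem IsTight.eq_of_isTight (hK : G.CliqueFree 4) (hl : IsCliqueLabelling G l)
    (hsurj : ∀ l' : V → Fin r, IsCliqueLabelling G l' → Function.Surjective l') {i j k k' : Fin r}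
    (h : IsTight G (labelClass l i) (labelClass l j) (labelClass l k))
    (h' : IsTight G (labelClass l i) (labelClass l j) (labelClass l k')) : k = k' := by
  classical
  by_contra hkk
  obtain ⟨-, a, ha, b, hb, hab, hac, -⟩ :=
    h.exists_structure hK (hl.isClique i) (hl.isClique j) (hl.isClique k)
  obtain ⟨-, a', ha', b', hb', hab', -, hbc'⟩ :=
    h'.exists_structure hK (hl.isClique i) (hl.isClique j) (hl.isClique k')
  obtain ⟨hci, hcj, hck, eij, eik, ejk, -⟩ := h
  obtain ⟨-, -, hck', -, eik', ejk', -⟩ := h'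
  have hdeg : ∀ a ∈ labelClass l i, ∀ b, (∀ a' ∈ labelClass l i, G.Adj a' b ↔ a' ≠ a) →
      degIn G (labelClass l i) b = 2 := by
    intro a ha b hab
    have : ∀ a' ∈ labelClass l i, (adjBit G b a').toInt = if a' ≠ a then 1 else 0 := by
      intro a' ha'
      have := hab a' ha'
      by_cases hne : a' = a <;> simp_all [adjBit, G.adj_comm b]
    rw [degIn, sum_congr rfl this, sum_ite, sum_const_zero, add_zero, sum_const, filter_ne',
      card_erase_of_mem ha, hci]
    rfl
  have hbb : b' = b := by
    by_contra hne
    have : labelClass l j = {b, b'} :=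
      (eq_of_subset_of_card_le (by simp [insert_subset_iff, hb, hb'])
        (by rw [card_pair (Ne.symm hne), hcj])).symm
    rw [edgeCount_comm, ← sum_degIn, this, sum_pair (Ne.symm hne), hdeg a ha b hab,
      hdeg a' ha' b' hab'] at eij
    norm_num at eij
  subst hbb
  simp only [mem_filter, mem_univ, true_and] at ha hb hab hac ha' hab' hbc'
  have haa : a' = a := by
    by_contra hne
    exact (hab a ha).1 ((hab' a ha).2 (Ne.symm hne)) rfl
  subst haa
  have hij : i ≠ j := by rintro rfl; omega
  have hik : i ≠ k := by rintro rfl; omega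
  have hik' : i ≠ k' := by rintro rfl; omega
  have hjk : j ≠ k := by
    rintro rfl
    rw [edgeCount_self_of_card_two (hl.isClique j) hcj] at ejk
    norm_num at ejk
  have hjk' : j ≠ k' := by
    rintro rfl
    rw [edgeCount_self_of_card_two (hl.isClique j) hcj] at ejk'
    norm_num at ejk'
  have hsymm : ∀ u v, G.Adj u v → G.Adj v u := fun u v h => h.symm
  obtain ⟨w, hw⟩ := hsurj
    (fun v => if v = a' then k else if v = b' then i else if l v = k' then j else l v) (by
      intro u v huv he
      have := @hl u v huv
      dsimp only at he
      split_ifs at he <;> grind) k'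
  dsimp only at hw
  split_ifs at hw <;> grind

theorem weight_nonneg_of_ne (hK : G.CliqueFree 4) (hl : IsCliqueLabelling G l)
    (hsurj : ∀ l' : V → Fin r, IsCliqueLabelling G l' → Function.Surjective l') {i j k : Fin r}
    (hij : i ≠ j) (hik : i ≠ k) (hjk : j ≠ k) (hi : #(labelClass l i) = 2)
    (hj : #(labelClass l j) = 2) (hk : #(labelClass l k) = 2) :
    0 ≤ weight G (labelClass l i) (labelClass l j) (labelClass l k) := by
  by_contra! h
  have hdis : ∀ {x y : Fin r}, x ≠ y → Disjoint (labelClass l x) (labelClass l y) := by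
    intro x y hxy
    rw [disjoint_filter]
    rintro v - rfl
    exact hxy
  obtain ⟨col, hcol⟩ := exists_coloring_of_weight_neg hK (hl.isClique i) (hl.isClique j)
    (hl.isClique k) (hdis hij) (hdis hik) (hdis hjk) hi hj hk h
  simp only [mem_filter, mem_univ, true_and] at hcol
  obtain ⟨w, hw⟩ := hsurj
    (fun v => if l v = i ∨ l v = j ∨ l v = k then (if col v then i else j) else l v) (by
      intro u v huv he
      have := @hl u v huv
      have := hcol u v
      dsimp only at he
      split_ifs at he <;> grind) k
  dsimp only at hw
  split_ifs at hw <;> grind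

open Classical in
/-- The correction that redistributes weight between a triple of the form `(i, j, j)` and the tight
triples `(i, j, k)`. -/
noncomputable def correction (G : SimpleGraph V) (l : V → Fin r) (i j k : Fin r) : ℤ :=
  (if j = k ∧ ∃ k', IsTight G (labelClass l i) (labelClass l j) (labelClass l k') then 8 else 0) -
    (if IsTight G (labelClass l i) (labelClass l j) (labelClass l k) then 4 else 0)

theorem sum_correction_nonneg (hK : G.CliqueFree 4) (hl : IsCliqueLabelling G l)
    (hsurj : ∀ l' : V → Fin r, IsCliqueLabelling G l' → Function.Surjective l') (i j : Fin r) :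
    0 ≤ ∑ k, correction G l i j k := by
  classical
  simp only [correction, sum_sub_distrib]
  by_cases h : ∃ k', IsTight G (labelClass l i) (labelClass l j) (labelClass l k')
  · obtain ⟨k, hk⟩ := h
    have h₁ : ∀ k', IsTight G (labelClass l i) (labelClass l j) (labelClass l k') ↔ k = k' :=
      fun k' => ⟨fun h => hk.eq_of_isTight hK hl hsurj h, fun h => h ▸ hk⟩
    simp [h₁]
  · have h₁ : ∀ k', ¬ IsTight G (labelClass l i) (labelClass l j) (labelClass l k') :=
      fun k' hk' => h ⟨k', hk'⟩
    simp [h₁]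

theorem correction_nonpos_of_ne {i j k : Fin r} (h : j ≠ k) : correction G l i j k ≤ 0 := by
  rw [correction, if_neg (fun h' => h h'.1)]
  split_ifs <;> norm_num

theorem correction_nonpos {i j k : Fin r}
    (h : ¬ (#(labelClass l i) = 3 ∧ #(labelClass l j) = 2 ∧ #(labelClass l k) = 2)) :
    correction G l i j k ≤ 0 := by
  by_cases hjk : j = k
  · subst hjk
    have h₁ : ∀ k', ¬ IsTight G (labelClass l i) (labelClass l j) (labelClass l k') :=
      fun k' hk' => h ⟨hk'.1, hk'.2.1, hk'.2.1⟩
    simp [correction, h₁]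
  · exact correction_nonpos_of_ne hjk

theorem correction_le_weight (hK : G.CliqueFree 4) (hl : IsCliqueLabelling G l)
    {i j k : Fin r} (hi : #(labelClass l i) = 3)
    (hj : #(labelClass l j) = 2) (hk : #(labelClass l k) = 2) :
    correction G l i j k ≤ weight G (labelClass l i) (labelClass l j) (labelClass l k) := by
  have hw := weight_three_two_two hK (hl.isClique i) (hl.isClique j) (hl.isClique k) hi hj hk
  by_cases hjk : j = k
  · subst hjk
    have hn : ¬ IsTight G (labelClass l i) (labelClass l j) (labelClass l j) := by
      rintro ⟨-, -, -, -, -, h, -⟩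
      rw [edgeCount_self_of_card_two (hl.isClique j) hj] at h
      norm_num at h
    have hw : 0 ≤ weight G (labelClass l i) (labelClass l j) (labelClass l j) := by tauto
    rw [correction, if_neg hn]
    split_ifs with h
    · obtain ⟨-, k', h⟩ := h
      have := h.le_weight hK (hl.isClique i) (hl.isClique j) (hl.isClique k')
      linarith
    · simpa using hw
  · have := correction_nonpos_of_ne (G := G) (l := l) (i := i) hjk
    rcases hw with hw | ⟨ht, hw⟩
    · linarith
    · rw [hw, correction, if_pos ht, if_neg (by tauto)]
      norm_num

theorem correction_add_le_weight (hK : G.CliqueFree 4) (hl : IsCliqueLabelling G l)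
    (hsurj : ∀ l' : V → Fin r, IsCliqueLabelling G l' → Function.Surjective l')
    (hcard : ∀ i, #(labelClass l i) = 2 ∨ #(labelClass l i) = 3) (i j k : Fin r) :
    correction G l i j k + correction G l j k i + correction G l k i j ≤
      weight G (labelClass l i) (labelClass l j) (labelClass l k) := by
  have hc := hl.isClique
  have r₁ := weight_rotate (G := G) (labelClass l i) (labelClass l j) (labelClass l k)
  have r₂ := weight_rotate (G := G) (labelClass l j) (labelClass l k) (labelClass l i)
  have n₁ := correction_nonpos (G := G) (l := l) (i := i) (j := j) (k := k)
  have n₂ := correction_nonpos (G := G) (l := l) (i := j) (j := k) (k := i)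
  have n₃ := correction_nonpos (G := G) (l := l) (i := k) (j := i) (k := j)
  rcases hcard i with hi | hi <;> rcases hcard j with hj | hj <;> rcases hcard k with hk | hk
  · suffices h : 0 ≤ weight G (labelClass l i) (labelClass l j) (labelClass l k) by
      linarith [n₁ (by omega), n₂ (by omega), n₃ (by omega)]
    by_cases hij : i = j
    · subst hij
      exact weight_nonneg_of_card_two hK (hc i) (hc k) hi hk
    by_cases hjk : j = k
    · subst hjk
      rw [r₁]
      exact weight_nonneg_of_card_two hK (hc j) (hc i) hj hi
    by_cases hik : i = k
    · subst hik
      rw [r₁, r₂]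
      exact weight_nonneg_of_card_two hK (hc i) (hc j) hi hj
    exact weight_nonneg_of_ne hK hl hsurj hij hik hjk hi hj hk
  · linarith [correction_le_weight hK hl hk hi hj, n₁ (by omega), n₂ (by omega)]
  · linarith [correction_le_weight hK hl hj hk hi, n₁ (by omega), n₃ (by omega)]
  · linarith [weight_nonneg_three_three_two hK (hc j) (hc k) (hc i) hj hk hi, n₁ (by omega),
      n₂ (by omega), n₃ (by omega)]
  · linarith [correction_le_weight hK hl hi hj hk, n₂ (by omega), n₃ (by omega)]
  · linarith [weight_nonneg_three_three_two hK (hc k) (hc i) (hc j) hk hi hj, n₁ (by omega),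
      n₂ (by omega), n₃ (by omega)]
  · linarith [weight_nonneg_three_three_two hK (hc i) (hc j) (hc k) hi hj hk, n₁ (by omega),
      n₂ (by omega), n₃ (by omega)]
  · linarith [weight_nonneg_three_three_three hK (hc i) (hc j) (hc k) hi hj hk, n₁ (by omega),
      n₂ (by omega), n₃ (by omega)]

theorem sum_rotate {ι M : Type*} [Fintype ι] [AddCommMonoid M] (f : ι → ι → ι → M) :
    ∑ i, ∑ j, ∑ k, f j k i = ∑ i, ∑ j, ∑ k, f i j k := by
  rw [sum_comm]
  exact sum_congr rfl fun i _ => sum_comm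

theorem sum_weight_nonneg (hK : G.CliqueFree 4) (hl : IsCliqueLabelling G l)
    (hsurj : ∀ l' : V → Fin r, IsCliqueLabelling G l' → Function.Surjective l')
    (hcard : ∀ i, #(labelClass l i) = 2 ∨ #(labelClass l i) = 3) :
    0 ≤ ∑ i, ∑ j, ∑ k, weight G (labelClass l i) (labelClass l j) (labelClass l k) := by
  have h₁ : 0 ≤ ∑ i, ∑ j, ∑ k, correction G l i j k :=
    sum_nonneg fun i _ => sum_nonneg fun j _ => sum_correction_nonneg hK hl hsurj i j
  have h₂ := sum_rotate fun i j k => correction G l i j k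
  have h₃ := sum_rotate fun i j k => correction G l j k i
  have := sum_le_sum fun i (_ : i ∈ univ) => sum_le_sum fun j (_ : j ∈ univ) =>
    sum_le_sum fun k (_ : k ∈ univ) => correction_add_le_weight hK hl hsurj hcard i j k
  simp only [sum_add_distrib, h₂, h₃] at this
  linarith

end MinimumLabelling

section GlobalCount

variable {V : Type*} {G : SimpleGraph V} [Fintype V] {r : ℕ} {l : V → Fin r}

theorem sum_edgeCount (G : SimpleGraph V) (l : V → Fin r) :
    ∑ i, ∑ j, edgeCount G (labelClass l i) (labelClass l j) = edgeCount G univ univ := by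
  simp only [edgeCount]
  rw [← sum_fiberwise univ l]
  refine sum_congr rfl fun i _ => ?_
  rw [sum_comm]
  refine sum_congr rfl fun u _ => ?_
  rw [← sum_fiberwise univ l]

theorem sum_triCount (G : SimpleGraph V) (l : V → Fin r) :
    ∑ i, ∑ j, ∑ k, triCount G (labelClass l i) (labelClass l j) (labelClass l k) =
      triCount G univ univ univ := by
  simp only [triCount, sum_fiberwise]
  simp only [triCountAt]
  have h : ∀ i, ∑ j, ∑ c, ∑ a ∈ labelClass l i, ∑ b ∈ labelClass l j,
      (adjBit G a b && adjBit G c a && adjBit G c b).toInt =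
      ∑ a ∈ labelClass l i, ∑ c, ∑ b, (adjBit G a b && adjBit G c a && adjBit G c b).toInt := by
    intro i
    rw [sum_comm, sum_comm (s := labelClass l i)]
    refine sum_congr rfl fun c _ => ?_
    rw [sum_comm]
    refine sum_congr rfl fun a _ => ?_
    rw [sum_fiberwise]
  simp only [h, sum_fiberwise]
  rw [sum_comm]

theorem edgeCount_univ [DecidableRel G.Adj] :
    edgeCount G univ univ = 2 * #G.edgeFinset := by
  have h := G.sum_degrees_eq_twice_card_edges
  rw [edgeCount]
  have : ∀ u, ∑ v, (adjBit G u v).toInt = G.degree u := by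
    intro u
    rw [← G.card_neighborFinset_eq_degree, G.neighborFinset_eq_filter, card_filter]
    push_cast
    refine sum_congr rfl fun v _ => ?_
    by_cases h : G.Adj u v <;> simp [adjBit, h]
  simp only [this]
  exact_mod_cast h

theorem sum_surplus_nonneg [DecidableRel G.Adj] (hdeg : ∀ v, Fintype.card V < 2 * G.degree v)
    (A B : Finset V) : 0 ≤ ∑ k, surplus G A B (labelClass l k) := by
  simp only [surplus, sum_fiberwise]
  simp only [surplusAt]
  rw [sum_comm]
  refine sum_nonneg fun a _ => ?_
  rw [sum_comm]
  refine sum_nonneg fun b _ => ?_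
  split_ifs
  · have : ∀ u, ∑ v, (adjBit G v u).toInt = G.degree u := by
      intro u
      rw [← G.card_neighborFinset_eq_degree, G.neighborFinset_eq_filter, card_filter]
      push_cast
      refine sum_congr rfl fun v _ => ?_
      by_cases h : G.Adj u v <;> simp [adjBit, h, G.adj_comm v u]
    simp only [sum_sub_distrib, sum_add_distrib, this]
    have ha := hdeg a
    have hb := hdeg b
    simp
    omega
  · simp

theorem sum_weight_le [DecidableRel G.Adj] (hdeg : ∀ v, Fintype.card V < 2 * G.degree v) :
    ∑ i, ∑ j, ∑ k, weight G (labelClass l i) (labelClass l j) (labelClass l k) ≤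
      4 * triCount G univ univ univ - 24 * r * #G.edgeFinset + 6 * r * Fintype.card V ^ 2 := by
  set F : Fin r → Fin r → Fin r → ℤ := fun i j k =>
    8 * (#(labelClass l i) : ℤ) + 2 * ((#(labelClass l i) - 2) * (#(labelClass l j) - 2)) - 8 -
      4 * edgeCount G (labelClass l i) (labelClass l j) -
      surplus G (labelClass l i) (labelClass l j) (labelClass l k) with hF
  have hw : ∀ i j k, weight G (labelClass l i) (labelClass l j) (labelClass l k) =
      4 * triCount G (labelClass l i) (labelClass l j) (labelClass l k) +
        (F i j k + F j k i + F k i j) := by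
    intro i j k
    rw [weight, hF, surplus_comm (labelClass l i) (labelClass l k),
      edgeCount_comm (labelClass l i) (labelClass l k)]
    ring
  have hE : ∑ i, ∑ j, ∑ _k : Fin r, edgeCount G (labelClass l i) (labelClass l j) =
      r * (2 * #G.edgeFinset) := by
    simp only [sum_const, card_univ, Fintype.card_fin, nsmul_eq_mul, ← mul_sum]
    rw [sum_edgeCount, edgeCount_univ]
  have hn : ∑ i, (#(labelClass l i) : ℤ) = Fintype.card V := by
    have : ∑ i, #(labelClass l i) = Fintype.card V :=
      (card_eq_sum_card_fiberwise fun x _ => mem_coe.2 (mem_univ (l x))).symm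
    exact_mod_cast this
  have hD : 0 ≤ ∑ i, ∑ j, ∑ k, surplus G (labelClass l i) (labelClass l j) (labelClass l k) :=
    sum_nonneg fun i _ => sum_nonneg fun j _ => sum_surplus_nonneg hdeg _ _
  have hFsum : ∑ i, ∑ j, ∑ k, F i j k ≤
      8 * r ^ 2 * Fintype.card V + 2 * (r * (Fintype.card V - 2 * r) ^ 2) - 8 * r ^ 3 -
        4 * (r * (2 * #G.edgeFinset)) := by
    simp only [hF, sum_sub_distrib, sum_add_distrib, ← mul_sum, hE]
    simp only [sum_const, card_univ, Fintype.card_fin, nsmul_eq_mul, ← mul_sum, ← sum_mul,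
      sum_sub_distrib, hn]
    linarith
  simp only [hw, sum_add_distrib, ← mul_sum, sum_triCount]
  rw [sum_rotate fun i j k => F j k i, sum_rotate F]
  linarith

end GlobalCount

section Packing

variable {V : Type*} {G : SimpleGraph V}

theorem triCount_univ_le [Fintype V] [DecidableEq V] [DecidableRel G.Adj] :
    triCount G univ univ univ ≤ 6 * #(G.cliqueFinset 3) := by
  set S : Finset (V × V × V) := {x | G.Adj x.2.1 x.2.2 ∧ G.Adj x.1 x.2.1 ∧ G.Adj x.1 x.2.2}
    with hS
  have h₁ : triCount G univ univ univ = #S := by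
    rw [hS, card_filter, Fintype.sum_prod_type]
    simp only [Fintype.sum_prod_type, triCount, triCountAt]
    push_cast
    refine sum_congr rfl fun c _ => sum_congr rfl fun a _ => sum_congr rfl fun b _ => ?_
    by_cases h₁ : G.Adj a b <;> by_cases h₂ : G.Adj c a <;> by_cases h₃ : G.Adj c b <;>
      simp [adjBit, h₁, h₂, h₃]
  have h₂ := card_le_mul_card_image_of_maps_to (s := S) (t := G.cliqueFinset 3)
    (f := fun x => {x.1, x.2.1, x.2.2}) (by
      rintro ⟨a, b, c⟩ h
      simp only [hS, mem_filter, mem_univ, true_and] at h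
      rw [SimpleGraph.mem_cliqueFinset_iff, SimpleGraph.is3Clique_triple_iff]
      tauto) 6 (by
      intro t ht
      rw [SimpleGraph.mem_cliqueFinset_iff, SimpleGraph.is3Clique_iff] at ht
      obtain ⟨x, y, z, hxy, hxz, hyz, rfl⟩ := ht
      refine (card_le_card (t := {(x, y, z), (x, z, y), (y, x, z), (y, z, x), (z, x, y),
        (z, y, x)}) ?_).trans card_le_six
      rintro ⟨a, b, c⟩ h
      simp only [hS, mem_filter, mem_univ, true_and] at h
      obtain ⟨⟨hbc, hab, hac⟩, he⟩ := h
      have h₁ : a ∈ ({x, y, z} : Finset V) := he ▸ by simp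
      have h₂ : b ∈ ({x, y, z} : Finset V) := he ▸ by simp
      have h₃ : c ∈ ({x, y, z} : Finset V) := he ▸ by simp
      have := hbc.ne
      have := hab.ne
      have := hac.ne
      simp only [mem_insert, mem_singleton, Prod.mk.injEq] at h₁ h₂ h₃ ⊢
      grind)
  rw [h₁]
  exact_mod_cast h₂

/-- Two triangles that share an edge and have the same label sum have equally labelled, hence
adjacent, third vertices. -/
theorem card_inter_le_one [DecidableEq V] (hK : G.CliqueFree 4) {ι : Type*} [AddCommGroup ι]
    {l : V → ι} (hl : IsCliqueLabelling G l) {s t : Finset V} (hs : G.IsNClique 3 s) (ht : G.IsNClique 3 t)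
    (hst : ∑ v ∈ s, l v = ∑ v ∈ t, l v) (hne : s ≠ t) : #(s ∩ t) ≤ 1 := by
  by_contra! h
  have hlt : #(s ∩ t) < 3 := by
    refine lt_of_le_of_ne ((card_le_card inter_subset_left).trans hs.card_eq.le) fun h3 => hne ?_
    have h₁ := eq_of_subset_of_card_le inter_subset_left (hs.card_eq.trans h3.symm).le
    have h₂ := eq_of_subset_of_card_le inter_subset_right (ht.card_eq.trans h3.symm).le
    exact h₁.symm.trans h₂
  have h2 : #(s ∩ t) = 2 := by omega
  have hs1 : #(s \ t) = 1 := by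
    have := card_sdiff_add_card_inter s t
    have := hs.card_eq
    omega
  have ht1 : #(t \ s) = 1 := by
    have := card_sdiff_add_card_inter t s
    have := ht.card_eq
    rw [inter_comm] at h2
    omega
  obtain ⟨a, ha⟩ := card_eq_one.1 hs1
  obtain ⟨b, hb⟩ := card_eq_one.1 ht1
  obtain ⟨x, y, hxy, hi⟩ := card_eq_two.1 h2
  have hmem : ∀ v, v ∈ s \ t ↔ v = a := by simp [ha]
  have hmem' : ∀ v, v ∈ t \ s ↔ v = b := by simp [hb]
  have hmem'' : ∀ v, v ∈ s ∩ t ↔ v = x ∨ v = y := by simp [hi]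
  have hlab : l a = l b := by
    rw [← sum_inter_add_sum_sdiff s t, ← sum_inter_add_sum_sdiff t s, inter_comm t s, ha, hb] at hst
    simpa using hst
  have ha' := (hmem a).2 rfl
  have hb' := (hmem' b).2 rfl
  have hx' := (hmem'' x).2 (Or.inl rfl)
  have hy' := (hmem'' y).2 (Or.inr rfl)
  simp only [mem_sdiff, mem_inter] at ha' hb' hx' hy'
  have hne {u v : V} {p : Finset V} (hu : u ∈ p) (hv : v ∉ p) : v ≠ u := by
    rintro rfl
    exact hv hu
  have hsc := hs.isClique
  have htc := ht.isClique
  exact not_adj_of_cliqueFree_four hK (hsc hx'.1 hy'.1 hxy) (hsc hx'.1 ha'.1 (hne hx'.2 ha'.2).symm)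
    (htc hx'.2 hb'.1 (hne hx'.1 hb'.2).symm) (hsc hy'.1 ha'.1 (hne hy'.2 ha'.2).symm)
    (htc hy'.2 hb'.1 (hne hy'.1 hb'.2).symm) (hl (hne hb'.1 ha'.2) hlab)

/-- A family of pairwise edge-disjoint triangles. -/
def IsTrianglePacking [DecidableEq V] (G : SimpleGraph V) (T : Finset (Finset V)) : Prop :=
  (∀ t ∈ T, #t = 3 ∧ G.IsClique (t : Set V)) ∧ ∀ t₁ ∈ T, ∀ t₂ ∈ T, t₁ ≠ t₂ → #(t₁ ∩ t₂) ≤ 1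

theorem exists_packing_of_labelling [Fintype V] [DecidableEq V] [DecidableRel G.Adj]
    (hK : G.CliqueFree 4) {r : ℕ} [NeZero r] {l : V → Fin r} (hl : IsCliqueLabelling G l) :
    ∃ T, IsTrianglePacking G T ∧ #(G.cliqueFinset 3) ≤ r * #T := by
  obtain ⟨s, -, hs⟩ := exists_max_image (univ : Finset (Fin r))
    (fun s => #{t ∈ G.cliqueFinset 3 | ∑ v ∈ t, l v = s}) univ_nonempty
  refine ⟨{t ∈ G.cliqueFinset 3 | ∑ v ∈ t, l v = s}, ⟨fun t ht => ?_, fun t₁ h₁ t₂ h₂ hne => ?_⟩, ?_⟩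
  · rw [mem_filter, SimpleGraph.mem_cliqueFinset_iff] at ht
    exact ⟨ht.1.card_eq, ht.1.isClique⟩
  · rw [mem_filter, SimpleGraph.mem_cliqueFinset_iff] at h₁ h₂
    exact card_inter_le_one hK hl h₁.1 h₂.1 (h₁.2.trans h₂.2.symm) hne
  · have := card_le_mul_card_image_of_maps_to (s := G.cliqueFinset 3) (t := (univ : Finset (Fin r)))
      (f := fun t => ∑ v ∈ t, l v) (fun _ _ => mem_univ _) _ fun s' _ => hs s' (mem_univ s')
    rw [card_univ, Fintype.card_fin, mul_comm] at this
    exact this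

theorem exists_packing_of_degree [Fintype V] [DecidableEq V] [DecidableRel G.Adj] [Nonempty V]
    (hK : G.CliqueFree 4) (hdeg : ∀ v, Fintype.card V < 2 * G.degree v) :
    ∃ T, IsTrianglePacking G T ∧ 4 * #G.edgeFinset ≤ Fintype.card V ^ 2 + 4 * #T := by
  obtain ⟨r, l, hl, hsurj, hcard⟩ := exists_labelling_card_two_or_three hK hdeg
  have hr : 0 < r := (l (Classical.arbitrary V)).pos
  have : NeZero r := ⟨hr.ne'⟩
  obtain ⟨T, hT, hTcard⟩ := exists_packing_of_labelling hK hl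
  refine ⟨T, hT, ?_⟩
  have h₁ := (sum_weight_nonneg hK hl hsurj hcard).trans (sum_weight_le hdeg)
  have h₂ := triCount_univ_le (G := G)
  have h₃ : (#(G.cliqueFinset 3) : ℤ) ≤ r * #T := by exact_mod_cast hTcard
  have h₄ : (r : ℤ) * (4 * #G.edgeFinset) ≤ r * (Fintype.card V ^ 2 + 4 * #T) := by linarith
  exact_mod_cast le_of_mul_le_mul_left h₄ (by exact_mod_cast hr)

theorem IsTrianglePacking.map {W : Type*} [DecidableEq V] [DecidableEq W] {H : SimpleGraph W}
    {T : Finset (Finset W)} (hT : IsTrianglePacking H T) (f : H ↪g G) :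
    IsTrianglePacking G (T.map (mapEmbedding f.toEmbedding).toEmbedding) := by
  constructor
  · simp only [mem_map, forall_exists_index, and_imp]
    rintro _ t ht rfl
    obtain ⟨h₁, h₂⟩ := hT.1 t ht
    refine ⟨by simpa using h₁, ?_⟩
    simp only [RelEmbedding.coe_toEmbedding, mapEmbedding_apply, coe_map]
    rintro _ ⟨u, hu, rfl⟩ _ ⟨v, hv, rfl⟩ huv
    exact f.map_adj_iff.2 (h₂ hu hv fun h => huv (h ▸ rfl))
  · simp only [mem_map, forall_exists_index, and_imp]
    rintro _ t₁ ht₁ rfl _ t₂ ht₂ rfl hne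
    simp only [RelEmbedding.coe_toEmbedding, mapEmbedding_apply]
    rw [← map_inter, card_map]
    exact hT.2 t₁ ht₁ t₂ ht₂ fun h => hne (h ▸ rfl)

theorem exists_packing (n k : ℕ) : ∀ {V : Type*} [Fintype V] [DecidableEq V] (G : SimpleGraph V)
    [DecidableRel G.Adj], Fintype.card V = n → G.CliqueFree 4 → n ^ 2 / 4 + k ≤ #G.edgeFinset →
    ∃ T, IsTrianglePacking G T ∧ k ≤ #T := by
  induction n with
  | zero =>
    intro V _ _ G _ hV _ he
    have := Fintype.card_eq_zero_iff.1 hV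
    have : #G.edgeFinset = 0 := by simpa using Subsingleton.elim G ⊥
    exact ⟨∅, by simp [IsTrianglePacking], by omega⟩
  | succ n ih =>
    intro V _ _ G _ hV hK he
    by_cases hdeg : ∀ v, Fintype.card V < 2 * G.degree v
    · have : Nonempty V := Fintype.card_pos_iff.1 (by omega)
      obtain ⟨T, hT, h⟩ := exists_packing_of_degree hK hdeg
      refine ⟨T, hT, ?_⟩
      rw [hV] at h
      omega
    · push Not at hdeg
      obtain ⟨v, hv⟩ := hdeg
      have hcard := G.card_edgeFinset_induce_compl_singleton v
      rw [G.card_edgeFinset_deleteIncidenceSet] at hcard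
      obtain ⟨T, hT, h⟩ := ih (G.induce {v}ᶜ) (by
        rw [Fintype.card_compl_set, hV]; simp)
        (hK.comap (SimpleGraph.Embedding.induce _).isContained) (by
        rw [hcard]
        have : (n + 1) ^ 2 / 4 = n ^ 2 / 4 + (n + 1) / 2 := by
          obtain ⟨m, rfl | rfl⟩ := n.even_or_odd'
          · have h₁ : (2 * m + 1) ^ 2 = 4 * (m ^ 2 + m) + 1 := by ring
            have h₂ : (2 * m) ^ 2 = 4 * m ^ 2 := by ring
            omega
          · have h₁ : (2 * m + 1 + 1) ^ 2 = 4 * (m ^ 2 + 2 * m + 1) := by ring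
            have h₂ : (2 * m + 1) ^ 2 = 4 * (m ^ 2 + m) + 1 := by ring
            omega
        omega)
      exact ⟨_, hT.map (SimpleGraph.Embedding.induce _), by rwa [card_map]⟩

end Packing

end TrianglePacking

/-- Every `K₄`-free graph on `n` vertices with at least `⌊n²/4⌋ + k` edges contains
at least `k` pairwise edge-disjoint triangles. -/
theorem gyori_keszegh :
    ∀ (n k : ℕ) (G : SimpleGraph (Fin n)), G.CliqueFree 4 →
      n ^ 2 / 4 + k ≤ G.edgeSet.ncard →
      ∃ T : Finset (Finset (Fin n)),
        (∀ t ∈ T, t.card = 3 ∧ G.IsClique (t : Set (Fin n))) ∧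
        (∀ t₁ ∈ T, ∀ t₂ ∈ T, t₁ ≠ t₂ → (t₁ ∩ t₂).card ≤ 1) ∧
        k ≤ T.card := by
  classical
  intro n k G hK he
  have hcard : G.edgeFinset.card = G.edgeSet.ncard := by
    rw [← SimpleGraph.coe_edgeFinset, Set.ncard_coe_finset]
  obtain ⟨T, ⟨h₁, h₂⟩, h₃⟩ :=
    TrianglePacking.exists_packing n k G (Fintype.card_fin n) hK (hcard ▸ he)
  exact ⟨T, h₁, fun t₁ ht₁ t₂ ht₂ hne => by convert h₂ t₁ ht₁ t₂ ht₂ hne, h₃⟩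
end

section
/- For every ε > 0 there exists N such that for every simple graph G on at least N vertices, the average of π_{3,f}(G[W]) over all 7-element subsets W of the vertex set of G is at most 21 + ε; that is, if W is a uniformly random 7-element subset of V(G), then E_W[π_{3,f}(G[W])] ≤ 21 + o(1). -/
open Finset

/-- `w` is a fractional `3`-decomposition of `H`: a non-negative weighting of the
complete subgraphs of `H` of order at most `3` such that for every edge of `H` the
weights of the complete subgraphs containing it sum to one. -/
def IsFracDecomp {V : Type*} [Fintype V] [DecidableEq V] (H : SimpleGraph V) (k : ℕ)
    (w : Finset V → ℝ) : Prop :=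
  (∀ C, 0 ≤ w C) ∧
  (∀ C : Finset V, w C ≠ 0 → H.IsClique (C : Set V) ∧ C.card ≤ k) ∧
  ∀ u v : V, H.Adj u v → ∑ C ∈ univ.filter (fun C : Finset V => u ∈ C ∧ v ∈ C), w C = 1

/-- The weight of a fractional decomposition: the sum of the weights of the complete
subgraphs multiplied by their orders. -/
noncomputable def fracWeight {V : Type*} [Fintype V] [DecidableEq V]
    (w : Finset V → ℝ) : ℝ :=
  ∑ C : Finset V, w C * C.card

/-- `π_{k,f}(H)`: the minimum weight of a fractional `k`-decomposition of `H`. -/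
noncomputable def piFrac {V : Type*} [Fintype V] [DecidableEq V]
    (H : SimpleGraph V) (k : ℕ) : ℝ :=
  sInf { x | ∃ w, IsFracDecomp H k w ∧ fracWeight w = x }

/-- The bit `i` of the number `g`. -/
def bitAt (g i : ℕ) : Bool := Nat.beq (Nat.land (Nat.shiftRight g i) 1) 1

/-- The position of the pair `i < j` in the colexicographic order. -/
def colexIdx (i j : ℕ) : ℕ := Nat.add (Nat.div (Nat.mul j (Nat.sub j 1)) 2) i

/-- The position of the pair `{i, j}` in the colexicographic order. -/
def pairIdx (i j : ℕ) : ℕ := bif Nat.ble i j then colexIdx i j else colexIdx j i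

lemma bitAt_eq_testBit (g i : ℕ) : bitAt g i = g.testBit i := by
  have h : Nat.land (Nat.shiftRight g i) 1 = (g >>> i) % 2 := Nat.and_one_is_mod _
  rw [bitAt, h, Nat.testBit_eq_decide_div_mod_eq, Nat.shiftRight_eq_div_pow]
  rw [Bool.eq_iff_iff]
  simp

lemma colexIdx_eq (i j : ℕ) : colexIdx i j = j * (j - 1) / 2 + i := rfl

lemma pairIdx_of_le {i j : ℕ} (h : i ≤ j) : pairIdx i j = colexIdx i j := by
  simp [pairIdx, Nat.ble_eq_true_of_le h]

lemma pairIdx_comm (i j : ℕ) : pairIdx i j = pairIdx j i := by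
  have key : ∀ {i j : ℕ}, i < j → pairIdx i j = pairIdx j i := fun {i j} h ↦ by
    rw [pairIdx_of_le h.le, pairIdx, Bool.cond_neg]
    rw [← Bool.not_eq_true, Nat.ble_eq]
    lia
  rcases lt_trichotomy i j with h | rfl | h
  · exact key h
  · rfl
  · exact (key h).symm

lemma succ_mul_self_div_two (k : ℕ) : (k + 1) * k / 2 = k * (k - 1) / 2 + k := by
  cases k with
  | zero => rfl
  | succ n =>
    rw [Nat.add_sub_cancel, show (n + 1 + 1) * (n + 1) = (n + 1) * n + (n + 1) * 2 by ring,
      Nat.add_mul_div_right _ _ two_pos]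

lemma colexIdx_lt {i j k : ℕ} (hij : i < j) (hjk : j < k) : colexIdx i j < k * (k - 1) / 2 := by
  have h : (j + 1) * j / 2 ≤ k * (k - 1) / 2 :=
    Nat.div_le_div_right (Nat.mul_le_mul hjk (by lia))
  rw [succ_mul_self_div_two] at h
  rw [colexIdx_eq]
  lia

/-- The graph on `Fin k` whose edges are given by the bits of `g`. -/
def maskGraph (k g : ℕ) : SimpleGraph (Fin k) where
  Adj i j := i ≠ j ∧ bitAt g (pairIdx i j) = true
  symm := ⟨fun i j h ↦ ⟨h.1.symm, pairIdx_comm i j ▸ h.2⟩⟩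
  loopless := ⟨fun _ h ↦ h.1 rfl⟩

/-- Every graph on `Fin k` is isomorphic to one encoded in the list. -/
def CoversGraphs (k : ℕ) (L : List ℕ) : Prop :=
  ∀ H : SimpleGraph (Fin k), ∃ g ∈ L, Nonempty (H ≃g maskGraph k g)

/-- All encodings of graphs on `k + 1` vertices that extend a graph of the list by a vertex. -/
def extensions (k : ℕ) (L : List ℕ) : List ℕ :=
  L.flatMap fun r ↦ (List.range (2 ^ k)).map fun s ↦ r + s * 2 ^ (k * (k - 1) / 2)

lemma coversGraphs_extensions {k : ℕ} {L : List ℕ} (hL : CoversGraphs k L)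
    (hlt : ∀ r ∈ L, r < 2 ^ (k * (k - 1) / 2)) : CoversGraphs (k + 1) (extensions k L) := by
  classical
  intro H
  obtain ⟨r, hr, ⟨e⟩⟩ := hL (H.comap Fin.castSucc)
  set s := Nat.ofBits fun i : Fin k ↦ decide (H.Adj (e.symm i).castSucc (Fin.last k)) with hs
  have hs_bit (i : Fin k) : s.testBit i = decide (H.Adj (e.symm i).castSucc (Fin.last k)) := by
    rw [hs, Nat.testBit_ofBits_lt _ _ i.2]
  have hbit (m : ℕ) : bitAt (r + s * 2 ^ (k * (k - 1) / 2)) m =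
      if m < k * (k - 1) / 2 then r.testBit m else s.testBit (m - k * (k - 1) / 2) := by
    rw [bitAt_eq_testBit, add_comm, mul_comm, Nat.testBit_two_pow_mul_add _ (hlt r hr)]
  refine ⟨r + s * 2 ^ (k * (k - 1) / 2), ?_, ⟨?_⟩⟩
  · rw [extensions, List.mem_flatMap]
    exact ⟨r, hr, List.mem_map.2 ⟨s, List.mem_range.2 (Nat.ofBits_lt_two_pow _), rfl⟩⟩
  have hlast (a : Fin k) : bitAt (r + s * 2 ^ (k * (k - 1) / 2)) (pairIdx (e a) k) = true ↔
      H.Adj a.castSucc (Fin.last k) := by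
    rw [pairIdx_of_le (e a).2.le, hbit, colexIdx_eq, if_neg (by lia), Nat.add_sub_cancel_left,
      hs_bit]
    simp
  have hcast {a b : Fin k} (hab : a < b) :
      bitAt (r + s * 2 ^ (k * (k - 1) / 2)) (pairIdx a b) = bitAt r (pairIdx a b) := by
    rw [hbit, pairIdx_of_le hab.le, if_pos (colexIdx_lt hab b.2), bitAt_eq_testBit]
  have hcast' {a b : Fin k} (hab : a ≠ b) :
      bitAt (r + s * 2 ^ (k * (k - 1) / 2)) (pairIdx a b) = bitAt r (pairIdx a b) := by
    rcases hab.lt_or_gt with h | h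
    · exact hcast h
    · rw [pairIdx_comm a b]
      exact hcast h
  refine ⟨finSuccEquivLast.trans ((Equiv.optionCongr e.toEquiv).trans finSuccEquivLast.symm), ?_⟩
  intro a b
  induction a using Fin.lastCases with
  | last =>
    induction b using Fin.lastCases with
    | last => simp
    | cast b =>
      rw [SimpleGraph.adj_comm, SimpleGraph.adj_comm H, ← hlast b]
      simp [maskGraph, Fin.castSucc_ne_last]
  | cast a =>
    induction b using Fin.lastCases with
    | last =>
      rw [← hlast a]
      simp [maskGraph, Fin.castSucc_ne_last]
    | cast b =>
      have := e.map_adj_iff (v := a) (w := b)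
      rw [SimpleGraph.comap_adj] at this
      rw [← this]
      have hab (h : e a ≠ e b) := hcast' h
      simpa [maskGraph] using hab

/-- All numbers below the second argument satisfy `f`. -/
def forallBelow (f : ℕ → Bool) : ℕ → Bool
  | 0 => true
  | n + 1 => and (f n) (forallBelow f n)

lemma forallBelow_eq_true {f : ℕ → Bool} {n : ℕ} :
    forallBelow f n = true ↔ ∀ i < n, f i = true := by
  induction n with
  | zero => simp [forallBelow]
  | succ n ih => rw [forallBelow, Bool.and_eq_true, ih, Nat.forall_lt_succ_right, and_comm]

/-- The digit `i` in base eight of the code `p`. -/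
def octalDigit (p i : ℕ) : ℕ := Nat.land (Nat.shiftRight p (Nat.mul 3 i)) 7

/-- The octal digits of `p` give an isomorphism between the graphs on `k` vertices encoded by
`g` and `h`. -/
def isIsoCode (k g h p : ℕ) : Bool :=
  forallBelow (fun j ↦ and (Nat.blt (octalDigit p j) k) (forallBelow (fun i ↦
    and (not (Nat.beq (octalDigit p i) (octalDigit p j)))
      (bitAt g (colexIdx i j) == bitAt h (pairIdx (octalDigit p i) (octalDigit p j)))) j)) k

lemma exists_iso_of_isIsoCode {k g h p : ℕ} (hp : isIsoCode k g h p = true) :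
    Nonempty (maskGraph k g ≃g maskGraph k h) := by
  simp only [isIsoCode, forallBelow_eq_true, Bool.and_eq_true, Nat.blt_eq, Bool.not_eq_true',
    beq_iff_eq] at hp
  let f : Fin k → Fin k := fun i ↦ ⟨octalDigit p i, (hp i i.2).1⟩
  have hlt {i j : Fin k} (hij : i < j) :
      f i ≠ f j ∧ bitAt g (pairIdx i j) = bitAt h (pairIdx (f i) (f j)) := by
    obtain ⟨h1, h2⟩ := (hp j j.2).2 i hij
    refine ⟨fun H ↦ ?_, by rw [pairIdx_of_le (le_of_lt hij), h2]⟩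
    have : octalDigit p i = octalDigit p j := congrArg Fin.val H
    simp [this] at h1
  have hne {i j : Fin k} (hij : i ≠ j) :
      f i ≠ f j ∧ bitAt g (pairIdx i j) = bitAt h (pairIdx (f i) (f j)) := by
    rcases hij.lt_or_gt with h | h
    · exact hlt h
    · rw [pairIdx_comm i j, pairIdx_comm (f i) (f j)]
      exact ⟨(hlt h).1.symm, (hlt h).2⟩
  have hf : Function.Injective f := fun i j hij ↦ by
    by_contra h
    exact (hne h).1 hij
  refine ⟨Equiv.ofBijective f (Finite.injective_iff_bijective.1 hf), ?_⟩
  intro i j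
  by_cases hij : i = j
  · simp [hij]
  · simp [maskGraph, hij, hf.ne hij, (hne hij).2]

/-- Each graph of the first list is isomorphic to one in `reps` by the corresponding entry of the
list of isomorphism codes. -/
def reducesTo (k : ℕ) (reps : List ℕ) : List ℕ → List (ℕ × ℕ) → Bool
  | [], _ => true
  | _ :: _, [] => false
  | g :: l, q :: m =>
    and (and (reps.any (Nat.beq q.1)) (isIsoCode k g q.1 q.2)) (reducesTo k reps l m)

lemma CoversGraphs.of_reducesTo {k : ℕ} {reps L : List ℕ} {codes : List (ℕ × ℕ)}
    (hL : CoversGraphs k L) (h : reducesTo k reps L codes = true) : CoversGraphs k reps := by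
  have key : ∀ g ∈ L, ∃ h ∈ reps, Nonempty (maskGraph k g ≃g maskGraph k h) := by
    clear hL
    induction L generalizing codes with
    | nil => simp
    | cons g l ih =>
      cases codes with
      | nil => simp [reducesTo] at h
      | cons q m =>
        simp only [reducesTo, Bool.and_eq_true, List.any_eq_true] at h
        obtain ⟨⟨⟨r, hr, hqr⟩, hq⟩, hm⟩ := h
        rw [List.forall_mem_cons]
        exact ⟨⟨r, hr, exists_iso_of_isIsoCode (Nat.eq_of_beq_eq_true hqr ▸ hq)⟩, ih hm⟩
  intro H
  obtain ⟨g, hg, ⟨e⟩⟩ := hL H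
  obtain ⟨r, hr, ⟨e'⟩⟩ := key g hg
  exact ⟨r, hr, ⟨e'.comp e⟩⟩

section FracDecomp

variable {V V' : Type*} [Fintype V] [DecidableEq V] [Fintype V'] [DecidableEq V']

lemma IsFracDecomp.comap {H : SimpleGraph V} {H' : SimpleGraph V'} {k : ℕ} {w : Finset V' → ℝ}
    (hw : IsFracDecomp H' k w) (e : H ≃g H') :
    IsFracDecomp H k fun C ↦ w (C.map e.toEquiv.toEmbedding) := by
  obtain ⟨h0, h1, h2⟩ := hw
  refine ⟨fun C ↦ h0 _, fun C hC ↦ ?_, fun u v huv ↦ ?_⟩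
  · obtain ⟨hcl, hcard⟩ := h1 _ hC
    rw [card_map] at hcard
    refine ⟨fun x hx y hy hxy ↦ ?_, hcard⟩
    rw [← e.map_adj_iff]
    exact hcl (by simpa using hx) (by simpa using hy) (e.injective.ne hxy)
  · rw [← h2 (e u) (e v) (e.map_adj_iff.2 huv)]
    refine sum_equiv e.toEquiv.finsetCongr (fun C ↦ ?_) fun C _ ↦ ?_
    · have h (x : V) : e x ∈ C.map e.toEquiv.toEmbedding ↔ x ∈ C := mem_map' e.toEquiv.toEmbedding
      simp only [mem_filter, mem_univ, true_and, Equiv.finsetCongr_apply, h]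
    · simp [Equiv.finsetCongr]

lemma fracWeight_comap (w : Finset V' → ℝ) (e : V ≃ V') :
    fracWeight (fun C ↦ w (C.map e.toEmbedding)) = fracWeight w := by
  refine sum_equiv e.finsetCongr (by simp) fun C _ ↦ ?_
  simp [Equiv.finsetCongr]

lemma piFrac_congr {H : SimpleGraph V} {H' : SimpleGraph V'} (e : H ≃g H') (k : ℕ) :
    piFrac H k = piFrac H' k := by
  rw [piFrac, piFrac]
  congr 1
  ext x
  constructor
  · rintro ⟨w, hw, rfl⟩
    exact ⟨_, hw.comap e.symm, fracWeight_comap w e.symm.toEquiv⟩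
  · rintro ⟨w, hw, rfl⟩
    exact ⟨_, hw.comap e, fracWeight_comap w e.toEquiv⟩

lemma IsFracDecomp.piFrac_le {H : SimpleGraph V} {k : ℕ} {w : Finset V → ℝ}
    (hw : IsFracDecomp H k w) : piFrac H k ≤ fracWeight w := by
  refine csInf_le ⟨0, ?_⟩ ⟨w, hw, rfl⟩
  rintro _ ⟨w', hw', rfl⟩
  exact sum_nonneg fun C _ ↦ mul_nonneg (hw'.1 C) (Nat.cast_nonneg _)

open Classical in
/-- A fractional triangle packing `t` extends to a fractional `3`-decomposition by adding edges. -/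
lemma piFrac_three_le_of_packing {H : SimpleGraph V} {t : Finset V → ℝ} (h0 : ∀ C, 0 ≤ t C)
    (hcl : ∀ C, t C ≠ 0 → H.IsClique (C : Set V) ∧ #C = 3)
    (hload : ∀ u v, H.Adj u v → ∑ C with u ∈ C ∧ v ∈ C, t C ≤ 1) :
    piFrac H 3 ≤ (∑ u, ∑ v, if H.Adj u v then (1 : ℝ) else 0) - 3 * ∑ C, t C := by
  set r : V → V → ℝ := fun u v ↦ if H.Adj u v then (1 - ∑ C with u ∈ C ∧ v ∈ C, t C) / 2 else 0
    with hr
  have hr0 (u v : V) : 0 ≤ r u v := by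
    rw [hr]
    dsimp only
    split_ifs with h
    · linarith [hload u v h]
    · rfl
  have hr_comm (u v : V) : r u v = r v u := by
    simp only [hr, SimpleGraph.adj_comm H u v, and_comm (a := u ∈ _)]
  set w : Finset V → ℝ := fun C ↦ t C + ∑ u, ∑ v, if C = {u, v} then r u v else 0 with hw
  have hdecomp : IsFracDecomp H 3 w := by
    refine ⟨fun C ↦ ?_, fun C hC ↦ ?_, fun a b hab ↦ ?_⟩
    · refine add_nonneg (h0 C) (sum_nonneg fun u _ ↦ sum_nonneg fun v _ ↦ ?_)
      split_ifs
      exacts [hr0 u v, le_rfl]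
    · by_cases ht : t C = 0
      · rw [hw] at hC
        dsimp only at hC
        rw [ht, zero_add] at hC
        obtain ⟨u, -, hu⟩ := exists_ne_zero_of_sum_ne_zero hC
        obtain ⟨v, -, hv⟩ := exists_ne_zero_of_sum_ne_zero hu
        obtain ⟨rfl, hrv⟩ := ite_ne_right_iff.1 hv
        have huv : H.Adj u v := (ite_ne_right_iff.1 hrv).1
        refine ⟨?_, card_le_two.trans (by norm_num)⟩
        simpa using fun _ ↦ huv
      · exact ⟨(hcl C ht).1, (hcl C ht).2.le⟩
    · have hab' := hab.ne
      have key : ∑ C : Finset V with a ∈ C ∧ b ∈ C, ∑ u, ∑ v, (if C = {u, v} then r u v else 0) =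
          ∑ u, ∑ v,
            ((if u = a ∧ v = b then r a b else 0) + if u = b ∧ v = a then r b a else 0) := by
        rw [sum_comm]
        refine sum_congr rfl fun u _ ↦ ?_
        rw [sum_comm]
        refine sum_congr rfl fun v _ ↦ ?_
        rw [sum_ite_eq']
        simp only [mem_filter, mem_univ, true_and, mem_insert, mem_singleton]
        by_cases h1 : u = a ∧ v = b
        · obtain ⟨rfl, rfl⟩ := h1
          simp [hab']
        by_cases h2 : u = b ∧ v = a
        · obtain ⟨rfl, rfl⟩ := h2
          simp [hab']
        rw [if_neg h1, if_neg h2, if_neg, add_zero]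
        grind
      have hsum : ∑ u, ∑ v, ((if u = a ∧ v = b then r a b else 0) +
          if u = b ∧ v = a then r b a else 0) = r a b + r b a := by
        simp [sum_add_distrib, ite_and]
      rw [sum_add_distrib, key, hsum, hr_comm b a]
      simp only [hr, if_pos hab]
      ring
  refine hdecomp.piFrac_le.trans_eq ?_
  have htcard : ∑ C, t C * (#C : ℝ) = 3 * ∑ C, t C := by
    rw [mul_sum]
    refine sum_congr rfl fun C _ ↦ ?_
    by_cases ht : t C = 0
    · simp [ht]
    · rw [(hcl C ht).2]
      push_cast
      ring
  have hrcard : ∑ C : Finset V, (∑ u, ∑ v, if C = {u, v} then r u v else 0) * (#C : ℝ) =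
      ∑ u, ∑ v, 2 * r u v := by
    simp_rw [sum_mul]
    rw [sum_comm]
    refine sum_congr rfl fun u _ ↦ ?_
    rw [sum_comm]
    refine sum_congr rfl fun v _ ↦ ?_
    simp_rw [ite_mul, zero_mul]
    rw [sum_ite_eq', if_pos (mem_univ _)]
    by_cases huv : H.Adj u v
    · rw [card_pair huv.ne]
      push_cast
      ring
    · simp [hr, huv]
  have hr2 : ∑ u, ∑ v, 2 * r u v = (∑ u, ∑ v, if H.Adj u v then (1 : ℝ) else 0) -
      ∑ u, ∑ v, ∑ C, if H.Adj u v ∧ u ∈ C ∧ v ∈ C then t C else 0 := by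
    simp_rw [← sum_sub_distrib]
    refine sum_congr rfl fun u _ ↦ sum_congr rfl fun v _ ↦ ?_
    by_cases huv : H.Adj u v
    · simp only [hr, huv, if_true, true_and, sum_filter]
      ring
    · simp [hr, huv]
  have hsix : ∑ u, ∑ v, ∑ C, (if H.Adj u v ∧ u ∈ C ∧ v ∈ C then t C else 0) = 6 * ∑ C, t C := by
    simp_rw [sum_comm (s := (univ : Finset V)) (t := (univ : Finset (Finset V)))]
    rw [mul_sum]
    refine sum_congr rfl fun C _ ↦ ?_
    by_cases ht : t C = 0
    · simp [ht]
    · obtain ⟨h1, h2⟩ := hcl C ht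
      have h3 : univ.filter (fun p : V × V ↦ H.Adj p.1 p.2 ∧ p.1 ∈ C ∧ p.2 ∈ C) = C.offDiag := by
        ext ⟨u, v⟩
        simp only [mem_filter, mem_univ, true_and, mem_offDiag]
        exact ⟨fun h ↦ ⟨h.2.1, h.2.2, h.1.ne⟩, fun h ↦ ⟨h1 h.1 h.2.1 h.2.2, h.1, h.2.1⟩⟩
      rw [← Fintype.sum_prod_type', ← sum_filter, h3, sum_const, offDiag_card, h2]
      norm_num
  rw [fracWeight]
  simp only [hw, add_mul, sum_add_distrib]
  rw [htcard, hrcard, hr2, hsix]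
  ring

end FracDecomp

/-- The vertices of `Fin 7` given by the seven lowest bits of `c`. -/
def vertexSet (c : ℕ) : Finset (Fin 7) := {i | bitAt c i = true}

/-- An entry `(s, p, l)` describes a fractional triangle packing of value `p / 6`. The list `l`
contains the numbers `128 * m + c`, where `c` encodes the vertices of a triangle of weight `m / 6`,
and `s` encodes a set of pairs containing all edges of these triangles. -/
def isPacking (q : ℕ × ℕ × List ℕ) : Bool :=
  and (and (Nat.beq (q.2.2.map fun c ↦ Nat.div c 128).sum q.2.1)
    (q.2.2.all fun c ↦ Nat.beq #(vertexSet c) 3))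
    (forallBelow (fun j ↦ forallBelow (fun i ↦
      and (Nat.ble (q.2.2.map fun c ↦ bif and (bitAt c i) (bitAt c j) then Nat.div c 128 else 0).sum 6)
        (q.2.2.all fun c ↦ or (not (and (bitAt c i) (bitAt c j))) (bitAt q.1 (colexIdx i j)))) j) 7)

lemma sum_sum_map_ite_vertexSet (l : List ℕ) (p : Finset (Fin 7) → Prop) [DecidablePred p] :
    ∑ C with p C, (l.map fun c ↦ if C = vertexSet c then ((c / 128 : ℕ) : ℝ) / 6 else 0).sum =
      ((l.map fun c ↦ if p (vertexSet c) then c / 128 else 0).sum : ℕ) / 6 := by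
  induction l with
  | nil => simp
  | cons c l ih =>
    simp only [List.map_cons, List.sum_cons, sum_add_distrib, ih, Nat.cast_add, add_div]
    congr 1
    rw [sum_ite_eq']
    simp only [mem_filter, mem_univ, true_and]
    split_ifs <;> simp

open Classical in
lemma piFrac_maskGraph_le {q : ℕ × ℕ × List ℕ} (hq : isPacking q = true) {g : ℕ}
    (hg : Nat.land q.1 g = q.1) :
    piFrac (maskGraph 7 g) 3 ≤
      (∑ u, ∑ v, if (maskGraph 7 g).Adj u v then (1 : ℝ) else 0) - q.2.1 / 2 := by
  obtain ⟨s, p, l⟩ := q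
  simp only [isPacking, Bool.and_eq_true, forallBelow_eq_true, List.all_eq_true, Nat.ble_eq,
    Nat.beq_eq, Bool.or_eq_true, Bool.not_eq_true'] at hq hg ⊢
  obtain ⟨⟨hp, hcard⟩, hpair⟩ := hq
  have hbit {i : ℕ} (hi : bitAt s i = true) : bitAt g i = true := by
    have h : (s &&& g).testBit i = s.testBit i := congrArg (Nat.testBit · i) hg
    rw [Nat.testBit_and] at h
    rw [bitAt_eq_testBit] at hi ⊢
    rw [hi] at h
    simpa using h
  have hpair' {i j : Fin 7} (hij : i ≠ j) :
      (l.map fun c ↦ if i ∈ vertexSet c ∧ j ∈ vertexSet c then c / 128 else 0).sum ≤ 6 ∧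
        ∀ c ∈ l, i ∈ vertexSet c → j ∈ vertexSet c → bitAt s (pairIdx i j) = true := by
    have key {i j : Fin 7} (hij : i < j) :
        (l.map fun c ↦ if i ∈ vertexSet c ∧ j ∈ vertexSet c then c / 128 else 0).sum ≤ 6 ∧
          ∀ c ∈ l, i ∈ vertexSet c → j ∈ vertexSet c → bitAt s (pairIdx i j) = true := by
      obtain ⟨h1, h2⟩ := hpair j j.2 i hij
      refine ⟨?_, fun c hc hi hj ↦ ?_⟩
      · convert h1 using 4 with c
        simp only [vertexSet, mem_filter, mem_univ, true_and, cond_eq_ite, Bool.and_eq_true]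
        rfl
      · rw [pairIdx_of_le (le_of_lt hij)]
        simp only [vertexSet, mem_filter, mem_univ, true_and] at hi hj
        simpa [hi, hj] using h2 c hc
    rcases hij.lt_or_gt with h | h
    · exact key h
    · simp_rw [pairIdx_comm i j, and_comm (a := i ∈ _)]
      exact ⟨(key h).1, fun c hc hi hj ↦ (key h).2 c hc hj hi⟩
  refine (piFrac_three_le_of_packing (t := fun C ↦
    (l.map fun c ↦ if C = vertexSet c then ((c / 128 : ℕ) : ℝ) / 6 else 0).sum)
    (fun C ↦ ?_) (fun C hC ↦ ?_) fun u v huv ↦ ?_).trans_eq ?_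
  · refine List.sum_nonneg fun x hx ↦ ?_
    obtain ⟨c, -, rfl⟩ := List.mem_map.1 hx
    positivity
  · obtain ⟨x, hx, hx0⟩ := List.exists_mem_ne_zero_of_sum_ne_zero hC
    obtain ⟨c, hc, rfl⟩ := List.mem_map.1 hx
    obtain rfl := (ite_ne_right_iff.1 hx0).1
    exact ⟨fun i hi j hj hij ↦ ⟨hij, hbit ((hpair' hij).2 c hc hi hj)⟩, hcard c hc⟩
  · rw [sum_sum_map_ite_vertexSet l fun C ↦ u ∈ C ∧ v ∈ C, div_le_one (by norm_num)]
    exact_mod_cast (hpair' huv.ne).1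
  · have h := sum_sum_map_ite_vertexSet l fun _ ↦ True
    simp only [filter_true, if_true] at h
    rw [h, show (l.map fun c ↦ c / 128).sum = p from hp]
    ring

lemma pairIdx_eq_ite (i j : ℕ) :
    pairIdx i j = if i ≤ j then j * (j - 1) / 2 + i else i * (i - 1) / 2 + j := by
  split_ifs with h
  · rw [pairIdx_of_le h, colexIdx_eq]
  · rw [pairIdx_comm, pairIdx_of_le (le_of_not_ge h), colexIdx_eq]

lemma sum_pairIdx_seven (y : ℕ → ℝ) :
    (∑ u : Fin 7, ∑ v : Fin 7, if u = v then 0 else y (pairIdx u v)) =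
      2 * ∑ i ∈ range 21, y i := by
  have h (u v : Fin 7) : (if u = v then 0 else y (pairIdx u v)) =
      if (u : ℕ) = v then 0 else y (pairIdx u v) := by simp only [Fin.ext_iff]
  have h' (u : ℕ) := Fin.sum_univ_eq_sum_range (fun v ↦ if u = v then 0 else y (pairIdx u v)) 7
  simp only [h, h']
  rw [Fin.sum_univ_eq_sum_range (fun u ↦ ∑ v ∈ range 7, if u = v then 0 else y (pairIdx u v)) 7]
  simp [sum_range_succ, pairIdx_eq_ite]
  ring

lemma sum_adj_maskGraph_seven (g : ℕ) [DecidableRel (maskGraph 7 g).Adj] :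
    (∑ u, ∑ v, if (maskGraph 7 g).Adj u v then (1 : ℝ) else 0) =
      2 * (∑ i ∈ range 21, (bitAt g i).toNat : ℕ) := by
  have h (u v : Fin 7) : (if (maskGraph 7 g).Adj u v then (1 : ℝ) else 0) =
      if u = v then 0 else ((bitAt g (pairIdx u v)).toNat : ℝ) := by
    by_cases huv : u = v
    · simp [huv]
    · cases hb : bitAt g (pairIdx u v) <;> simp [maskGraph, huv, hb]
  simp only [h]
  rw [sum_pairIdx_seven fun i ↦ ((bitAt g i).toNat : ℝ), Nat.cast_sum]

/-- The index in the list of flags of the graph on four vertices with the given edges, one of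
which is the root. The value `7` stands for all flags that are not used. -/
def flagTable : List ℕ :=
  [0, 7, 7, 7, 7, 7, 7, 7, 7, 7, 7, 3, 7, 7, 7, 7, 7, 7, 7, 7, 7, 1, 7, 4, 7, 7, 7, 7, 7, 4, 2, 5,
    7, 7, 7, 7, 7, 7, 1, 4, 7, 7, 7, 7, 7, 2, 4, 5, 7, 7, 7, 2, 7, 7, 7, 6, 1, 4, 4, 5, 7, 6, 6, 7]

/-- The positive semidefinite matrix of the flag algebra certificate. -/
def flagMatrix : List (List ℤ) :=
  [[504, 56, -184, -120, 371, -64, 108, 0],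
   [56, 248, -184, -248, 177, 72, -76, 0],
   [-184, -184, 280, -104, -277, 56, -60, 0],
   [-120, -248, -104, 1176, -71, -320, 300, 0],
   [371, 177, -277, -71, 387, -49, 73, 0],
   [-64, 72, 56, -320, -49, 109, -113, 0],
   [108, -76, -60, 300, 73, -113, 123, 0],
   [0, 0, 0, 0, 0, 0, 0, 0]]

/-- The flag with the given edges, in the order `01, 02, 12, 03, 13, 23` with root `0`. -/
def flagType (b₀ b₁ b₂ b₃ b₄ b₅ : Bool) : ℕ :=
  flagTable.getD (b₀.toNat + 2 * b₁.toNat + 4 * b₂.toNat + 8 * b₃.toNat + 16 * b₄.toNat +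
    32 * b₅.toNat) 7

/-- The entries of `flagMatrix`. -/
def flagWeight (i j : ℕ) : ℤ := (flagMatrix.getD i []).getD j 0

/-- Weighted squares of linear forms summing to a multiple of the quadratic form of
`flagMatrix`. -/
def flagSquares : List (ℤ × List ℤ) :=
  [(29921710, [504, 56, -184, -120, 371, -64, 108]),
   (476840, [0, -1232, -776, 6024, 91, -1760, 1710]),
   (81744, [0, 2648, -2648, 0, 797, 735, -1035]),
   (986430, [0, -640, 640, 0, -681, 0, 156]),
   (12299, [0, 12576, -12576, 0, 9689, 0, 0]),
   (49784814625, [0, 0, 0, 0, 1, 0, 0])]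

lemma flagType_lt (b₀ b₁ b₂ b₃ b₄ b₅ : Bool) : flagType b₀ b₁ b₂ b₃ b₄ b₅ < 8 := by
  revert b₀ b₁ b₂ b₃ b₄ b₅
  decide +kernel

lemma flagWeight_comm {i j : ℕ} (hi : i < 8) (hj : j < 8) : flagWeight i j = flagWeight j i := by
  have h : ∀ i < 8, ∀ j < 8, flagWeight i j = flagWeight j i := by decide +kernel
  exact h i hi j hj

lemma flagWeight_mem_Icc {i j : ℕ} (hi : i < 8) (hj : j < 8) :
    -320 ≤ flagWeight i j ∧ flagWeight i j ≤ 1176 := by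
  have h : ∀ i < 8, ∀ j < 8, -320 ≤ flagWeight i j ∧ flagWeight i j ≤ 1176 := by decide +kernel
  exact h i hi j hj

lemma flagWeight_eq_sum_flagSquares {i j : ℕ} (hi : i < 8) (hj : j < 8) :
    15080541840 * flagWeight i j =
      (flagSquares.map fun q ↦ q.1 * (q.2.getD i 0 * q.2.getD j 0)).sum := by
  have h : ∀ i < 8, ∀ j < 8, 15080541840 * flagWeight i j =
      (flagSquares.map fun q ↦ q.1 * (q.2.getD i 0 * q.2.getD j 0)).sum := by decide +kernel
  exact h i hi j hj

lemma sum_sum_squares_nonneg {ι : Type*} [Fintype ι] (f : ι → ℕ) {l : List (ℤ × List ℤ)}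
    (hl : ∀ q ∈ l, 0 ≤ q.1) :
    0 ≤ ∑ s, ∑ t, (l.map fun q ↦ q.1 * (q.2.getD (f s) 0 * q.2.getD (f t) 0)).sum := by
  induction l with
  | nil => simp
  | cons q l ih =>
    simp only [List.map_cons, List.sum_cons, sum_add_distrib]
    refine add_nonneg ?_ (ih fun q hq ↦ hl q (List.mem_cons_of_mem _ hq))
    simp_rw [← mul_sum, ← sum_mul]
    exact mul_nonneg (hl q List.mem_cons_self) (mul_self_nonneg _)

lemma sum_sum_flagWeight_nonneg {ι : Type*} [Fintype ι] (f : ι → ℕ) (hf : ∀ s, f s < 8) :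
    0 ≤ ∑ s, ∑ t, flagWeight (f s) (f t) := by
  have h := sum_sum_squares_nonneg f (l := flagSquares) (by decide +kernel)
  simp_rw [← flagWeight_eq_sum_flagSquares (hf _) (hf _), ← mul_sum] at h
  linarith

/-- The flag with root `v` on the vertices `v`, `T 0`, `T 1`, `T 2`. -/
def flagOf {α : Type*} (A : α → α → Bool) (v : α) (T : Fin 3 → α) : ℕ :=
  flagType (A v (T 0)) (A v (T 1)) (A (T 0) (T 1)) (A v (T 2)) (A (T 0) (T 2)) (A (T 1) (T 2))

/-- The weight of the two flags with common root `φ 0` on the other vertices of `φ`. -/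
def splitWeight {α : Type*} (A : α → α → Bool) (φ : Fin 7 → α) : ℤ :=
  flagWeight (flagOf A (φ 0) ![φ 1, φ 2, φ 3]) (flagOf A (φ 0) ![φ 4, φ 5, φ 6])

lemma flagOf_lt {α : Type*} (A : α → α → Bool) (v : α) (T : Fin 3 → α) : flagOf A v T < 8 :=
  flagType_lt _ _ _ _ _ _

lemma flagOf_comp_perm {α : Type*} {A : α → α → Bool} (hA : ∀ x y, A x y = A y x) (v : α)
    (T : Fin 3 → α) (s : Equiv.Perm (Fin 3)) : flagOf A v (T ∘ s) = flagOf A v T := by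
  simp only [flagOf, Function.comp_apply]
  have h (i j : Fin 3) : A (T i) (T j) = if i = j then A (T i) (T i) else
      (![![A (T 0) (T 1), A (T 0) (T 1), A (T 0) (T 2)],
         ![A (T 0) (T 1), A (T 0) (T 1), A (T 1) (T 2)],
         ![A (T 0) (T 2), A (T 1) (T 2), A (T 0) (T 1)]] : Fin 3 → Fin 3 → Bool) i j := by
    fin_cases i <;> fin_cases j <;> simp [hA (T 1) (T 0), hA (T 2) (T 0), hA (T 2) (T 1)]
  have hv (i : Fin 3) : A v (T i) = (![A v (T 0), A v (T 1), A v (T 2)] : Fin 3 → Bool) i := by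
    fin_cases i <;> rfl
  rw [h (s 0) (s 1), h (s 0) (s 2), h (s 1) (s 2), if_neg (by simp), if_neg (by simp),
    if_neg (by simp), hv (s 0), hv (s 1), hv (s 2)]
  generalize A v (T 0) = b₀
  generalize A v (T 1) = b₁
  generalize A v (T 2) = b₃
  generalize A (T 0) (T 1) = b₂
  generalize A (T 0) (T 2) = b₄
  generalize A (T 1) (T 2) = b₅
  revert s b₀ b₁ b₂ b₃ b₄ b₅
  decide +kernel

/-- A map from `Fin 7` as a root and two triples. -/
def rootedTriplesEquiv (α : Type*) : (Fin 7 → α) ≃ α × (Fin 3 → α) × (Fin 3 → α) where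
  toFun φ := (φ 0, ![φ 1, φ 2, φ 3], ![φ 4, φ 5, φ 6])
  invFun p := ![p.1, p.2.1 0, p.2.1 1, p.2.1 2, p.2.2 0, p.2.2 1, p.2.2 2]
  left_inv φ := by
    funext i
    fin_cases i <;> rfl
  right_inv p := by
    obtain ⟨v, T, T'⟩ := p
    refine Prod.ext rfl (Prod.ext (funext fun i ↦ ?_) (funext fun i ↦ ?_)) <;>
      fin_cases i <;> rfl

lemma sum_splitWeight_nonneg {α : Type*} [Fintype α] (A : α → α → Bool) :
    0 ≤ ∑ φ : Fin 7 → α, splitWeight A φ := by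
  classical
  have h : ∑ φ : Fin 7 → α, splitWeight A φ = ∑ p : α × (Fin 3 → α) × (Fin 3 → α),
      flagWeight (flagOf A p.1 p.2.1) (flagOf A p.1 p.2.2) :=
    (rootedTriplesEquiv α).sum_comp fun p ↦ flagWeight (flagOf A p.1 p.2.1) (flagOf A p.1 p.2.2)
  rw [h, Fintype.sum_prod_type]
  refine sum_nonneg fun v _ ↦ ?_
  rw [Fintype.sum_prod_type]
  exact sum_sum_flagWeight_nonneg (flagOf A v) (flagOf_lt A v)

/-- Representatives of the isomorphism classes of graphs on two vertices. -/
def reps2 : List ℕ :=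
  [0, 1]

/-- The isomorphisms of the one-vertex extensions to the graphs in `reps2`. -/
def certs2 : List (ℕ × ℕ) :=
  [(0,8), (1,8)]

/-- Representatives of the isomorphism classes of graphs on three vertices. -/
def reps3 : List ℕ :=
  [0, 4, 6, 7]

/-- The isomorphisms of the one-vertex extensions to the graphs in `reps3`. -/
def certs3 : List (ℕ × ℕ) :=
  [(0,136), (4,129), (4,136), (6,136), (4,17), (6,66), (6,80), (7,136)]

/-- Representatives of the isomorphism classes of graphs on four vertices. -/
def reps4 : List ℕ :=
  [0, 32, 33, 48, 50, 51, 52, 56, 60, 62, 63]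

/-- The isomorphisms of the one-vertex extensions to the graphs in `reps4`. -/
def certs4 : List (ℕ × ℕ) :=
  [(0,1672), (32,1602), (32,1616), (48,1553), (32,1672), (48,1665), (48,1672), (56,1672),
  (32,720), (33,720), (48,1112), (50,1112), (48,1224), (50,1224), (52,1672), (60,1672), (48,209),
  (50,202), (50,664), (51,1112), (56,1224), (60,1217), (60,1224), (62,1672), (52,209), (60,139),
  (60,153), (62,538), (60,209), (62,706), (62,720), (63,1672)]

/-- Representatives of the isomorphism classes of graphs on five vertices. -/
def reps5 : List ℕ :=
  [0, 512, 516, 768, 769, 784, 786, 787, 788, 800, 801, 896, 904, 906, 907, 928, 929, 936, 937,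
  944, 946, 947, 948, 960, 992, 993, 1008, 1010, 1011, 1012, 1016, 1020, 1022, 1023]

/-- The isomorphisms of the one-vertex extensions to the graphs in `reps5`. -/
def certs5 : List (ℕ × ℕ) :=
  [(0,18056), (512,17475), (512,17496), (768,16922), (512,17608), (768,17090), (768,17104),
  (896,16593), (512,18056), (768,17986), (768,18000), (896,17937), (768,18056), (896,18049),
  (896,18056), (960,18056), (512,10440), (516,10433), (516,10440), (769,16922), (768,13576),
  (784,13569), (784,13576), (904,16593), (768,14472), (784,14465), (784,14472), (904,17937),
  (800,18056), (928,18049), (928,18056), (992,18056), (516,2257), (769,12820), (769,12834),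
  (801,16922), (769,13576), (786,17090), (786,17104), (929,16474), (769,14472), (786,17986),
  (786,18000), (929,16922), (801,18056), (929,18049), (929,18056), (993,18056), (768,6352),
  (769,6352), (784,6296), (786,9824), (784,9992), (786,9992), (788,13576), (906,16593),
  (896,14472), (904,14472), (928,14416), (936,14416), (928,14472), (936,14472), (944,18056),
  (1008,18056), (784,2257), (786,1802), (786,6296), (787,6296), (904,9985), (929,13058),
  (906,13569), (937,13058), (904,10440), (906,14472), (929,14416), (937,14416), (936,10440),
  (946,17601), (946,18056), (1010,18056), (788,2257), (906,4308), (906,5666), (937,8739),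
  (906,5890), (937,8963), (907,13569), (947,16523), (906,6352), (907,14472), (937,10328),
  (947,17433), (937,10440), (947,17601), (947,18056), (1011,18056), (800,6352), (801,6352),
  (928,5792), (929,5792), (928,5904), (929,5904), (944,8984), (946,8984), (928,6352), (929,6352),
  (944,10328), (946,10328), (944,10440), (946,10440), (948,18056), (1012,18056), (896,2257),
  (904,2187), (904,2201), (906,2138), (904,2257), (906,2250), (906,2257), (907,16593),
  (960,14472), (992,14402), (992,14416), (1008,14353), (992,14472), (1008,14465), (1008,14472),
  (1016,18056), (928,2257), (929,2257), (936,5792), (937,5792), (936,5904), (937,5904),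
  (946,5400), (947,8984), (992,6352), (993,6352), (1008,10328), (1010,10328), (1008,10440),
  (1010,10440), (1012,14472), (1020,18056), (944,2257), (946,2250), (946,2257), (947,2257),
  (1008,1809), (1010,1802), (1010,5400), (1011,8984), (1008,2257), (1010,2250), (1010,6296),
  (1011,10328), (1016,10440), (1020,10433), (1020,10440), (1022,18056), (948,2257), (1012,1676),
  (1012,1697), (1020,1123), (1012,1809), (1020,1291), (1020,1305), (1022,4378), (1012,2257),
  (1020,2187), (1020,2201), (1022,6170), (1020,2257), (1022,6338), (1022,6352), (1023,18056)]

/-- Representatives of the isomorphism classes of graphs on six vertices. -/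
def reps6 : List ℕ :=
  [0, 16384, 24576, 25088, 28672, 16416, 24832, 29184, 24864, 29440, 29472, 30720, 24580, 28800,
  31232, 24848, 29312, 28816, 31488, 25092, 29188, 29456, 31520, 28820, 31616, 31236, 24852,
  29316, 31504, 29460, 31648, 31508, 31664, 31668, 31744, 28673, 30784, 32256, 24582, 28864,
  28801, 31296, 30792, 32512, 25094, 29190, 31304, 32544, 28817, 31552, 16417, 24833, 28808,
  29320, 29185, 31234, 24850, 28880, 29314, 31496, 29458, 31584, 30794, 32640, 32260, 28809,
  31298, 32528, 29189, 31300, 29318, 31568, 31306, 32672, 24865, 28818, 28888, 29441, 31489,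
  31624, 29324, 31498, 29457, 31506, 31656, 32532, 29461, 31572, 32688, 29473, 31521, 31649,
  31666, 32692, 30795, 32704, 31235, 32513, 28819, 31553, 31299, 32648, 31307, 32736, 24851,
  29315, 31302, 31576, 28882, 31497, 32530, 29326, 31569, 32680, 28892, 31626, 31499, 32650,
  31573, 32752, 25095, 29191, 31308, 29319, 31570, 31658, 32545, 29459, 31310, 31585, 32673,
  31507, 31580, 31657, 32690, 31667, 32756, 28894, 31627, 32651, 32760, 31311, 32737, 32531,
  29327, 31571, 32681, 31582, 32754, 31659, 32691, 32764, 31583, 32755, 32766, 32767]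

/-- The isomorphisms of the one-vertex extensions to the graphs in `reps6`. -/
def certs6 : List (ℕ × ℕ) :=
  [(0,181896), (16384,177220), (16384,177248), (24576,172579), (16384,177416), (24576,172803),
  (24576,172824), (28672,168218), (16384,178312), (24576,174147), (24576,174168), (28672,170010),
  (24576,174280), (28672,170178), (28672,170192), (30720,166097), (16384,181896), (24576,181315),
  (24576,181336), (28672,180762), (24576,181448), (28672,180930), (28672,180944), (30720,180433),
  (24576,181896), (28672,181826), (28672,181840), (30720,181777), (28672,181896), (30720,181889),
  (30720,181896), (31744,181896), (16384,120968), (16416,120898), (16416,120912), (24580,172579),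
  (16416,120968), (24580,172803), (24580,172824), (28673,168218), (24576,146056), (24832,145986),
  (24832,146000), (28800,170010), (24832,146056), (28800,170178), (28800,170192), (30784,166097),
  (24576,153224), (24832,153154), (24832,153168), (28800,180762), (24832,153224), (28800,180930),
  (28800,180944), (30784,180433), (25088,181896), (29184,181826), (29184,181840), (31232,181777),
  (29184,181896), (31232,181889), (31232,181896), (32256,181896), (16416,55504), (16417,55504),
  (24580,140008), (24833,135402), (24580,140120), (24833,135514), (25092,172824), (29185,168218),
  (24580,146056), (24833,145986), (24848,174168), (28808,170010), (24848,174280), (28808,170178),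
  (29188,169240), (31234,165145), (24580,153224), (24833,153154), (24848,181336), (28808,180762),
  (24848,181448), (28808,180930), (29188,172824), (31234,172313), (25092,181896), (29185,181826),
  (29188,181840), (31234,181777), (29188,181896), (31234,181889), (31236,181896), (32260,181896),
  (24576,88264), (24580,88257), (24580,88264), (24582,88264), (24832,87816), (24848,116033),
  (24848,116040), (28801,168218), (24832,117384), (24848,117377), (24848,117384), (28801,170010),
  (24864,146056), (28816,170178), (28816,170192), (30792,166097), (28672,153224), (28800,153217),
  (28800,153224), (28864,153224), (29184,152776), (29312,152769), (29312,152776), (31296,180433),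
  (29184,153224), (29312,153217), (29312,153224), (31296,181777), (29440,181896), (31488,181889),
  (31488,181896), (32512,181896), (24580,22737), (24582,55490), (24582,55504), (25094,172579),
  (24833,87816), (24850,144194), (24850,144208), (29189,168099), (24833,117384), (24850,145986),
  (24850,146000), (29189,168995), (24865,146056), (28818,170178), (28818,170192), (31235,164963),
  (28673,153224), (28801,153217), (28801,153224), (29190,172579), (29185,152776), (29314,180930),
  (29314,180944), (31300,180433), (29185,153224), (29314,181826), (29314,181840), (31300,181777),
  (29441,181896), (31489,181889), (31489,181896), (32513,181896), (24832,55504), (24833,55504),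
  (24848,51864), (24850,80480), (24848,87816), (24850,87816), (24852,87816), (28809,168218),
  (28800,117328), (28808,117328), (29188,141912), (29314,141849), (28816,146000), (28880,146000),
  (29316,141912), (31298,166041), (28800,120968), (28808,120968), (28816,153224), (28880,153224),
  (29188,152776), (29314,152769), (29316,152776), (31298,180433), (29312,120968), (29320,120968),
  (29456,178256), (31496,178193), (29456,181896), (31496,181889), (31504,181896), (32528,181896),
  (24848,22737), (24850,22282), (24850,51864), (24851,51864), (28801,115522), (29189,140099),
  (28809,115522), (29315,139595), (28801,117328), (28809,117328), (29189,141912), (29315,141849),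
  (28817,146000), (29318,169219), (29318,170136), (31302,166041), (28808,88264), (28818,152769),
  (28818,153224), (28882,153224), (29314,120065), (29457,176898), (29324,152776), (31497,176394),
  (29314,120968), (29324,153217), (29457,178256), (31497,178193), (29458,181896), (31506,181441),
  (31506,181896), (32530,181896), (24852,22737), (28809,69917), (28809,71723), (29315,99436),
  (28809,82755), (29315,106828), (28819,139595), (29459,168148), (28809,84568), (28819,141849),
  (29315,109089), (29459,169506), (28819,146000), (29326,169219), (29326,170136), (31507,164963),
  (28809,88264), (28819,152769), (28819,153224), (29326,172579), (29315,120065), (29459,176898),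
  (29326,180944), (31507,172299), (29315,120968), (29326,181826), (29459,178256), (31507,174105),
  (29459,181896), (31507,181441), (31507,181896), (32531,181896), (24864,55504), (24865,55504),
  (28816,71912), (28818,71912), (28816,82776), (28818,82776), (29316,107360), (29324,107360),
  (28816,84568), (28818,84568), (29316,109152), (29324,109152), (28820,146000), (28888,170178),
  (29460,169632), (31498,165537), (28816,88264), (28818,88264), (28820,153224), (28888,180762),
  (29316,120072), (29324,120072), (29460,176912), (31498,176401), (29316,120968), (29324,120968),
  (29460,178256), (31498,178193), (29460,181896), (31498,181889), (31508,181896), (32532,181896),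
  (25088,88264), (25092,88257), (25092,88264), (25094,88264), (29184,83784), (29188,83777),
  (29188,83784), (29190,83784), (29184,84680), (29188,84673), (29188,84680), (29190,84680),
  (29440,109320), (29456,109313), (29456,109320), (31304,166097), (29184,88264), (29188,88257),
  (29188,88264), (29190,88264), (29440,120072), (29456,120065), (29456,120072), (31304,180433),
  (29440,120968), (29456,120961), (29456,120968), (31304,181777), (29472,181896), (31520,181889),
  (31520,181896), (32544,181896), (25092,22737), (25094,55490), (25094,55504), (25095,88264),
  (29185,83784), (29189,83777), (29189,83784), (29191,83784), (29185,84680), (29189,84673),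
  (29189,84680), (29191,84680), (29441,109320), (29457,109313), (29457,109320), (31308,166097),
  (29185,88264), (29189,88257), (29189,88264), (29191,88264), (29441,120072), (29457,120065),
  (29457,120072), (31308,180433), (29441,120968), (29457,120961), (29457,120968), (31308,181777),
  (29473,181896), (31521,181889), (31521,181896), (32545,181896), (28672,55504), (28673,55504),
  (28800,54944), (28801,54944), (28800,55056), (28801,55056), (28816,54552), (28817,54552),
  (28800,55504), (28801,55504), (28816,55448), (28817,55448), (28816,55504), (28817,55504),
  (28820,170192), (30794,166097), (30720,153224), (30784,153224), (31232,152664), (31296,152664),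
  (31232,152776), (31296,152776), (31488,152272), (31552,152272), (31232,153224), (31296,153224),
  (31488,153168), (31552,153168), (31488,153224), (31552,153224), (31616,181896), (32640,181896),
  (28800,22737), (28801,22737), (28808,54944), (28809,54944), (28808,55056), (28809,55056),
  (28818,54552), (28819,54552), (28864,55504), (29190,141891), (28880,55448), (29318,141835),
  (28880,55504), (29318,141891), (28888,145986), (31299,166027), (30784,120968), (30792,153224),
  (31234,152664), (31298,152664), (31234,152776), (31298,152776), (31489,152272), (31553,152272),
  (31296,120968), (31304,153224), (31496,153168), (31568,181777), (31496,153224), (31568,181889),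
  (31624,181896), (32648,181896), (28816,22737), (28817,22737), (28818,22737), (28819,22737),
  (28880,22289), (29318,107332), (28882,54552), (29326,139595), (28880,22737), (29318,109124),
  (28882,55448), (29326,141835), (28888,55504), (29461,169604), (28892,170192), (31499,165516),
  (30792,88264), (30794,153224), (31235,152664), (31299,152664), (31298,120072), (31306,152776),
  (31497,152272), (31569,180433), (31298,120968), (31306,153224), (31497,153168), (31569,181777),
  (31498,153224), (31572,181889), (31626,181896), (32650,181896), (28820,22737), (30794,35029),
  (28888,82475), (31299,99429), (28888,82755), (31299,99597), (28892,21785), (31499,131797),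
  (28888,84547), (31299,100493), (28892,22681), (31499,132693), (28892,22737), (31499,132749),
  (28894,170192), (31627,165516), (30794,55504), (30795,153224), (31299,119904), (31307,152664),
  (31299,120072), (31307,152776), (31499,152272), (31573,180433), (31299,120968), (31307,153224),
  (31499,153168), (31573,181777), (31499,153224), (31573,181889), (31627,181896), (32651,181896),
  (29184,55504), (29185,55504), (29188,55504), (29189,55504), (29312,83784), (29314,83784),
  (29316,83784), (29318,83784), (29312,84680), (29314,84680), (29316,84680), (29318,84680),
  (29456,80648), (29458,80648), (29460,109320), (31306,166097), (31232,88264), (31234,88264),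
  (31236,88264), (31300,152664), (31488,120072), (31496,120072), (31504,120072), (31568,152272),
  (31488,120968), (31496,120968), (31504,120968), (31568,153168), (31520,153224), (31584,153224),
  (31648,181896), (32672,181896), (29188,22737), (29189,22737), (29190,55504), (29191,55504),
  (29314,55056), (29315,83784), (29318,55056), (29319,83784), (29314,55504), (29315,84680),
  (29318,55504), (29319,84680), (29457,80648), (29459,80648), (29461,109320), (31310,166097),
  (31234,55504), (31235,88264), (31300,119904), (31308,152664), (31489,120072), (31497,120072),
  (31506,152272), (31570,152272), (31489,120968), (31497,120968), (31506,153168), (31570,153168),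
  (31521,153224), (31585,153224), (31649,181896), (32673,181896), (29312,22737), (29314,19146),
  (29314,22737), (29315,22737), (29320,83784), (29324,80193), (29324,83784), (29326,83784),
  (31296,84673), (31300,84673), (31298,84673), (31302,84673), (31496,80641), (31506,109313),
  (31498,109313), (31569,137922), (31296,88264), (31298,88264), (31300,88264), (31302,88264),
  (31496,87816), (31498,120072), (31506,120072), (31569,152272), (31552,120968), (31568,117377),
  (31568,120968), (31576,120968), (31584,120968), (31656,178305), (31656,181896), (32680,181896),
  (29316,22737), (29318,19146), (29318,22737), (29319,22737), (29324,22737), (29326,47874),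
  (29326,55056), (29327,83784), (31298,51906), (31302,51906), (31299,84673), (31310,141891),
  (31497,80641), (31507,109313), (31499,109313), (31571,137922), (31298,55504), (31299,88264),
  (31302,55504), (31310,152664), (31497,87816), (31499,120072), (31507,120072), (31571,152272),
  (31553,120968), (31569,117377), (31569,120968), (31580,181777), (31585,120968), (31657,178305),
  (31657,181896), (32681,181896), (29440,55504), (29441,55504), (29456,55448), (29457,55448),
  (29456,55504), (29457,55504), (29460,55504), (29461,55504), (31488,51920), (31489,51920),
  (31504,51864), (31506,80480), (31504,80648), (31506,80648), (31508,109320), (31572,137936),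
  (31488,55504), (31489,55504), (31504,55448), (31506,87648), (31504,87816), (31506,87816),
  (31508,120072), (31572,152272), (31616,120968), (31624,120968), (31648,120912), (31656,120912),
  (31648,120968), (31656,120968), (31664,181896), (32688,181896), (29456,22737), (29457,22737),
  (29458,55448), (29459,55448), (31304,83777), (31308,83777), (31306,83777), (31310,83777),
  (31496,51920), (31497,51920), (31506,51864), (31507,51864), (31568,80648), (31570,80648),
  (31572,109320), (31580,109320), (31496,55504), (31497,55504), (31506,55448), (31507,55448),
  (31568,87816), (31570,87816), (31572,120072), (31580,120072), (31624,88264), (31626,120968),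
  (31649,120912), (31657,120912), (31656,88264), (31658,120968), (31666,181896), (32690,181896),
  (29460,22737), (29461,22737), (31306,50730), (31310,50730), (31306,51010), (31310,51010),
  (31307,83777), (31311,83777), (31498,51920), (31499,51920), (31569,80480), (31571,80480),
  (31569,80648), (31571,80648), (31573,109320), (31582,137936), (31498,55504), (31499,55504),
  (31569,87648), (31571,87648), (31569,87816), (31571,87816), (31573,120072), (31582,152272),
  (31626,55504), (31627,120968), (31657,88152), (31659,120912), (31657,88264), (31659,120968),
  (31667,181896), (32691,181896), (29472,55504), (29473,55504), (31520,50856), (31521,50856),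
  (31520,51024), (31521,51024), (31648,46432), (31649,46432), (31520,51920), (31521,51920),
  (31648,47776), (31649,47776), (31648,47888), (31649,47888), (31664,72472), (31666,72472),
  (31520,55504), (31521,55504), (31648,54944), (31649,54944), (31648,55056), (31649,55056),
  (31664,86808), (31666,86808), (31648,55504), (31649,55504), (31664,88152), (31666,88152),
  (31664,88264), (31666,88264), (31668,181896), (32692,181896), (30720,22737), (30784,22156),
  (30784,22177), (30792,21603), (30784,22289), (30792,21771), (30792,21785), (30794,21274),
  (30784,22737), (30792,22667), (30792,22681), (30794,22618), (30792,22737), (30794,22730),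
  (30794,22737), (30795,166097), (31744,153224), (32256,152643), (32256,152664), (32512,152090),
  (32256,152776), (32512,152258), (32512,152272), (32640,151761), (32256,153224), (32512,153154),
  (32512,153168), (32640,153105), (32512,153224), (32640,153217), (32640,153224), (32704,181896),
  (31232,22737), (31234,22730), (31234,22737), (31235,22737), (31296,22289), (31298,22282),
  (31298,22289), (31299,22289), (31296,22737), (31298,22730), (31298,22737), (31299,22737),
  (31304,22737), (31306,22730), (31306,22737), (31307,166097), (32256,88264), (32260,88257),
  (32260,88264), (32513,152090), (32512,120072), (32528,120065), (32528,120072), (32648,151761),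
  (32512,120968), (32528,120961), (32528,120968), (32648,153105), (32544,153224), (32672,153217),
  (32672,153224), (32736,181896), (31236,22737), (31300,21596), (31300,21603), (31308,21603),
  (31300,22289), (31302,22282), (31302,22289), (31310,21155), (31300,22737), (31302,22730),
  (31302,22737), (31310,21603), (31308,22737), (31310,22730), (31310,22737), (31311,166097),
  (32260,22737), (32513,119316), (32513,119330), (32545,152090), (32513,120072), (32530,152258),
  (32530,152272), (32673,151642), (32513,120968), (32530,153154), (32530,153168), (32673,152090),
  (32545,153224), (32673,153217), (32673,153224), (32737,181896), (31488,22737), (31489,22737),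
  (31496,22681), (31497,22681), (31496,22737), (31497,22737), (31498,22737), (31499,22737),
  (31552,51920), (31553,51920), (31568,51864), (31569,51864), (31568,51920), (31569,51920),
  (31572,51920), (31573,137936), (32512,55504), (32513,55504), (32528,55448), (32530,87648),
  (32528,87816), (32530,87816), (32532,120072), (32650,151761), (32640,120968), (32648,120968),
  (32672,120912), (32680,120912), (32672,120968), (32680,120968), (32688,153224), (32752,181896),
  (31504,22737), (31506,22282), (31506,22737), (31507,22737), (31568,22282), (31570,22282),
  (31569,22282), (31571,22282), (31568,22737), (31569,22737), (31570,51864), (31571,51864),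
  (31576,80648), (31580,80193), (31580,80648), (31582,109320), (32528,22737), (32530,22282),
  (32530,55448), (32531,55448), (32648,87809), (32673,119554), (32650,120065), (32681,119554),
  (32648,88264), (32650,120968), (32673,120912), (32681,120912), (32680,88264), (32690,152769),
  (32690,153224), (32754,181896), (31508,22737), (31572,21204), (31572,22114), (31580,21603),
  (31572,22282), (31580,21771), (31573,22282), (31582,21204), (31572,22737), (31573,22737),
  (31580,22681), (31582,22114), (31580,22737), (31582,51010), (31582,51920), (31583,109320),
  (32532,22737), (32650,53460), (32650,54818), (32681,86563), (32650,55042), (32681,86787),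
  (32651,120065), (32691,151691), (32650,55504), (32651,120968), (32681,88152), (32691,152601),
  (32681,88264), (32691,152769), (32691,153224), (32755,181896), (31520,22737), (31521,22737),
  (31584,50856), (31585,50856), (31584,51024), (31585,51024), (31656,46432), (31657,46432),
  (31584,51920), (31585,51920), (31656,47776), (31657,47776), (31656,47888), (31657,47888),
  (31666,43800), (31667,72472), (32544,55504), (32545,55504), (32672,54944), (32673,54944),
  (32672,55056), (32673,55056), (32688,86808), (32690,86808), (32672,55504), (32673,55504),
  (32688,88152), (32690,88152), (32688,88264), (32690,88264), (32692,153224), (32756,181896),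
  (31616,22737), (31624,22667), (31624,22681), (31626,22618), (31624,22737), (31626,22730),
  (31626,22737), (31627,22737), (32640,19153), (32648,19083), (32648,19097), (32650,19034),
  (32648,19153), (32650,19146), (32650,19153), (32651,133841), (32640,22737), (32648,22667),
  (32648,22681), (32650,22618), (32648,22737), (32650,22730), (32650,22737), (32651,151761),
  (32704,120968), (32736,120898), (32736,120912), (32752,120849), (32736,120968), (32752,120961),
  (32752,120968), (32760,181896), (31648,22737), (31649,22737), (31656,22681), (31657,22681),
  (31656,22737), (31657,22737), (31658,46432), (31659,46432), (32672,19153), (32673,19153),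
  (32680,47776), (32681,47776), (32680,47888), (32681,47888), (32690,43800), (32691,72472),
  (32672,22737), (32673,22737), (32680,54944), (32681,54944), (32680,55056), (32681,55056),
  (32690,54552), (32691,86808), (32736,55504), (32737,55504), (32752,88152), (32754,88152),
  (32752,88264), (32754,88264), (32756,120968), (32764,181896), (31664,22737), (31666,22730),
  (31666,22737), (31667,22737), (32688,18257), (32690,18250), (32690,18257), (32691,18257),
  (32688,19153), (32690,19146), (32690,19153), (32691,19153), (32752,15121), (32754,15114),
  (32754,43800), (32755,72472), (32688,22737), (32690,22730), (32690,22737), (32691,22737),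
  (32752,22289), (32754,22282), (32754,54552), (32755,86808), (32752,22737), (32754,22730),
  (32754,55448), (32755,88152), (32760,88264), (32764,88257), (32764,88264), (32766,181896),
  (31668,22737), (32692,18061), (32692,18089), (32756,13420), (32692,18257), (32756,13644),
  (32756,13665), (32764,9059), (32692,19153), (32756,14988), (32756,15009), (32764,10851),
  (32756,15121), (32764,11019), (32764,11033), (32766,35610), (32692,22737), (32756,22156),
  (32756,22177), (32764,21603), (32756,22289), (32764,21771), (32764,21785), (32766,53530),
  (32756,22737), (32764,22667), (32764,22681), (32766,55322), (32764,22737), (32766,55490),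
  (32766,55504), (32767,181896)]

/-- Fractional triangle packings of graphs on seven vertices. -/
def packs : List (ℕ × ℕ × List ℕ) :=
  [(0, 0, []), (25088, 6, [824]), (30992, 12, [810, 820]), (29472, 12, [412, 428, 436, 440]),
  (31664, 18, [410, 426, 434, 412, 428, 436]), (1208832, 12, [868, 824]), (1589248, 6, [880]),
  (1923840, 18, [866, 820, 856]), (320008, 12, [841, 824]), (31576, 18, [793, 810, 820]),
  (1203104, 18, [818, 796, 868]), (807680, 12, [820, 856]), (31236, 12, [806, 824]), (1146608, 24,
  [817, 794, 866, 812]), (817824, 18, [818, 812, 856]), (327696, 6, [842]), (686064, 24, [817,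
  794, 812, 852]), (27784, 12, [809, 818]), (31583, 24, [775, 793, 810, 820]), (622497, 24, [803,
  850, 412, 428, 436, 440]), (817936, 18, [810, 820, 856]), (123393, 12, [835, 824]), (1307137,
  18, [835, 868, 824]), (163842, 6, [837]), (32756, 21, [817, 406, 422, 410, 426, 412]), (1343394,
  24, [805, 818, 796, 872]), (1114108, 30, [793, 865, 398, 406, 426, 434, 428, 436]), (1503752,
  18, [841, 868, 824]), (32545, 18, [803, 412, 428, 436, 440]), (1768864, 24, [865, 818, 812,
  852]), (1146370, 18, [805, 866, 824]), (294920, 6, [841]), (1876032, 12, [849, 872]), (615040,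
  12, [850, 824]), (588356, 18, [849, 806, 824]), (1605619, 30, [787, 805, 810, 796, 880]),
  (981778, 24, [837, 810, 820, 856]), (1301409, 24, [835, 818, 796, 868]), (683400, 18, [809, 818,
  852]), (1014548, 24, [806, 842, 852, 824]), (1183744, 6, [868]), (28158, 24, [781, 817, 790,
  810]), (127777, 18, [835, 412, 428, 436, 440]), (409598, 30, [789, 809, 806, 794, 844]),
  (194834, 18, [837, 810, 820]), (325368, 24, [841, 817, 794, 812]), (1802224, 30, [817, 794, 866,
  812, 852]), (318602, 18, [805, 841, 818]), (618480, 24, [817, 810, 850, 796]), (1511440, 12,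
  [842, 868]), (1141248, 12, [866, 824]), (1276420, 18, [422, 454, 482, 484, 824]), (16371, 24,
  [787, 805, 810, 796]), (1801986, 24, [805, 866, 852, 824]), (1212328, 24, [809, 818, 796, 868]),
  (815102, 30, [781, 817, 790, 810, 856]), (679934, 30, [781, 817, 806, 794, 852]), (1900192, 24,
  [865, 818, 812, 856]), (524083, 30, [803, 837, 842, 412, 428, 436, 440]), (1440552, 24, [841,
  866, 412, 428, 436, 440]), (320015, 18, [775, 841, 824]), (326478, 24, [789, 841, 806, 824]),
  (753732, 12, [849, 838]), (1698368, 18, [849, 866, 824]), (1530800, 24, [794, 866, 844, 820]),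
  (129969, 21, [835, 410, 426, 434, 412, 428]), (915082, 24, [805, 841, 850, 824]), (1759822, 24,
  [837, 793, 806, 880]), (774530, 18, [837, 850, 820]), (1478664, 12, [841, 868]), (557120, 6,
  [849]), (582208, 12, [849, 824]), (1407839, 30, [775, 793, 426, 458, 482, 820, 488]), (946976,
  18, [428, 460, 436, 468, 440, 472]), (1208839, 18, [775, 868, 824]), (1506563, 24, [803, 837,
  820, 872]), (126463, 30, [835, 781, 817, 790, 810]), (1998846, 36, [781, 817, 790, 810, 868,
  856]), (1605426, 24, [805, 810, 796, 880]), (1753090, 12, [837, 880]), (980984, 30, [809, 849,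
  794, 844, 820]), (2093704, 24, [841, 850, 868, 824]), (1339361, 24, [403, 419, 433, 434, 796,
  872]), (1407248, 18, [426, 458, 482, 820, 488]), (1671154, 30, [405, 421, 433, 410, 426, 466,
  482, 412, 428, 496]), (810753, 18, [803, 820, 856]), (1211902, 30, [781, 817, 790, 810, 868]),
  (1993130, 24, [781, 818, 852, 872]), (228188, 24, [793, 838, 810, 820]), (1212272, 24, [817,
  810, 796, 868]), (884816, 12, [849, 842]), (1765952, 18, [849, 868, 824]), (196612, 6, [838]),
  (1338272, 18, [818, 796, 872]), (686496, 18, [818, 812, 852]), (1796864, 18, [866, 852, 824]),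
  (680704, 12, [852, 824]), (719711, 30, [779, 405, 453, 465, 806, 468, 824]), (1503218, 30, [789,
  865, 410, 426, 434, 844, 440]), (2064289, 27, [803, 850, 412, 460, 436, 484, 440]), (950260, 27,
  [817, 406, 422, 410, 426, 428, 460, 468]), (359422, 27, [397, 405, 409, 406, 422, 842, 434,
  428]), (1015806, 36, [397, 405, 425, 433, 806, 410, 458, 466, 460, 468, 440]), (1441790, 36,
  [397, 405, 409, 865, 406, 422, 842, 434, 428, 440]), (1769470, 36, [781, 433, 465, 481, 406,
  422, 410, 426, 468, 484, 440]), (1116751, 18, [775, 793, 866]), (1436175, 24, [775, 841, 866,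
  824]), (1769139, 30, [803, 837, 794, 812, 880]), (187651, 18, [803, 837, 820]), (2096777, 30,
  [803, 841, 850, 868, 824]), (772523, 24, [835, 781, 818, 852]), (1441699, 30, [835, 805, 818,
  796, 872]), (916241, 24, [835, 810, 820, 856]), (905985, 18, [835, 820, 856]), (1441290, 24,
  [805, 841, 866, 824]), (909298, 30, [805, 849, 842, 818, 796]), (2097144, 36, [793, 865, 810,
  850, 844, 820]), (1441528, 30, [793, 865, 842, 818, 812]), (28584, 18, [809, 818, 796]),
  (491532, 12, [841, 838]), (2080780, 18, [841, 838, 880]), (1436168, 18, [841, 866, 824]),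
  (1933284, 30, [817, 790, 866, 812, 856]), (2096560, 30, [865, 810, 850, 844, 820]), (686852, 18,
  [806, 852, 824]), (1785860, 12, [838, 880]), (1784752, 24, [794, 866, 812, 852]), (1014192, 24,
  [810, 850, 844, 820]), (1916944, 12, [842, 880]), (1993088, 18, [818, 852, 872]), (1116160, 6,
  [866]), (933875, 30, [787, 805, 810, 412, 460, 468, 472]), (1636080, 24, [433, 465, 481, 794,
  812, 496]), (1228594, 24, [421, 453, 481, 810, 796, 484]), (1996640, 21, [817, 412, 428, 468,
  484, 472]), (950049, 21, [803, 428, 460, 436, 468, 440]), (1539572, 27, [817, 790, 426, 458,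
  482, 428, 460]), (2029537, 30, [787, 865, 428, 460, 436, 468, 440, 472]), (228350, 27, [397,
  405, 409, 838, 410, 426, 434, 428]), (589822, 27, [781, 433, 465, 406, 422, 410, 426, 436]),
  (2097151, 42, [775, 793, 865, 810, 850, 844, 820]), (1703903, 36, [775, 793, 865, 810, 850,
  820]), (1507199, 36, [775, 793, 865, 810, 844, 820]), (621535, 30, [775, 793, 810, 850, 820]),
  (980991, 36, [775, 809, 849, 794, 844, 820]), (913407, 36, [775, 809, 849, 842, 818, 796]),
  (1540031, 36, [775, 809, 794, 866, 844, 820]), (1146783, 30, [775, 809, 794, 866, 820]),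
  (325375, 30, [775, 841, 817, 794, 812]), (1802231, 36, [775, 817, 794, 866, 812, 852]),
  (1310207, 36, [779, 789, 865, 838, 818, 812]), (1900539, 36, [779, 789, 865, 818, 812, 856]),
  (778239, 36, [779, 805, 849, 838, 818, 796]), (1343419, 30, [779, 805, 818, 796, 872]), (194047,
  30, [779, 837, 817, 790, 812]), (1933309, 36, [779, 817, 790, 866, 812, 856]), (507903, 36,
  [787, 805, 841, 838, 810, 796]), (1539811, 30, [787, 805, 866, 844, 824]), (777603, 24, [803,
  837, 850, 820]), (974595, 24, [803, 837, 820, 856]), (613761, 18, [803, 850, 820]), (1932673,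
  24, [803, 850, 820, 872]), (1342721, 18, [803, 820, 872]), (2091435, 30, [835, 781, 818, 852,
  872]), (903851, 24, [835, 781, 818, 856]), (1292627, 24, [835, 789, 810, 868]), (126889, 24,
  [835, 809, 818, 796]), (1309833, 24, [835, 809, 818, 868]), (784369, 30, [835, 817, 794, 812,
  852]), (1310577, 30, [835, 817, 810, 796, 868]), (129541, 18, [835, 806, 824]), (1282049, 12,
  [835, 868]), (1417217, 12, [835, 872]), (1687553, 12, [835, 880]), (2091358, 30, [789, 841, 838,
  810, 880]), (358898, 24, [789, 842, 818, 812]), (818146, 24, [789, 818, 812, 856]), (1998210,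
  24, [805, 818, 852, 872]), (969346, 18, [837, 818, 856]), (2087682, 24, [837, 866, 820, 856]),
  (1993724, 30, [793, 782, 818, 852, 872]), (1338108, 24, [793, 782, 818, 872]), (424824, 24,
  [793, 810, 844, 820]), (1319496, 12, [793, 872]), (900988, 30, [809, 849, 806, 842, 796]),
  (784348, 30, [809, 849, 838, 794, 820]), (521980, 30, [841, 817, 838, 794, 812]), (1498024, 24,
  [841, 818, 796, 868]), (1336384, 12, [817, 872]), (1894592, 18, [849, 818, 872]), (2087264, 24,
  [849, 866, 844, 820]), (1740864, 12, [849, 868]), (1693108, 24, [865, 782, 850, 820]), (1486260,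
  24, [865, 790, 810, 844]), (1422772, 24, [865, 790, 842, 812]), (1291956, 24, [865, 838, 794,
  812]), (1993140, 24, [782, 818, 852, 872]), (1929652, 24, [782, 850, 820, 872]), (1817889, 24,
  [419, 451, 481, 482, 812, 852]), (2029344, 21, [865, 428, 460, 436, 468, 440]), (1892936, 18,
  [409, 457, 465, 440, 488, 496]), (2094001, 27, [835, 794, 428, 460, 436, 468, 488]), (1703924,
  27, [433, 465, 481, 398, 406, 410, 482, 428, 436]), (1767412, 27, [433, 465, 481, 398, 406, 410,
  428, 468, 484]), (1898484, 27, [433, 465, 481, 398, 406, 410, 428, 436, 472]), (1284687, 21,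
  [391, 451, 453, 793, 422, 482]), (1892943, 21, [775, 409, 457, 465, 440, 488]), (1802209, 27,
  [403, 419, 433, 466, 482, 412, 428, 468, 484]), (1933281, 27, [403, 419, 433, 466, 482, 412,
  428, 436, 472]), (1048339, 30, [419, 451, 421, 453, 426, 458, 436, 468, 440, 472]), (1638386,
  27, [405, 421, 465, 481, 410, 426, 434, 412, 428]), (2097138, 33, [405, 421, 465, 481, 410, 426,
  466, 482, 844, 436]), (851964, 27, [409, 425, 465, 398, 406, 426, 434, 436, 472]), (1966076, 33,
  [409, 425, 465, 481, 398, 406, 458, 434, 482, 428, 436]), (2031612, 33, [409, 425, 465, 481,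
  398, 406, 426, 434, 460, 436, 484]), (2064371, 36, [787, 805, 426, 458, 482, 412, 460, 468, 440,
  496]), (983038, 33, [397, 421, 457, 433, 465, 406, 422, 410, 426, 460, 468]), (1507326, 33,
  [397, 405, 457, 433, 481, 406, 422, 410, 426, 460, 484]), (1540094, 33, [397, 405, 425, 433,
  406, 422, 410, 458, 482, 460, 484]), (1802238, 33, [397, 405, 425, 433, 398, 422, 410, 466, 482,
  468, 484]), (1900542, 33, [781, 433, 465, 481, 406, 422, 410, 426, 436, 472]), (1933310, 33,
  [397, 405, 425, 433, 398, 422, 410, 466, 482, 436, 472]), (2097150, 38, [525, 277, 281, 305,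
  609, 278, 550, 298, 586, 338, 332, 340, 356, 568]), (1048575, 38, [519, 291, 293, 281, 297, 329,
  593, 326, 282, 554, 338, 284, 588, 564]), (1572863, 38, [519, 275, 277, 281, 297, 329, 609, 326,
  538, 298, 354, 300, 588, 564]), (1835007, 38, [519, 267, 269, 281, 305, 337, 609, 326, 538, 306,
  354, 556, 308, 596]), (1966079, 38, [519, 267, 269, 281, 305, 337, 609, 278, 298, 330, 306, 338,
  354, 284, 300, 308, 344]), (2031615, 38, [519, 267, 269, 281, 305, 337, 609, 278, 282, 298, 306,
  300, 332, 308, 340, 356, 344]), (2064383, 38, [519, 267, 269, 281, 561, 278, 282, 298, 338, 610,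
  300, 332, 308, 340, 356, 344])]

lemma coversGraphs_one : CoversGraphs 1 [0] := fun H ↦
  ⟨0, List.mem_singleton_self 0, ⟨Equiv.refl _, fun {a b} ↦ by
    simp [Subsingleton.elim a b]⟩⟩

lemma CoversGraphs.succ {k : ℕ} {L reps : List ℕ} {codes : List (ℕ × ℕ)} (hL : CoversGraphs k L)
    (hlt : ∀ r ∈ L, r < 2 ^ (k * (k - 1) / 2))
    (h : reducesTo (k + 1) reps (extensions k L) codes = true) : CoversGraphs (k + 1) reps :=
  (coversGraphs_extensions hL hlt).of_reducesTo h

lemma coversGraphs_reps6 : CoversGraphs 6 reps6 := by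
  have h2 : CoversGraphs 2 reps2 :=
    coversGraphs_one.succ (codes := certs2) (by decide +kernel) (by decide +kernel)
  have h3 : CoversGraphs 3 reps3 :=
    h2.succ (codes := certs3) (by decide +kernel) (by decide +kernel)
  have h4 : CoversGraphs 4 reps4 :=
    h3.succ (codes := certs4) (by decide +kernel) (by decide +kernel)
  have h5 : CoversGraphs 5 reps5 :=
    h4.succ (codes := certs5) (by decide +kernel) (by decide +kernel)
  exact h5.succ (codes := certs6) (by decide +kernel) (by decide +kernel)

lemma coversGraphs_extensions_reps6 : CoversGraphs 7 (extensions 6 reps6) :=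
  coversGraphs_extensions coversGraphs_reps6 (by decide +kernel)

lemma packs_isPacking : packs.all isPacking = true := by
  decide +kernel

/-- Codes of the partitions of `Fin 7` into a root and two triples. -/
def splitCodes : List ℕ :=
  [1754760, 1751176, 1718920, 1457288, 1747144, 1714888, 1453256, 1682184, 1420552, 1158472,
  1754753, 1751169, 1718913, 1457281, 1747137, 1714881, 1453249, 1682177, 1420545, 1158465,
  1754690, 1751106, 1718850, 1457218, 1743042, 1710786, 1449154, 1678082, 1416450, 1154370,
  1754179, 1747011, 1714755, 1453123, 1742979, 1710723, 1449091, 1645315, 1383683, 1121603,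
  1750084, 1746500, 1681988, 1420356, 1742468, 1677956, 1416324, 1645252, 1383620, 859460,
  1717317, 1713733, 1681477, 1158213, 1709701, 1677445, 1154181, 1644741, 1121477, 859397,
  1455174, 1451590, 1419334, 1157702, 1447558, 1415302, 1153670, 1382598, 1120966, 858886]

/-- The map given by the octal digits of `p`. -/
def digitMap (p : ℕ) (i : Fin 7) : Fin 7 := Fin.ofNat 7 (octalDigit p i)

/-- The octal digits of `p` define an injective map on `Fin 7`. -/
def isPermCode (p : ℕ) : Bool :=
  forallBelow (fun j ↦ and (Nat.blt (octalDigit p j) 7)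
    (forallBelow (fun i ↦ not (Nat.beq (octalDigit p i) (octalDigit p j))) j)) 7

lemma digitMap_injective {p : ℕ} (hp : isPermCode p = true) : Function.Injective (digitMap p) := by
  simp only [isPermCode, forallBelow_eq_true, Bool.and_eq_true, Nat.blt_eq, Bool.not_eq_true'] at hp
  have hne (i j : Fin 7) (hij : i < j) : digitMap p i ≠ digitMap p j := by
    intro h
    have h1 := congrArg Fin.val h
    simp only [digitMap, Fin.val_ofNat, Nat.mod_eq_of_lt (hp i i.2).1,
      Nat.mod_eq_of_lt (hp j j.2).1] at h1
    have h2 := (hp j j.2).2 i hij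
    simp [h1] at h2
  intro i j h
  by_contra hij
  exact (lt_or_gt_of_ne hij).elim (fun h' ↦ hne i j h' h) fun h' ↦ hne j i h' h.symm

/-- The partitions of `Fin 7` into a root and two triples. -/
def splits : List (Fin 7 → Fin 7) := splitCodes.map digitMap

/-- The map `φ` with the two triples interchanged. -/
def swapTriples {α : Type*} (φ : Fin 7 → α) : Fin 7 → α := ![φ 0, φ 4, φ 5, φ 6, φ 1, φ 2, φ 3]

/-- The splits of `splits` with both orders of the two triples. -/
def orderedSplits : List (Fin 7 → Fin 7) := splits ++ splits.map swapTriples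

/-- An encoding of the root and the first triple of a split. -/
def splitKey (φ : Fin 7 → Fin 7) : ℕ :=
  128 * (φ 0 : ℕ) + ∑ i : Fin 3, 2 ^ ((![φ 1, φ 2, φ 3] : Fin 3 → Fin 7) i : ℕ)

lemma map_splitKey_orderedSplits : orderedSplits.map splitKey =
    (splitCodes.map fun p ↦ 128 * octalDigit p 0 +
      (2 ^ octalDigit p 1 + 2 ^ octalDigit p 2 + 2 ^ octalDigit p 3)) ++
    (splitCodes.map fun p ↦ 128 * octalDigit p 0 +
      (2 ^ octalDigit p 4 + 2 ^ octalDigit p 5 + 2 ^ octalDigit p 6)) := by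
  have h : ∀ p ∈ splitCodes, isPermCode p = true := by decide +kernel
  have hlt (p : ℕ) (hp : p ∈ splitCodes) (i : Fin 7) : (digitMap p i : ℕ) = octalDigit p i := by
    have hp' := h p hp
    simp only [isPermCode, forallBelow_eq_true, Bool.and_eq_true, Nat.blt_eq] at hp'
    exact Nat.mod_eq_of_lt (hp' i i.2).1
  rw [orderedSplits, splits, List.map_append, List.map_map, List.map_map, List.map_map]
  refine congrArg₂ _ (List.map_congr_left fun p hp ↦ ?_) (List.map_congr_left fun p hp ↦ ?_) <;>
  simp [splitKey, swapTriples, Fin.sum_univ_three, hlt p hp]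

lemma nodup_map_splitKey : (orderedSplits.map splitKey).Nodup := by
  rw [map_splitKey_orderedSplits]
  decide +kernel

lemma injective_of_mem_orderedSplits {φ : Fin 7 → Fin 7} (hφ : φ ∈ orderedSplits) :
    Function.Injective φ := by
  have h : ∀ p ∈ splitCodes, isPermCode p = true := by decide +kernel
  have hsplit : ∀ φ ∈ splits, Function.Injective φ := by
    intro φ hφ
    obtain ⟨p, hp, rfl⟩ := List.mem_map.1 hφ
    exact digitMap_injective (h p hp)
  rcases List.mem_append.1 hφ with hφ | hφ
  · exact hsplit φ hφ
  · obtain ⟨ψ, hψ, rfl⟩ := List.mem_map.1 hφ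
    have hswap : swapTriples ψ = ψ ∘ ![0, 4, 5, 6, 1, 2, 3] := by
      funext i
      fin_cases i <;> rfl
    rw [hswap]
    exact (hsplit ψ hψ).comp (by decide +kernel)

/-- The permutation of positions permuting each of the two triples. -/
def triplePerm (s t : Equiv.Perm (Fin 3)) : Fin 7 → Fin 7 :=
  ![0, (![1, 2, 3] : Fin 3 → Fin 7) (s 0), (![1, 2, 3] : Fin 3 → Fin 7) (s 1),
    (![1, 2, 3] : Fin 3 → Fin 7) (s 2), (![4, 5, 6] : Fin 3 → Fin 7) (t 0),
    (![4, 5, 6] : Fin 3 → Fin 7) (t 1), (![4, 5, 6] : Fin 3 → Fin 7) (t 2)]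

lemma comp_triplePerm_left {α : Type*} (φ : Fin 7 → α) (s t : Equiv.Perm (Fin 3)) :
    ![(φ ∘ triplePerm s t) 1, (φ ∘ triplePerm s t) 2, (φ ∘ triplePerm s t) 3] =
      ![φ 1, φ 2, φ 3] ∘ s := by
  have h (i : Fin 3) : φ ((![1, 2, 3] : Fin 3 → Fin 7) i) = ![φ 1, φ 2, φ 3] i := by
    fin_cases i <;> rfl
  funext i
  fin_cases i <;> exact h _

lemma comp_triplePerm_right {α : Type*} (φ : Fin 7 → α) (s t : Equiv.Perm (Fin 3)) :
    ![(φ ∘ triplePerm s t) 4, (φ ∘ triplePerm s t) 5, (φ ∘ triplePerm s t) 6] =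
      ![φ 4, φ 5, φ 6] ∘ t := by
  have h (i : Fin 3) : φ ((![4, 5, 6] : Fin 3 → Fin 7) i) = ![φ 4, φ 5, φ 6] i := by
    fin_cases i <;> rfl
  funext i
  fin_cases i <;> exact h _

lemma rootedTriplesEquiv_comp_triplePerm {α : Type*} (φ : Fin 7 → α) (s t : Equiv.Perm (Fin 3)) :
    rootedTriplesEquiv α (φ ∘ triplePerm s t) =
      (φ 0, ![φ 1, φ 2, φ 3] ∘ s, ![φ 4, φ 5, φ 6] ∘ t) :=
  Prod.ext rfl (Prod.ext (comp_triplePerm_left φ s t) (comp_triplePerm_right φ s t))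

lemma triplePerm_injective (s t : Equiv.Perm (Fin 3)) : Function.Injective (triplePerm s t) := by
  have h : triplePerm s t ∘ triplePerm s⁻¹ t⁻¹ = id := by
    apply (rootedTriplesEquiv (Fin 7)).injective
    rw [rootedTriplesEquiv_comp_triplePerm]
    have h1 := comp_triplePerm_left id s t
    have h2 := comp_triplePerm_right id s t
    rw [Function.id_comp] at h1 h2
    rw [h1, h2, Function.comp_assoc, Function.comp_assoc]
    simp
    rfl
  exact Finite.injective_iff_surjective.2 (Function.RightInverse.surjective (congrFun h))

lemma triplePerm_inj {s t s' t' : Equiv.Perm (Fin 3)} (h : triplePerm s t = triplePerm s' t') :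
    s = s' ∧ t = t' := by
  have h1 := rootedTriplesEquiv_comp_triplePerm id s t
  rw [h, rootedTriplesEquiv_comp_triplePerm, Prod.mk.injEq, Prod.mk.injEq] at h1
  have hl : Function.Injective ![id (1 : Fin 7), id 2, id 3] := by decide +kernel
  have hr : Function.Injective ![id (4 : Fin 7), id 5, id 6] := by decide +kernel
  exact ⟨DFunLike.coe_injective (hl.comp_left h1.2.1.symm),
    DFunLike.coe_injective (hr.comp_left h1.2.2.symm)⟩

lemma splitWeight_comp_triplePerm {α : Type*} {A : α → α → Bool} (hA : ∀ x y, A x y = A y x)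
    (φ : Fin 7 → α) (s t : Equiv.Perm (Fin 3)) :
    splitWeight A (φ ∘ triplePerm s t) = splitWeight A φ := by
  rw [splitWeight, comp_triplePerm_left, comp_triplePerm_right, flagOf_comp_perm hA,
    flagOf_comp_perm hA]
  rfl

lemma splitKey_comp_triplePerm (φ : Fin 7 → Fin 7) (s t : Equiv.Perm (Fin 3)) :
    splitKey (φ ∘ triplePerm s t) = splitKey φ := by
  rw [splitKey, comp_triplePerm_left]
  exact congrArg _ (Equiv.sum_comp s fun i ↦ 2 ^ ((![φ 1, φ 2, φ 3] : Fin 3 → Fin 7) i : ℕ))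

lemma splitWeight_swapTriples (A : Fin 7 → Fin 7 → Bool) (φ : Fin 7 → Fin 7) :
    splitWeight A (swapTriples φ) = splitWeight A φ :=
  flagWeight_comm (flagOf_lt A _ _) (flagOf_lt A _ _)

lemma sum_perm_splitWeight {A : Fin 7 → Fin 7 → Bool} (hA : ∀ x y, A x y = A y x) :
    ∑ σ : Equiv.Perm (Fin 7), splitWeight A σ = 72 * (splits.map (splitWeight A)).sum := by
  let F : Fin orderedSplits.length × Equiv.Perm (Fin 3) × Equiv.Perm (Fin 3) →
      Equiv.Perm (Fin 7) := fun p ↦ Equiv.ofBijective (orderedSplits[p.1] ∘ triplePerm p.2.1 p.2.2)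
    (Finite.injective_iff_bijective.1 ((injective_of_mem_orderedSplits
      (List.getElem_mem _)).comp (triplePerm_injective _ _)))
  have hF : Function.Injective F := by
    rintro ⟨i, s, t⟩ ⟨j, s', t'⟩ h
    have h' : (orderedSplits[i] : Fin 7 → Fin 7) ∘ triplePerm s t =
      orderedSplits[j] ∘ triplePerm s' t' := congrArg (fun σ : Equiv.Perm (Fin 7) ↦ ⇑σ) h
    have hkey := congrArg splitKey h'
    rw [splitKey_comp_triplePerm, splitKey_comp_triplePerm] at hkey
    have hij := List.inj_on_of_nodup_map nodup_map_splitKey (List.getElem_mem _)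
      (List.getElem_mem _) hkey
    obtain rfl : i = j := Fin.ext
      ((List.Nodup.getElem_inj_iff (List.Nodup.of_map _ nodup_map_splitKey)).1 hij)
    obtain ⟨rfl, rfl⟩ := triplePerm_inj
      ((injective_of_mem_orderedSplits (List.getElem_mem _)).comp_left h')
    rfl
  have hF' : Function.Bijective F := by
    rw [Fintype.bijective_iff_injective_and_card]
    refine ⟨hF, ?_⟩
    have hlen : orderedSplits.length = 140 := by decide +kernel
    simp [Fintype.card_perm, hlen, Nat.factorial]
  rw [← hF'.sum_comp, Fintype.sum_prod_type]
  have h (i : Fin orderedSplits.length) :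
      ∑ p : Equiv.Perm (Fin 3) × Equiv.Perm (Fin 3), splitWeight A (F (i, p)) =
        36 * splitWeight A orderedSplits[i] := by
    have h (p : Equiv.Perm (Fin 3) × Equiv.Perm (Fin 3)) :
        splitWeight A (F (i, p)) = splitWeight A orderedSplits[i] :=
      splitWeight_comp_triplePerm hA _ _ _
    simp only [h, sum_const, card_univ, Fintype.card_prod, Fintype.card_perm, Fintype.card_fin]
    simp [Nat.factorial]
  simp_rw [h]
  rw [← mul_sum]
  have h2 : ∑ i : Fin orderedSplits.length, splitWeight A orderedSplits[i] =
      (orderedSplits.map (splitWeight A)).sum :=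
    Fin.sum_univ_fun_getElem orderedSplits (splitWeight A)
  rw [h2, orderedSplits, List.map_append, List.sum_append, List.map_map]
  have h3 : splitWeight A ∘ swapTriples = splitWeight A := funext (splitWeight_swapTriples A)
  rw [h3]
  ring

/-- The weight of two flags, shifted to be a natural number. -/
def pairWeight (b₀ b₁ b₂ b₃ b₄ b₅ c₀ c₁ c₂ c₃ c₄ c₅ : Bool) : ℕ :=
  (flagWeight (flagType b₀ b₁ b₂ b₃ b₄ b₅) (flagType c₀ c₁ c₂ c₃ c₄ c₅) + 320).toNat

/-- The shifted flag weights of the graph with the given edges, in the order of `splits`. -/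
def score (b0 b1 b2 b3 b4 b5 b6 b7 b8 b9 b10 b11 b12 b13 b14 b15 b16 b17 b18 b19 b20 :
    Bool) : ℕ :=
  Nat.add (pairWeight b0 b1 b2 b3 b4 b5 b6 b10 b14 b15 b19 b20) <|
  Nat.add (pairWeight b0 b1 b2 b6 b7 b8 b3 b10 b13 b15 b18 b20) <|
  Nat.add (pairWeight b0 b1 b2 b10 b11 b12 b3 b6 b9 b15 b18 b19) <|
  Nat.add (pairWeight b0 b1 b2 b15 b16 b17 b3 b6 b9 b10 b13 b14) <|
  Nat.add (pairWeight b0 b3 b4 b6 b7 b9 b1 b10 b12 b15 b17 b20) <|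
  Nat.add (pairWeight b0 b3 b4 b10 b11 b13 b1 b6 b8 b15 b17 b19) <|
  Nat.add (pairWeight b0 b3 b4 b15 b16 b18 b1 b6 b8 b10 b12 b14) <|
  Nat.add (pairWeight b0 b6 b7 b10 b11 b14 b1 b3 b5 b15 b17 b18) <|
  Nat.add (pairWeight b0 b6 b7 b15 b16 b19 b1 b3 b5 b10 b12 b13) <|
  Nat.add (pairWeight b0 b10 b11 b15 b16 b20 b1 b3 b5 b6 b8 b9) <|
  Nat.add (pairWeight b0 b2 b1 b4 b3 b5 b7 b11 b14 b16 b19 b20) <|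
  Nat.add (pairWeight b0 b2 b1 b7 b6 b8 b4 b11 b13 b16 b18 b20) <|
  Nat.add (pairWeight b0 b2 b1 b11 b10 b12 b4 b7 b9 b16 b18 b19) <|
  Nat.add (pairWeight b0 b2 b1 b16 b15 b17 b4 b7 b9 b11 b13 b14) <|
  Nat.add (pairWeight b0 b4 b3 b7 b6 b9 b2 b11 b12 b16 b17 b20) <|
  Nat.add (pairWeight b0 b4 b3 b11 b10 b13 b2 b7 b8 b16 b17 b19) <|
  Nat.add (pairWeight b0 b4 b3 b16 b15 b18 b2 b7 b8 b11 b12 b14) <|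
  Nat.add (pairWeight b0 b7 b6 b11 b10 b14 b2 b4 b5 b16 b17 b18) <|
  Nat.add (pairWeight b0 b7 b6 b16 b15 b19 b2 b4 b5 b11 b12 b13) <|
  Nat.add (pairWeight b0 b11 b10 b16 b15 b20 b2 b4 b5 b7 b8 b9) <|
  Nat.add (pairWeight b1 b2 b0 b5 b3 b4 b8 b12 b14 b17 b19 b20) <|
  Nat.add (pairWeight b1 b2 b0 b8 b6 b7 b5 b12 b13 b17 b18 b20) <|
  Nat.add (pairWeight b1 b2 b0 b12 b10 b11 b5 b8 b9 b17 b18 b19) <|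
  Nat.add (pairWeight b1 b2 b0 b17 b15 b16 b5 b8 b9 b12 b13 b14) <|
  Nat.add (pairWeight b1 b5 b3 b8 b6 b9 b2 b12 b11 b17 b16 b20) <|
  Nat.add (pairWeight b1 b5 b3 b12 b10 b13 b2 b8 b7 b17 b16 b19) <|
  Nat.add (pairWeight b1 b5 b3 b17 b15 b18 b2 b8 b7 b12 b11 b14) <|
  Nat.add (pairWeight b1 b8 b6 b12 b10 b14 b2 b5 b4 b17 b16 b18) <|
  Nat.add (pairWeight b1 b8 b6 b17 b15 b19 b2 b5 b4 b12 b11 b13) <|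
  Nat.add (pairWeight b1 b12 b10 b17 b15 b20 b2 b5 b4 b8 b7 b9) <|
  Nat.add (pairWeight b3 b4 b0 b5 b1 b2 b9 b13 b14 b18 b19 b20) <|
  Nat.add (pairWeight b3 b4 b0 b9 b6 b7 b5 b13 b12 b18 b17 b20) <|
  Nat.add (pairWeight b3 b4 b0 b13 b10 b11 b5 b9 b8 b18 b17 b19) <|
  Nat.add (pairWeight b3 b4 b0 b18 b15 b16 b5 b9 b8 b13 b12 b14) <|
  Nat.add (pairWeight b3 b5 b1 b9 b6 b8 b4 b13 b11 b18 b16 b20) <|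
  Nat.add (pairWeight b3 b5 b1 b13 b10 b12 b4 b9 b7 b18 b16 b19) <|
  Nat.add (pairWeight b3 b5 b1 b18 b15 b17 b4 b9 b7 b13 b11 b14) <|
  Nat.add (pairWeight b3 b9 b6 b13 b10 b14 b4 b5 b2 b18 b16 b17) <|
  Nat.add (pairWeight b3 b9 b6 b18 b15 b19 b4 b5 b2 b13 b11 b12) <|
  Nat.add (pairWeight b3 b13 b10 b18 b15 b20 b4 b5 b2 b9 b7 b8) <|
  Nat.add (pairWeight b6 b7 b0 b8 b1 b2 b9 b14 b13 b19 b18 b20) <|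
  Nat.add (pairWeight b6 b7 b0 b9 b3 b4 b8 b14 b12 b19 b17 b20) <|
  Nat.add (pairWeight b6 b7 b0 b14 b10 b11 b8 b9 b5 b19 b17 b18) <|
  Nat.add (pairWeight b6 b7 b0 b19 b15 b16 b8 b9 b5 b14 b12 b13) <|
  Nat.add (pairWeight b6 b8 b1 b9 b3 b5 b7 b14 b11 b19 b16 b20) <|
  Nat.add (pairWeight b6 b8 b1 b14 b10 b12 b7 b9 b4 b19 b16 b18) <|
  Nat.add (pairWeight b6 b8 b1 b19 b15 b17 b7 b9 b4 b14 b11 b13) <|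
  Nat.add (pairWeight b6 b9 b3 b14 b10 b13 b7 b8 b2 b19 b16 b17) <|
  Nat.add (pairWeight b6 b9 b3 b19 b15 b18 b7 b8 b2 b14 b11 b12) <|
  Nat.add (pairWeight b6 b14 b10 b19 b15 b20 b7 b8 b2 b9 b4 b5) <|
  Nat.add (pairWeight b10 b11 b0 b12 b1 b2 b13 b14 b9 b20 b18 b19) <|
  Nat.add (pairWeight b10 b11 b0 b13 b3 b4 b12 b14 b8 b20 b17 b19) <|
  Nat.add (pairWeight b10 b11 b0 b14 b6 b7 b12 b13 b5 b20 b17 b18) <|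
  Nat.add (pairWeight b10 b11 b0 b20 b15 b16 b12 b13 b5 b14 b8 b9) <|
  Nat.add (pairWeight b10 b12 b1 b13 b3 b5 b11 b14 b7 b20 b16 b19) <|
  Nat.add (pairWeight b10 b12 b1 b14 b6 b8 b11 b13 b4 b20 b16 b18) <|
  Nat.add (pairWeight b10 b12 b1 b20 b15 b17 b11 b13 b4 b14 b7 b9) <|
  Nat.add (pairWeight b10 b13 b3 b14 b6 b9 b11 b12 b2 b20 b16 b17) <|
  Nat.add (pairWeight b10 b13 b3 b20 b15 b18 b11 b12 b2 b14 b7 b8) <|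
  Nat.add (pairWeight b10 b14 b6 b20 b15 b19 b11 b12 b2 b13 b4 b5) <|
  Nat.add (pairWeight b15 b16 b0 b17 b1 b2 b18 b19 b9 b20 b13 b14) <|
  Nat.add (pairWeight b15 b16 b0 b18 b3 b4 b17 b19 b8 b20 b12 b14) <|
  Nat.add (pairWeight b15 b16 b0 b19 b6 b7 b17 b18 b5 b20 b12 b13) <|
  Nat.add (pairWeight b15 b16 b0 b20 b10 b11 b17 b18 b5 b19 b8 b9) <|
  Nat.add (pairWeight b15 b17 b1 b18 b3 b5 b16 b19 b7 b20 b11 b14) <|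
  Nat.add (pairWeight b15 b17 b1 b19 b6 b8 b16 b18 b4 b20 b11 b13) <|
  Nat.add (pairWeight b15 b17 b1 b20 b10 b12 b16 b18 b4 b19 b7 b9) <|
  Nat.add (pairWeight b15 b18 b3 b19 b6 b9 b16 b17 b2 b20 b11 b12) <|
  Nat.add (pairWeight b15 b18 b3 b20 b10 b13 b16 b17 b2 b19 b7 b8) <|
  pairWeight b15 b19 b6 b20 b10 b14 b16 b17 b2 b18 b4 b5

/-- The number of true arguments. -/
def edgeCount (b0 b1 b2 b3 b4 b5 b6 b7 b8 b9 b10 b11 b12 b13 b14 b15 b16 b17 b18 b19 b20 : Bool) :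
    ℕ :=
  Nat.add b0.toNat <| Nat.add b1.toNat <| Nat.add b2.toNat <| Nat.add b3.toNat <|
  Nat.add b4.toNat <| Nat.add b5.toNat <| Nat.add b6.toNat <| Nat.add b7.toNat <|
  Nat.add b8.toNat <| Nat.add b9.toNat <| Nat.add b10.toNat <| Nat.add b11.toNat <|
  Nat.add b12.toNat <| Nat.add b13.toNat <| Nat.add b14.toNat <| Nat.add b15.toNat <|
  Nat.add b16.toNat <| Nat.add b17.toNat <| Nat.add b18.toNat <| Nat.add b19.toNat b20.toNat

/-- Application of a predicate to an evaluated boolean. -/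
def forBool (b : Bool) (f : Bool → Bool) : Bool :=
  match b with
  | true => f true
  | false => f false

/-- Some entry of the list is contained in the graph `g` and has value at least `s`, after
rescaling. -/
def hasPack (g s : ℕ) : List (ℕ × ℕ × List ℕ) → Bool
  | [] => false
  | q :: l => or (and (Nat.beq (Nat.land q.1 g) q.1)
      (Nat.ble s (Nat.add 57680 (Nat.mul 840 q.2.1)))) (hasPack g s l)

/-- The flag algebra inequality for the graph on seven vertices encoded by `g`. -/
def checkGraph (g : ℕ) : Bool :=
  forBool (bitAt g 0) fun b0 ↦ forBool (bitAt g 1) fun b1 ↦ forBool (bitAt g 2) fun b2 ↦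
  forBool (bitAt g 3) fun b3 ↦ forBool (bitAt g 4) fun b4 ↦ forBool (bitAt g 5) fun b5 ↦
  forBool (bitAt g 6) fun b6 ↦ forBool (bitAt g 7) fun b7 ↦ forBool (bitAt g 8) fun b8 ↦
  forBool (bitAt g 9) fun b9 ↦ forBool (bitAt g 10) fun b10 ↦ forBool (bitAt g 11) fun b11 ↦
  forBool (bitAt g 12) fun b12 ↦ forBool (bitAt g 13) fun b13 ↦ forBool (bitAt g 14) fun b14 ↦
  forBool (bitAt g 15) fun b15 ↦ forBool (bitAt g 16) fun b16 ↦ forBool (bitAt g 17) fun b17 ↦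
  forBool (bitAt g 18) fun b18 ↦ forBool (bitAt g 19) fun b19 ↦ forBool (bitAt g 20) fun b20 ↦
  hasPack g (Nat.add
    (Nat.mul 3360
      (edgeCount b0 b1 b2 b3 b4 b5 b6 b7 b8 b9 b10 b11 b12 b13 b14 b15 b16 b17 b18 b19 b20))
    (score b0 b1 b2 b3 b4 b5 b6 b7 b8 b9 b10 b11 b12 b13 b14 b15 b16 b17 b18 b19 b20)) packs

lemma forBool_eq (b : Bool) (f : Bool → Bool) : forBool b f = f b := by
  cases b <;> rfl

lemma hasPack_eq_true {g s : ℕ} {l : List (ℕ × ℕ × List ℕ)} (h : hasPack g s l = true) :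
    ∃ q ∈ l, Nat.land q.1 g = q.1 ∧ s ≤ 57680 + 840 * q.2.1 := by
  induction l with
  | nil => simp [hasPack] at h
  | cons q l ih =>
    rw [hasPack, Bool.or_eq_true, Bool.and_eq_true, Nat.beq_eq, Nat.ble_eq] at h
    rcases h with h | h
    · exact ⟨q, List.mem_cons_self, h⟩
    · obtain ⟨q', hq', h⟩ := ih h
      exact ⟨q', List.mem_cons_of_mem _ hq', h⟩

lemma pairWeight_cast (b₀ b₁ b₂ b₃ b₄ b₅ c₀ c₁ c₂ c₃ c₄ c₅ : Bool) :
    (pairWeight b₀ b₁ b₂ b₃ b₄ b₅ c₀ c₁ c₂ c₃ c₄ c₅ : ℤ) =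
      flagWeight (flagType b₀ b₁ b₂ b₃ b₄ b₅) (flagType c₀ c₁ c₂ c₃ c₄ c₅) + 320 := by
  have h := (flagWeight_mem_Icc (flagType_lt b₀ b₁ b₂ b₃ b₄ b₅) (flagType_lt c₀ c₁ c₂ c₃ c₄ c₅)).1
  rw [pairWeight, Int.toNat_of_nonneg (by lia)]

/-- The adjacency matrix of the graph on seven vertices with the given edges. -/
def bitAdj (x : ℕ → Bool) (i j : Fin 7) : Bool := bif Nat.beq i j then false else x (pairIdx i j)

/-- The shifted weight of a split. -/
def splitPairWeight (A : Fin 7 → Fin 7 → Bool) (φ : Fin 7 → Fin 7) : ℕ :=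
  pairWeight (A (φ 0) (φ 1)) (A (φ 0) (φ 2)) (A (φ 1) (φ 2)) (A (φ 0) (φ 3)) (A (φ 1) (φ 3))
    (A (φ 2) (φ 3)) (A (φ 0) (φ 4)) (A (φ 0) (φ 5)) (A (φ 4) (φ 5)) (A (φ 0) (φ 6))
    (A (φ 4) (φ 6)) (A (φ 5) (φ 6))

lemma natAdd_eq_sum_cons {α : Type*} {f : α → ℕ} {a b : ℕ} {c : α} {l : List α} (ha : a = f c)
    (hb : b = (l.map f).sum) : Nat.add a b = ((c :: l).map f).sum := by
  rw [List.map_cons, List.sum_cons, ← ha, ← hb]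
  rfl

lemma score_eq_foldr (x : ℕ → Bool) :
    score (x 0) (x 1) (x 2) (x 3) (x 4) (x 5) (x 6) (x 7) (x 8) (x 9) (x 10) (x 11) (x 12) (x 13)
      (x 14) (x 15) (x 16) (x 17) (x 18) (x 19) (x 20) =
      (splits.map (splitPairWeight (bitAdj x))).sum := by
  unfold score
  rw [splits, splitCodes]
  iterate 69 refine natAdd_eq_sum_cons ?_ ?_; unfold splitPairWeight; rfl
  refine (add_zero _).symm.trans (natAdd_eq_sum_cons ?_ ?_)
  · rfl
  · rfl

lemma sum_map_splitPairWeight (A : Fin 7 → Fin 7 → Bool) (l : List (Fin 7 → Fin 7)) :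
    ((l.map (splitPairWeight A)).sum : ℤ) = (l.map (splitWeight A)).sum + 320 * l.length := by
  induction l with
  | nil => simp
  | cons φ l ih =>
    have h : (splitPairWeight A φ : ℤ) = splitWeight A φ + 320 := pairWeight_cast ..
    simp only [List.map_cons, List.sum_cons, List.length_cons]
    rw [Nat.cast_add, Nat.cast_succ, ih, h]
    ring

open Classical in
/-- The adjacency relation of `G` as a boolean function. -/
noncomputable def adjBool {V : Type*} (G : SimpleGraph V) (u v : V) : Bool := decide (G.Adj u v)

lemma adjBool_eq_true {V : Type*} {G : SimpleGraph V} {u v : V} :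
    adjBool G u v = true ↔ G.Adj u v := by
  simp [adjBool]

lemma adjBool_comm {V : Type*} (G : SimpleGraph V) (u v : V) : adjBool G u v = adjBool G v u := by
  rw [Bool.eq_iff_iff, adjBool_eq_true, adjBool_eq_true, G.adj_comm]

lemma adjBool_maskGraph (g : ℕ) : adjBool (maskGraph 7 g) = bitAdj (bitAt g) := by
  funext i j
  rw [bitAdj, Bool.eq_iff_iff, adjBool_eq_true]
  by_cases hij : i = j
  · simp [hij]
  · have h : Nat.beq i j = false := by
      rw [← Bool.not_eq_true, Nat.beq_eq, ← Fin.ext_iff]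
      exact hij
    simp [maskGraph, hij, h]

lemma edgeCount_eq_sum (x : ℕ → Bool) :
    edgeCount (x 0) (x 1) (x 2) (x 3) (x 4) (x 5) (x 6) (x 7) (x 8) (x 9) (x 10) (x 11) (x 12)
      (x 13) (x 14) (x 15) (x 16) (x 17) (x 18) (x 19) (x 20) =
      ∑ i ∈ range 21, (x i).toNat := by
  have h : ∑ i ∈ range 21, (x i).toNat = ((List.range 21).map fun i ↦ (x i).toNat).sum :=
    Multiset.sum_coe _
  have hrange : List.range 21 =
      [0, 1, 2, 3, 4, 5, 6, 7, 8, 9, 10, 11, 12, 13, 14, 15, 16, 17, 18, 19, 20] := rfl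
  rw [h, hrange]
  unfold edgeCount
  iterate 20 refine natAdd_eq_sum_cons rfl ?_
  rw [List.map_singleton, List.sum_singleton]

lemma piFrac_maskGraph_add_le {g : ℕ} (hg : checkGraph g = true) :
    1680 * piFrac (maskGraph 7 g) 3 +
      ((splits.map (splitWeight (adjBool (maskGraph 7 g)))).sum : ℤ) ≤ 35280 := by
  simp only [checkGraph, forBool_eq] at hg
  obtain ⟨q, hq, hland, hle⟩ := hasPack_eq_true hg
  rw [edgeCount_eq_sum (bitAt g), score_eq_foldr (bitAt g)] at hle
  have h := piFrac_maskGraph_le (List.all_eq_true.1 packs_isPacking q hq) hland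
  rw [sum_adj_maskGraph_seven] at h
  have hsum := sum_map_splitPairWeight (bitAdj (bitAt g)) splits
  have hlen : splits.length = 70 := by decide +kernel
  rw [hlen] at hsum
  have hle' : 3360 * (∑ i ∈ range 21, (bitAt g i).toNat) +
      (splits.map (splitPairWeight (bitAdj (bitAt g)))).sum ≤ 57680 + 840 * q.2.1 := hle
  have hsum' : ((splits.map (splitPairWeight (bitAdj (bitAt g)))).sum : ℝ) =
      ((splits.map (splitWeight (bitAdj (bitAt g)))).sum : ℤ) + 22400 := by
    have h := congrArg (Int.cast : ℤ → ℝ) hsum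
    rw [Int.cast_natCast] at h
    rw [h, Int.cast_add]
    norm_num
  rw [adjBool_maskGraph]
  have hle'' : 3360 * ((∑ i ∈ range 21, (bitAt g i).toNat : ℕ) : ℝ) +
      ((splits.map (splitPairWeight (bitAdj (bitAt g)))).sum : ℕ) ≤ 57680 + 840 * (q.2.1 : ℝ) := by
    exact_mod_cast hle'
  rw [hsum'] at hle''
  linarith

set_option maxRecDepth 100000 in
lemma checkGraph_of_mem_extensions {g : ℕ} (hg : g ∈ extensions 6 reps6) :
    checkGraph g = true := by
  have h : (reps6.all fun r ↦
      forallBelow (fun s ↦ checkGraph (Nat.add r (Nat.mul s 32768))) 64) = true := by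
    decide +kernel
  rw [extensions, List.mem_flatMap] at hg
  obtain ⟨r, hr, hg⟩ := hg
  obtain ⟨s, hs, rfl⟩ := List.mem_map.1 hg
  exact forallBelow_eq_true.1 (List.all_eq_true.1 h r hr) s (List.mem_range.1 hs)

/-- The flag algebra inequality for graphs on seven vertices. -/
lemma piFrac_add_sum_perm_le (H : SimpleGraph (Fin 7)) :
    120960 * piFrac H 3 + (∑ σ : Equiv.Perm (Fin 7), splitWeight (adjBool H) σ : ℤ) ≤
      2540160 := by
  obtain ⟨g, hg, ⟨e⟩⟩ := coversGraphs_extensions_reps6 H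
  have h := piFrac_maskGraph_add_le (checkGraph_of_mem_extensions hg)
  have hA : adjBool H = fun i j ↦ adjBool (maskGraph 7 g) (e i) (e j) := by
    funext i j
    rw [Bool.eq_iff_iff, adjBool_eq_true, adjBool_eq_true, e.map_adj_iff]
  have hsum : ∑ σ : Equiv.Perm (Fin 7), splitWeight (adjBool H) σ =
      ∑ σ : Equiv.Perm (Fin 7), splitWeight (adjBool (maskGraph 7 g)) σ := by
    rw [hA]
    exact Equiv.sum_comp (Equiv.mulLeft (e.toEquiv : Equiv.Perm (Fin 7)))
      fun σ : Equiv.Perm (Fin 7) ↦ splitWeight (adjBool (maskGraph 7 g)) σ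
  rw [hsum, sum_perm_splitWeight (adjBool_comm _), piFrac_congr e, Int.cast_mul]
  norm_num only [Int.cast_ofNat]
  linarith

lemma card_filter_map_eq {α : Type*} [Fintype α] [DecidableEq α] {W : Finset α} (hW : #W = 7) :
    #{φ : Fin 7 ↪ α | univ.map φ = W} = 5040 := by
  have h : ({φ : Fin 7 ↪ α | univ.map φ = W} : Finset (Fin 7 ↪ α)) =
      univ.image fun ψ : Fin 7 ↪ W ↦ ψ.trans (Function.Embedding.subtype (· ∈ W)) := by
    ext φ
    simp only [mem_filter, mem_univ, true_and, mem_image]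
    constructor
    · rintro rfl
      exact ⟨⟨fun i ↦ ⟨φ i, mem_map_of_mem _ (mem_univ i)⟩, fun i j hij ↦
        φ.injective (congrArg Subtype.val hij)⟩, rfl⟩
    · rintro ⟨ψ, rfl⟩
      refine eq_of_subset_of_card_le (fun x hx ↦ ?_) (by simp [hW])
      obtain ⟨i, -, rfl⟩ := mem_map.1 hx
      exact (ψ i).2
  rw [h, card_image_of_injective, card_univ, Fintype.card_embedding_eq]
  · simp [hW, Nat.descFactorial]
  · intro ψ ψ' hψ
    ext i
    exact congrArg (fun φ : Fin 7 ↪ α ↦ φ i) hψ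

lemma sum_embedding_piFrac {n : ℕ} (G : SimpleGraph (Fin n)) :
    ∑ φ : Fin 7 ↪ Fin n, piFrac (G.comap φ) 3 = 5040 *
      ∑ W ∈ powersetCard 7 (univ : Finset (Fin n)), piFrac (G.induce (W : Set (Fin n))) 3 := by
  rw [← sum_fiberwise_of_maps_to (g := fun φ : Fin 7 ↪ Fin n ↦ univ.map φ)
    (t := powersetCard 7 univ) fun φ _ ↦ by simp [mem_powersetCard], mul_sum]
  refine sum_congr rfl fun W hW ↦ ?_
  have h (φ : Fin 7 ↪ Fin n) (hφ : φ ∈ ({φ | univ.map φ = W} : Finset (Fin 7 ↪ Fin n))) :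
      piFrac (G.comap φ) 3 = piFrac (G.induce (W : Set (Fin n))) 3 := by
    obtain rfl := (mem_filter.1 hφ).2
    refine piFrac_congr ⟨(Equiv.ofInjective φ φ.injective).trans
      (Equiv.setCongr (by simp)), ?_⟩ 3
    intro i j
    rfl
  rw [sum_congr rfl h, sum_const, card_filter_map_eq (mem_powersetCard.1 hW).2, nsmul_eq_mul]
  norm_num

lemma sum_embedding_sum_perm_splitWeight {n : ℕ} (A : Fin n → Fin n → Bool) :
    ∑ φ : Fin 7 ↪ Fin n, ∑ σ : Equiv.Perm (Fin 7), splitWeight A (φ ∘ σ) =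
      5040 * ∑ φ : Fin 7 ↪ Fin n, splitWeight A φ := by
  rw [sum_comm]
  have h (σ : Equiv.Perm (Fin 7)) :
      ∑ φ : Fin 7 ↪ Fin n, splitWeight A (φ ∘ σ) = ∑ φ : Fin 7 ↪ Fin n, splitWeight A φ :=
    Fintype.sum_equiv (σ.symm.embeddingCongr (Equiv.refl _)) _ _ fun φ ↦ rfl
  simp only [h, sum_const, card_univ, Fintype.card_perm, Fintype.card_fin, nsmul_eq_mul]
  rfl

lemma sum_embedding_splitWeight_ge {n : ℕ} (A : Fin n → Fin n → Bool) :
    1176 * (n.descFactorial 7 : ℤ) - ∑ φ : Fin 7 ↪ Fin n, splitWeight A φ ≤ 1176 * n ^ 7 := by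
  have h0 (f : Fin 7 → Fin n) : 0 ≤ 1176 - splitWeight A f :=
    sub_nonneg.2 (flagWeight_mem_Icc (flagOf_lt A _ _) (flagOf_lt A _ _)).2
  have h : ∑ φ : Fin 7 ↪ Fin n, (1176 - splitWeight A φ) ≤
      ∑ f : Fin 7 → Fin n, (1176 - splitWeight A f) := by
    exact (sum_map univ ⟨fun φ : Fin 7 ↪ Fin n ↦ ⇑φ, DFunLike.coe_injective⟩
      fun f ↦ 1176 - splitWeight A f).ge.trans (sum_le_univ_sum_of_nonneg h0)
  simp only [sum_sub_distrib, sum_const, card_univ, Fintype.card_embedding_eq, Fintype.card_fin,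
    Fintype.card_fun, nsmul_eq_mul] at h
  push_cast at h
  have := sum_splitWeight_nonneg A
  linarith

lemma sum_piFrac_induce_le {n : ℕ} (G : SimpleGraph (Fin n)) :
    5040 * ∑ W ∈ powersetCard 7 (univ : Finset (Fin n)), piFrac (G.induce (W : Set (Fin n))) 3 ≤
      21 * n.descFactorial 7 + 49 * ((n : ℝ) ^ 7 - n.descFactorial 7) := by
  have h : ∑ φ : Fin 7 ↪ Fin n, (120960 * piFrac (G.comap φ) 3 +
      (∑ σ : Equiv.Perm (Fin 7), splitWeight (adjBool G) (φ ∘ σ) : ℤ)) ≤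
      ∑ φ : Fin 7 ↪ Fin n, (2540160 : ℝ) :=
    sum_le_sum fun φ _ ↦ piFrac_add_sum_perm_le (G.comap φ)
  rw [sum_add_distrib, ← mul_sum, sum_embedding_piFrac, ← Int.cast_sum,
    sum_embedding_sum_perm_splitWeight, sum_const, card_univ, Fintype.card_embedding_eq,
    Fintype.card_fin, Fintype.card_fin, nsmul_eq_mul] at h
  have h' : 1176 * (n.descFactorial 7 : ℝ) -
      (∑ φ : Fin 7 ↪ Fin n, splitWeight (adjBool G) φ : ℤ) ≤ 1176 * (n : ℝ) ^ 7 := by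
    exact_mod_cast sum_embedding_splitWeight_ge (adjBool G)
  push_cast at h h'
  linarith

open Filter in
lemma exists_pow_le_mul_descFactorial {δ : ℝ} (hδ : 0 < δ) :
    ∃ N : ℕ, ∀ n : ℕ, N ≤ n → (n : ℝ) ^ 7 ≤ (1 + δ) * n.descFactorial 7 ∧
      0 < n.descFactorial 7 := by
  have h : Tendsto (fun m : ℕ ↦ (1 + (6 : ℝ) / m) ^ 7) atTop (nhds 1) := by
    simpa using ((tendsto_const_div_atTop_nhds_zero_nat (6 : ℝ)).const_add 1).pow 7
  obtain ⟨M, hM⟩ := eventually_atTop.1 (h.eventually (gt_mem_nhds (lt_add_of_pos_right 1 hδ)))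
  refine ⟨M + 7, fun n hn ↦ ?_⟩
  obtain ⟨m, rfl⟩ : ∃ m, n = m + 6 := ⟨n - 6, by lia⟩
  have hm : (0 : ℝ) < m := by
    exact_mod_cast (by lia : 0 < m)
  refine ⟨?_, Nat.descFactorial_pos.2 (by lia)⟩
  have h1 : (m : ℝ) ^ 7 ≤ (m + 6).descFactorial 7 := by
    exact_mod_cast Nat.pow_sub_le_descFactorial (m + 6) 7
  calc ((m + 6 : ℕ) : ℝ) ^ 7 = (1 + (6 : ℝ) / m) ^ 7 * (m : ℝ) ^ 7 := by
        rw [← mul_pow]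
        congr 1
        push_cast
        field_simp
    _ ≤ (1 + δ) * (m + 6).descFactorial 7 := by
        gcongr
        exact (hM m (by lia)).le

/-- For every `ε > 0` there is `N` such that for every graph `G` on `n ≥ N` vertices,
the average of `π_{3,f}(G[W])` over all `7`-element subsets `W` of the vertex set
is at most `21 + ε`. -/
theorem average_piFrac_of_seven_subsets :
    ∀ ε : ℝ, 0 < ε → ∃ N : ℕ, ∀ n : ℕ, N ≤ n → ∀ G : SimpleGraph (Fin n),
      (1 / (n.choose 7 : ℝ)) *
        ∑ W ∈ Finset.powersetCard 7 (univ : Finset (Fin n)),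
          piFrac (G.induce (W : Set (Fin n))) 3 ≤ 21 + ε := by
  intro ε hε
  obtain ⟨N, hN⟩ := exists_pow_le_mul_descFactorial (div_pos hε (by norm_num : (0 : ℝ) < 49))
  refine ⟨N, fun n hn G ↦ ?_⟩
  obtain ⟨hpow, hpos⟩ := hN n hn
  have h := sum_piFrac_induce_le G
  have hchoose : (n.descFactorial 7 : ℝ) = 5040 * n.choose 7 := by
    exact_mod_cast Nat.descFactorial_eq_factorial_mul_choose n 7
  have hpos' : (0 : ℝ) < n.choose 7 := by
    have : (0 : ℝ) < n.descFactorial 7 := by exact_mod_cast hpos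
    linarith
  rw [one_div, inv_mul_le_iff₀ hpos']
  rw [hchoose] at h hpow
  linarith
end

section
/- The symmetric 7×7 real matrix M = (1/(12·10⁹)) · A, where A is the symmetric matrix with rows (1800000000, 2444365956, 640188285, −1524146769, 1386815580, −732139362, −129387078), (2444365956, 4759879134, 1177441152, −1783771230, 2546923788, −1397639394, −143552208), (640188285, 1177441152, 484273772, −317303211, 1038156300, −591902130, −6783162), (−1524146769, −1783771230, −317303211, 1558870290, −651906630, 305728704, 154602378), (1386815580, 2546923788, 1038156300, −651906630, 2285399634, −1283125950, −10755036), (−732139362, −1397639394, −591902130, 305728704, −1283125950, 734039016, −1621938), (−129387078, −143552208, −6783162, 154602378, −10755036, −1621938, 23860164), is positive semidefinite, has rank six, and the vector (1, 0, 3, 1, 0, 3, 0) spans its kernel (i.e., M·(1,0,3,1,0,3,0)ᵀ = 0). -/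
/-- The symmetric integer matrix `A` from the flag-algebra proof. -/
noncomputable def flagMatrixA : Matrix (Fin 7) (Fin 7) ℝ :=
  !![1800000000, 2444365956, 640188285, -1524146769, 1386815580, -732139362, -129387078;
     2444365956, 4759879134, 1177441152, -1783771230, 2546923788, -1397639394, -143552208;
     640188285, 1177441152, 484273772, -317303211, 1038156300, -591902130, -6783162;
     -1524146769, -1783771230, -317303211, 1558870290, -651906630, 305728704, 154602378;
     1386815580, 2546923788, 1038156300, -651906630, 2285399634, -1283125950, -10755036;
     -732139362, -1397639394, -591902130, 305728704, -1283125950, 734039016, -1621938;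
     -129387078, -143552208, -6783162, 154602378, -10755036, -1621938, 23860164]

/-- The matrix `M = (1/(12·10⁹)) · A`. -/
noncomputable def flagMatrixM : Matrix (Fin 7) (Fin 7) ℝ :=
  (1 / (12 * 10 ^ 9) : ℝ) • flagMatrixA

/-- The rows of the upper factor in a square-root-free Cholesky decomposition of `A`. -/
noncomputable def flagCholeskyFactor : Matrix (Fin 6) (Fin 7) ℝ :=
  !![-21564513, -23925368, -1130527, 25767063, -1792506, -270323, 3976694;
     440251173537921, 822584862670302, 343022589224019, -192942291158496, 755754712130815, -425458883350494, 0;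
     27704890949178679651364, 150457726354426043012463, 1259603932822767037566, -27700697368286446105799, 0, -1261001793120178219421, 0;
     -15352928590721466558076384364338, 0, -363723562200346910833971142038, 18455805305766824011993344623887, 0, -670568676148105573805015611145, 0;
     -137446704545304202513531109908871832024, 0, 227140124845742275900693802326957454783, 0, 0, -181324556663974208396183432357333510775, 0;
     -3, 0, 0, 0, 0, 1, 0]

/-- The positive weights in the square-root-free Cholesky decomposition of `A`. -/
noncomputable def flagCholeskyWeights : Fin 6 → ℝ :=
  ![3 / 1988347,
     6 / 1502702614601169612805,
     2 / 37903045222948730511745943264110449115,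
     1 / 925606168115209690739356858672773635334355247729501227,
     1 / 4192053921280589104049679600329461482624497741952874672935469944201521,
     626261316068631497286752146904414984539970811 / 227140124845742275900693802326957454783]

theorem flagCholeskyWeights_nonneg : 0 ≤ flagCholeskyWeights := by
  intro i
  fin_cases i <;> norm_num [flagCholeskyWeights]

theorem flagMatrixA_eq_cholesky :
    flagMatrixA = flagCholeskyFactor.conjTranspose *
      Matrix.diagonal flagCholeskyWeights * flagCholeskyFactor := by
  ext i j
  rw [Matrix.mul_apply]
  simp only [Matrix.mul_diagonal, Matrix.conjTranspose_apply, star_trivial]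
  fin_cases i <;> fin_cases j <;>
    norm_num [flagMatrixA, flagCholeskyFactor, flagCholeskyWeights, Fin.sum_univ_succ]

theorem flagMatrixA_posSemidef : flagMatrixA.PosSemidef := by
  rw [flagMatrixA_eq_cholesky]
  exact (Matrix.PosSemidef.diagonal flagCholeskyWeights_nonneg).conjTranspose_mul_mul_same _

theorem flagMatrixM_posSemidef : flagMatrixM.PosSemidef :=
  flagMatrixA_posSemidef.smul (by positivity)

theorem flagMatrixA_mulVec_eq_zero_iff (x : Fin 7 → ℝ) :
    flagMatrixA.mulVec x = 0 ↔ ∃ c : ℝ, x = c • ![1, 0, 3, 1, 0, 3, 0] := by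
  constructor
  · intro h
    have h0 := congrFun h 0
    have h1 := congrFun h 1
    have h2 := congrFun h 2
    have h3 := congrFun h 3
    have h4 := congrFun h 4
    have h5 := congrFun h 5
    have h6 := congrFun h 6
    simp [flagMatrixA, Matrix.mulVec, dotProduct, Fin.sum_univ_seven]
      at h0 h1 h2 h3 h4 h5 h6
    refine ⟨x 0, funext fun i => ?_⟩
    fin_cases i <;> simp <;> linarith
  · rintro ⟨c, rfl⟩
    rw [Matrix.mulVec_smul]
    suffices flagMatrixA.mulVec ![1, 0, 3, 1, 0, 3, 0] = 0 by rw [this, smul_zero]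
    ext i
    fin_cases i <;> norm_num [flagMatrixA, Matrix.mulVec, dotProduct, Fin.sum_univ_succ]

theorem flagMatrixM_mulVec_eq_zero_iff (x : Fin 7 → ℝ) :
    flagMatrixM.mulVec x = 0 ↔ ∃ c : ℝ, x = c • ![1, 0, 3, 1, 0, 3, 0] := by
  rw [flagMatrixM, Matrix.smul_mulVec, smul_eq_zero_iff_right (by norm_num),
    flagMatrixA_mulVec_eq_zero_iff]

theorem flagMatrixM_rank : flagMatrixM.rank = 6 := by
  have hker : LinearMap.ker flagMatrixM.mulVecLin = Submodule.span ℝ {![1, 0, 3, 1, 0, 3, 0]} := by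
    ext x
    rw [LinearMap.mem_ker, Matrix.mulVecLin_apply, flagMatrixM_mulVec_eq_zero_iff,
      Submodule.mem_span_singleton]
    simp only [eq_comm]
  have hne : (![1, 0, 3, 1, 0, 3, 0] : Fin 7 → ℝ) ≠ 0 := fun h => one_ne_zero (congrFun h 0)
  have hdim := flagMatrixM.mulVecLin.finrank_range_add_finrank_ker
  rw [hker, finrank_span_singleton hne, Module.finrank_fin_fun] at hdim
  rw [Matrix.rank]
  omega

/-- `M` is positive semidefinite, has rank six, and its kernel is spanned by the
vector `(1, 0, 3, 1, 0, 3, 0)`. -/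
theorem flagMatrixM_psd_rank_kernel :
    flagMatrixM.PosSemidef ∧ flagMatrixM.rank = 6 ∧
      ∀ x : Fin 7 → ℝ,
        flagMatrixM.mulVec x = 0 ↔ ∃ c : ℝ, x = c • ![1, 0, 3, 1, 0, 3, 0] :=
  ⟨flagMatrixM_posSemidef, flagMatrixM_rank, flagMatrixM_mulVec_eq_zero_iff⟩
end
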